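/- For every δ with 0 < δ < 1/5 there exists a weak solution (v,p) of the incompressible Euler equations on ℝ×𝕋³ such that: v is Hölder continuous of exponent 1/5−δ jointly in time and space, p is Hölder continuous of exponent 2(1/5−δ) jointly in time and space, v is not identically zero, and there is a compact interval [a,b] ⊂ ℝ such that v(t,x)=0 and p(t,x)=0 for all t ∉ [a,b]. -/

import Mathlib

noncomputable section

open MeasureTheory

/-- Points of space; functions on the torus 𝕋³ = ℝ³/ℤ³ are identified with
ℤ³-periodic functions on ℝ³. -/
abbrev Spc : Type := Fin 3 → ℝ

/-- The fundamental domain [0,1)³ of the torus. -/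
def Tdom : Set Spc := Set.univ.pi fun _ => Set.Ico (0 : ℝ) 1

/-- ℤ³-periodicity of a function on ℝ³. -/
def Per {α : Type*} (f : Spc → α) : Prop :=
  ∀ (x : Spc) (k : Fin 3 → ℤ), f (fun i => x i + (k i : ℝ)) = f x

/-- Spatial partial derivative in direction `j`. -/
def pd {E : Type*} [NormedAddCommGroup E] [NormedSpace ℝ E]
    (j : Fin 3) (f : Spc → E) (x : Spc) : E :=
  fderiv ℝ f x (Pi.single j 1)

/-- Time derivative. -/
def pt {E : Type*} [NormedAddCommGroup E] [NormedSpace ℝ E]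
    (f : ℝ → Spc → E) (t : ℝ) (x : Spc) : E :=
  deriv (fun s => f s x) t

/-- Smooth test function on ℝ×𝕋³: smooth, ℤ³-periodic in space and
compactly supported in time. -/
def IsTest {E : Type*} [NormedAddCommGroup E] [NormedSpace ℝ E]
    (φ : ℝ → Spc → E) : Prop :=
  ContDiff ℝ (⊤ : ℕ∞) (fun q : ℝ × Spc => φ q.1 q.2) ∧ (∀ t, Per (φ t)) ∧
    ∃ T : ℝ, ∀ t : ℝ, T < |t| → ∀ x, φ t x = 0

/-- Weak solution of the incompressible Euler equations on ℝ×𝕋³. -/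
def IsWeakEuler (v : ℝ → Spc → Spc) (p : ℝ → Spc → ℝ) : Prop :=
  (∀ φ : ℝ → Spc → Spc, IsTest φ →
    (∫ t : ℝ, ∫ x in Tdom,
      ((∑ l, v t x l * pt (fun s y => φ s y l) t x) +
        (∑ j, ∑ l, v t x j * v t x l * pd j (fun y => φ t y l) x) +
        p t x * ∑ j, pd j (fun y => φ t y j) x)) = 0) ∧
  (∀ ψ : ℝ → Spc → ℝ, IsTest ψ →
    (∫ t : ℝ, ∫ x in Tdom, ∑ j, v t x j * pd j (ψ t) x) = 0)

/-- Hölder continuity of exponent `α`, jointly in time and space. -/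
def HolderTS {E : Type*} [NormedAddCommGroup E] (α : ℝ) (f : ℝ → Spc → E) : Prop :=
  ∃ C : ℝ, ∀ (t t' : ℝ) (x x' : Spc),
    ‖f t x - f t' x'‖ ≤ C * dist ((t, x) : ℝ × Spc) ((t', x') : ℝ × Spc) ^ α

section

open scoped ContDiff NNReal

/-! ### Part 1 -/

section

open scoped ContDiff

abbrev Pt : Type := ℝ × Spc

/-- Algebra of smooth functions, periodic in space. -/
def SmAlg : Subalgebra ℂ (Pt → ℂ) where
  carrier := {f | ContDiff ℝ ∞ f ∧ ∀ (t : ℝ) (x : Spc) (k : Fin 3 → ℤ),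
    f (t, fun i => x i + (k i : ℝ)) = f (t, x)}
  mul_mem' := by
    rintro f g ⟨hf, pf⟩ ⟨hg, pg⟩
    exact ⟨hf.mul hg, fun t x k => by simp [pf, pg]⟩
  add_mem' := by
    rintro f g ⟨hf, pf⟩ ⟨hg, pg⟩
    exact ⟨hf.add hg, fun t x k => by simp [pf, pg]⟩
  algebraMap_mem' := fun r => ⟨contDiff_const, fun t x k => rfl⟩

abbrev Sm : Type := ↥SmAlg

namespace Sm

def ap (f : Sm) (q : Pt) : ℂ := f.1 q

lemma smooth (f : Sm) : ContDiff ℝ ∞ f.ap := f.2.1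
lemma per (f : Sm) (t : ℝ) (x : Spc) (k : Fin 3 → ℤ) :
    f.ap (t, fun i => x i + (k i : ℝ)) = f.ap (t, x) := f.2.2 t x k
lemma diff (f : Sm) : Differentiable ℝ f.ap := f.smooth.differentiable (by simp)
lemma cont (f : Sm) : Continuous f.ap := f.smooth.continuous

@[ext] lemma ext' {f g : Sm} (h : ∀ q, f.ap q = g.ap q) : f = g := Subtype.ext (funext h)

@[simp] lemma ap_add (f g : Sm) (q : Pt) : (f + g).ap q = f.ap q + g.ap q := rfl
@[simp] lemma ap_mul (f g : Sm) (q : Pt) : (f * g).ap q = f.ap q * g.ap q := rfl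
@[simp] lemma ap_sub (f g : Sm) (q : Pt) : (f - g).ap q = f.ap q - g.ap q := rfl
@[simp] lemma ap_neg (f : Sm) (q : Pt) : (-f).ap q = -f.ap q := rfl
@[simp] lemma ap_smul (c : ℂ) (f : Sm) (q : Pt) : (c • f).ap q = c * f.ap q := rfl
@[simp] lemma ap_zero (q : Pt) : (0 : Sm).ap q = 0 := rfl
@[simp] lemma ap_one (q : Pt) : (1 : Sm).ap q = 1 := rfl
@[simp] lemma ap_algebraMap (c : ℂ) (q : Pt) : (algebraMap ℂ Sm c).ap q = c := rfl
@[simp] lemma ap_pow (f : Sm) (n : ℕ) (q : Pt) : (f ^ n).ap q = f.ap q ^ n := rfl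

/-- evaluation as ring hom -/
def ev (q : Pt) : Sm →ₗ[ℂ] ℂ where
  toFun f := f.ap q
  map_add' _ _ := rfl
  map_smul' _ _ := rfl

lemma ap_sum {ι : Type*} (s : Finset ι) (f : ι → Sm) (q : Pt) :
    (∑ i ∈ s, f i).ap q = ∑ i ∈ s, (f i).ap q := map_sum (ev q) f s

/-- constructor -/
def mk' (f : Pt → ℂ) (h : ContDiff ℝ ∞ f) (hp : ∀ (t : ℝ) (x : Spc) (k : Fin 3 → ℤ),
    f (t, fun i => x i + (k i : ℝ)) = f (t, x)) : Sm := ⟨f, h, hp⟩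

@[simp] lemma ap_mk' (f : Pt → ℂ) (h hp) (q : Pt) : (mk' f h hp).ap q = f q := rfl

lemma fderiv_per (f : Sm) (t : ℝ) (x : Spc) (k : Fin 3 → ℤ) :
    fderiv ℝ f.ap (t, fun i => x i + (k i : ℝ)) = fderiv ℝ f.ap (t, x) := by
  have h : (fun q : Pt => f.ap (q + (0, fun i => (k i : ℝ)))) = f.ap := by
    funext ⟨t, x⟩
    have := f.per t x k
    simp only [Prod.mk_add_mk, add_zero]
    exact this
  have h2 := fderiv_comp_add_right (𝕜 := ℝ) (f := f.ap) (x := (t, x)) (0, fun i => (k i : ℝ))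
  rw [h] at h2
  rw [h2]
  congr 1
  simp
  rfl

/-- directional derivative -/
def pdir (e : Pt) : Derivation ℂ Sm Sm :=
  Derivation.mk'
    { toFun := fun f => mk' (fun q => fderiv ℝ f.ap q e)
        ((f.smooth.fderiv_right (m := ∞) (by simp)).clm_apply contDiff_const)
        (fun t x k => by simp only [fderiv_per])
      map_add' := by
        intro f g
        ext q
        have : (f + g).ap = f.ap + g.ap := rfl
        simp [this, fderiv_add (f.diff q) (g.diff q)]
      map_smul' := by
        intro c f
        ext q
        have : (c • f).ap = c • f.ap := rfl
        simp [this, fderiv_const_smul (f.diff q) c] }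
    (by
      intro f g
      ext q
      have : (f * g).ap = f.ap * g.ap := rfl
      simp [this, fderiv_mul (f.diff q) (g.diff q)])

lemma ap_pdir (e : Pt) (f : Sm) (q : Pt) : (pdir e f).ap q = fderiv ℝ f.ap q e := rfl

lemma pdir_comm (e e' : Pt) (f : Sm) : pdir e (pdir e' f) = pdir e' (pdir e f) := by
  ext q
  have hs : IsSymmSndFDerivAt ℝ f.ap q := by
    apply (f.smooth.contDiffAt).isSymmSndFDerivAt
    simp only [minSmoothness_of_isRCLikeNormedField]
    exact WithTop.coe_le_coe.2 (le_top : (2:ℕ∞) ≤ ⊤)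
  have hd : DifferentiableAt ℝ (fderiv ℝ f.ap) q :=
    (f.smooth.fderiv_right (m := ∞) (by simp)).differentiable (by simp) q
  have key : ∀ a b : Pt, (pdir a (pdir b f)).ap q = fderiv ℝ (fderiv ℝ f.ap) q a b := by
    intro a b
    rw [ap_pdir]
    have : (pdir b f).ap = fun q => fderiv ℝ f.ap q b := rfl
    rw [this, fderiv_clm_apply hd (differentiableAt_const b)]
    simp
  rw [key, key]
  exact hs e e'

def dx (j : Fin 3) : Derivation ℂ Sm Sm := pdir (0, Pi.single j 1)
def dt : Derivation ℂ Sm Sm := pdir (1, 0)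

lemma dx_comm (i j : Fin 3) (f : Sm) : dx i (dx j f) = dx j (dx i f) := pdir_comm _ _ _
lemma dt_dx (j : Fin 3) (f : Sm) : dt (dx j f) = dx j (dt f) := pdir_comm _ _ _

lemma leib (d : Derivation ℂ Sm Sm) (f g : Sm) : d (f * g) = d f * g + f * d g := by
  rw [d.leibniz, smul_eq_mul, smul_eq_mul]; ring

/-- derivative along a time curve -/
lemma hasDerivAt_curve (f : Sm) {X : ℝ → Spc} {X' : Spc} {t : ℝ}
    (hX : HasDerivAt X X' t) :
    HasDerivAt (fun s => f.ap (s, X s))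
      ((dt f).ap (t, X t) + ∑ j, (X' j : ℂ) * (dx j f).ap (t, X t)) t := by
  have h1 : HasDerivAt (fun s : ℝ => ((s, X s) : Pt)) (1, X') t := (hasDerivAt_id t).prodMk hX
  have h2 := (f.diff (t, X t)).hasFDerivAt.comp_hasDerivAt t h1
  refine h2.congr_deriv ?_
  have : ((1, X') : Pt) = (1, 0) + ∑ j, X' j • ((0, Pi.single j 1) : Pt) := by
    apply Prod.ext
    · simp [Prod.fst_sum]
    · simp only [Prod.snd_add, zero_add, Prod.snd_sum, Prod.smul_snd]
      funext i
      simp [Finset.sum_apply, Pi.single_apply]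
  rw [this, map_add, map_sum]
  simp only [map_smul]
  rfl

lemma hasDerivAt_time (f : Sm) (t : ℝ) (x : Spc) :
    HasDerivAt (fun s => f.ap (s, x)) ((dt f).ap (t, x)) t := by
  have := f.hasDerivAt_curve (X := fun _ => x) (hasDerivAt_const t x)
  simpa using this

lemma hasDerivAt_line (f : Sm) (t : ℝ) (x e : Spc) (s : ℝ) :
    HasDerivAt (fun s : ℝ => f.ap (t, x + s • e))
      (∑ j, (e j : ℂ) * (dx j f).ap (t, x + s • e)) s := by
  have h1 : HasDerivAt (fun s : ℝ => ((t, x + s • e) : Pt)) (0, e) s := by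
    have := ((hasDerivAt_id s).smul_const e).const_add x
    simpa using (hasDerivAt_const s t).prodMk this
  have h2 := (f.diff (t, x + s • e)).hasFDerivAt.comp_hasDerivAt s h1
  refine h2.congr_deriv ?_
  have : ((0, e) : Pt) = ∑ j, e j • ((0, Pi.single j 1) : Pt) := by
    apply Prod.ext
    · simp [Prod.fst_sum]
    · simp only [Prod.snd_sum, Prod.smul_snd]
      funext i
      simp [Finset.sum_apply, Pi.single_apply]
  rw [this, map_sum]
  simp only [map_smul]
  rfl

/-- conjugation -/
def cj (f : Sm) : Sm := mk' (fun q => (starRingEnd ℂ) (f.ap q))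
  (Complex.conjCLE.contDiff.comp f.smooth) (fun t x k => by rw [f.per])

@[simp] lemma ap_cj (f : Sm) (q : Pt) : (cj f).ap q = (starRingEnd ℂ) (f.ap q) := rfl
lemma cj_add (f g : Sm) : cj (f + g) = cj f + cj g := by ext; simp
lemma cj_mul (f g : Sm) : cj (f * g) = cj f * cj g := by ext; simp
lemma cj_smul (c : ℂ) (f : Sm) : cj (c • f) = (starRingEnd ℂ c) • cj f := by ext; simp
lemma cj_sum {ι : Type*} (s : Finset ι) (f : ι → Sm) : cj (∑ i ∈ s, f i) = ∑ i ∈ s, cj (f i) := by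
  ext; simp [ap_sum]
lemma cj_cj (f : Sm) : cj (cj f) = f := by ext; simp
lemma cj_pdir (e : Pt) (f : Sm) : cj (pdir e f) = pdir e (cj f) := by
  ext q
  have h := (Complex.conjCLE : ℂ ≃L[ℝ] ℂ).toContinuousLinearMap.hasFDerivAt.comp q
    (f.diff q).hasFDerivAt
  have h2 : (cj f).ap = (Complex.conjCLE : ℂ ≃L[ℝ] ℂ).toContinuousLinearMap ∘ f.ap := rfl
  rw [ap_pdir, h2, h.fderiv]
  rfl
lemma cj_dx (j : Fin 3) (f : Sm) : cj (dx j f) = dx j (cj f) := cj_pdir _ _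
lemma cj_dt (f : Sm) : cj (dt f) = dt (cj f) := cj_pdir _ _

/-- advective derivative -/
def DD (v : Fin 3 → Sm) : Derivation ℂ Sm Sm := dt + ∑ j, v j • dx j

lemma DD_apply (v : Fin 3 → Sm) (f : Sm) : DD v f = dt f + ∑ j, v j * dx j f := by
  unfold DD
  rw [Derivation.add_apply]
  congr 1

lemma DD_dx (v : Fin 3 → Sm) (j : Fin 3) (f : Sm) :
    DD v (dx j f) = dx j (DD v f) - ∑ i, dx j (v i) * dx i f := by
  rw [DD_apply, DD_apply, map_add, map_sum, dt_dx]
  simp only [leib, Finset.sum_add_distrib, dx_comm j]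
  ring

end Sm

end

/-! ### Part 2 -/

section

open scoped ContDiff

namespace Sm

/-- derivative bounds on a set -/
def Bd (U : Set Pt) : ℕ → ℝ → ℝ → Sm → Prop
  | 0, A, _, f => ∀ q ∈ U, ‖f.ap q‖ ≤ A
  | n + 1, A, μ, f => (∀ q ∈ U, ‖f.ap q‖ ≤ A) ∧ ∀ j, Bd U n (A * μ) μ (dx j f)

variable {U V : Set Pt} {n m : ℕ} {A B μ ν : ℝ} {f g : Sm}

lemma Bd.le (h : Bd U n A μ f) {q : Pt} (hq : q ∈ U) : ‖f.ap q‖ ≤ A := by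
  cases n with
  | zero => exact h q hq
  | succ n => exact h.1 q hq

lemma Bd.dx (h : Bd U (n + 1) A μ f) (j : Fin 3) : Bd U n (A * μ) μ (Sm.dx j f) := h.2 j

lemma Bd.mono_U (hUV : V ⊆ U) (h : Bd U n A μ f) : Bd V n A μ f := by
  induction n generalizing A f with
  | zero => exact fun q hq => h q (hUV hq)
  | succ n ih => exact ⟨fun q hq => h.1 q (hUV hq), fun j => ih (h.2 j)⟩

lemma Bd.mono (hAB : A ≤ B) (hμ : 0 ≤ μ) (h : Bd U n A μ f) : Bd U n B μ f := by
  induction n generalizing A B f with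
  | zero => exact fun q hq => (h q hq).trans hAB
  | succ n ih => exact ⟨fun q hq => (h.1 q hq).trans hAB,
      fun j => ih (mul_le_mul_of_nonneg_right hAB hμ) (h.2 j)⟩

lemma Bd.mono_μ (hA : 0 ≤ A) (hμ : 0 ≤ μ) (hμν : μ ≤ ν) (h : Bd U n A μ f) : Bd U n A ν f := by
  induction n generalizing A f with
  | zero => exact fun q hq => h q hq
  | succ n ih => exact ⟨fun q hq => h.1 q hq,
      fun j => (ih (mul_nonneg hA hμ) (h.2 j)).mono (mul_le_mul_of_nonneg_left hμν hA) (hμ.trans hμν)⟩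

lemma Bd.pred (h : Bd U (n + 1) A μ f) : Bd U n A μ f := by
  induction n generalizing A f with
  | zero => exact fun q hq => h.1 q hq
  | succ n ih => exact ⟨h.1, fun j => ih (h.2 j)⟩

lemma Bd.of_le (hmn : m ≤ n) (h : Bd U n A μ f) : Bd U m A μ f := by
  induction hmn with
  | refl => exact h
  | step _ ih => exact ih h.pred

lemma Bd.zero (hA : 0 ≤ A) (hμ : 0 ≤ μ) : Bd U n A μ (0 : Sm) := by
  induction n generalizing A with
  | zero => intro q _; simpa using hA
  | succ n ih => exact ⟨fun q _ => by simpa using hA, fun j => by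
      rw [map_zero]; exact ih (mul_nonneg hA hμ)⟩

lemma Bd.add (hf : Bd U n A μ f) (hg : Bd U n B μ g) : Bd U n (A + B) μ (f + g) := by
  induction n generalizing A B f g with
  | zero => exact fun q hq => (norm_add_le _ _).trans (add_le_add (hf q hq) (hg q hq))
  | succ n ih =>
    refine ⟨fun q hq => (norm_add_le _ _).trans (add_le_add (hf.1 q hq) (hg.1 q hq)), fun j => ?_⟩
    rw [map_add, add_mul]
    exact ih (hf.2 j) (hg.2 j)

lemma Bd.smul (c : ℂ) (hf : Bd U n A μ f) : Bd U n (‖c‖ * A) μ (c • f) := by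
  induction n generalizing A f with
  | zero => intro q hq; rw [ap_smul, norm_mul]; exact mul_le_mul_of_nonneg_left (hf q hq) (norm_nonneg _)
  | succ n ih =>
    refine ⟨fun q hq => ?_, fun j => ?_⟩
    · rw [ap_smul, norm_mul]; exact mul_le_mul_of_nonneg_left (hf.1 q hq) (norm_nonneg _)
    · rw [(Sm.dx j).map_smul, mul_assoc]
      exact ih (hf.2 j)

lemma Bd.neg (hf : Bd U n A μ f) : Bd U n A μ (-f) := by
  have := hf.smul (-1)
  simpa using this

lemma Bd.sub (hf : Bd U n A μ f) (hg : Bd U n B μ g) : Bd U n (A + B) μ (f - g) := by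
  rw [sub_eq_add_neg]; exact hf.add hg.neg

lemma Bd.sum {ι : Type*} (s : Finset ι) {F : ι → Sm} {a : ι → ℝ} (hμ : 0 ≤ μ)
    (h : ∀ i ∈ s, Bd U n (a i) μ (F i)) : Bd U n (∑ i ∈ s, a i) μ (∑ i ∈ s, F i) := by
  classical
  induction s using Finset.induction_on with
  | empty => simpa using Bd.zero le_rfl hμ
  | insert i s hi ih =>
    rw [Finset.sum_insert hi, Finset.sum_insert hi]
    exact (h i (by simp)).add (ih fun k hk => h k (by simp [hk]))

lemma Bd.sum3 {F : Fin 3 → Sm} (hμ : 0 ≤ μ)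
    (h : ∀ i, Bd U n A μ (F i)) : Bd U n (3 * A) μ (∑ i, F i) := by
  have := Bd.sum Finset.univ (a := fun _ => A) hμ (fun i _ => h i)
  simpa using this

lemma Bd.mul (hf : Bd U n A μ f) (hg : Bd U n B μ g) :
    Bd U n (2 ^ n * (A * B)) μ (f * g) := by
  have key : ∀ (A B : ℝ) (f g : Sm) (q : Pt), ‖f.ap q‖ ≤ A → ‖g.ap q‖ ≤ B →
      ‖(f * g).ap q‖ ≤ A * B := by
    intro A B f g q h1 h2
    rw [ap_mul, norm_mul]
    exact mul_le_mul h1 h2 (norm_nonneg _) ((norm_nonneg _).trans h1)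
  induction n generalizing A B f g with
  | zero => intro q hq; rw [pow_zero, one_mul]; exact key _ _ _ _ _ (hf q hq) (hg q hq)
  | succ n ih =>
    refine ⟨fun q hq => ?_, fun j => ?_⟩
    · have h1 := key _ _ _ _ _ (hf.1 q hq) (hg.1 q hq)
      have h0 : 0 ≤ A * B := (norm_nonneg _).trans h1
      have : (1:ℝ) ≤ 2 ^ (n + 1) := one_le_pow₀ (by norm_num)
      nlinarith
    · rw [leib]
      have := (ih (hf.2 j) hg.pred).add (ih hf.pred (hg.2 j))
      convert this using 1
      ring

lemma Bd.const (c : ℂ) (hc : ‖c‖ ≤ A) (hμ : 0 ≤ μ) : Bd U n A μ (algebraMap ℂ Sm c) := by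
  cases n with
  | zero => intro q _; simpa using hc
  | succ n => exact ⟨fun q _ => by simpa using hc, fun j => by
      rw [Derivation.map_algebraMap]
      exact Bd.zero (mul_nonneg ((norm_nonneg _).trans hc) hμ) hμ⟩

/-- support -/
def Supp (U : Set Pt) (f : Sm) : Prop := ∀ q, q ∉ U → f.ap q = 0

lemma Supp.mul_right (h : Supp U f) (g : Sm) : Supp U (f * g) := fun q hq => by simp [h q hq]
lemma Supp.mul_left (h : Supp U f) (g : Sm) : Supp U (g * f) := fun q hq => by simp [h q hq]
lemma Supp.add (h : Supp U f) (h' : Supp U g) : Supp U (f + g) := fun q hq => by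
  simp [h q hq, h' q hq]
lemma Supp.sub (h : Supp U f) (h' : Supp U g) : Supp U (f - g) := fun q hq => by
  simp [h q hq, h' q hq]
lemma Supp.neg (h : Supp U f) : Supp U (-f) := fun q hq => by simp [h q hq]
lemma Supp.smul (c : ℂ) (h : Supp U f) : Supp U (c • f) := fun q hq => by simp [h q hq]
lemma Supp.sum {ι : Type*} (s : Finset ι) {F : ι → Sm} (h : ∀ i ∈ s, Supp U (F i)) :
    Supp U (∑ i ∈ s, F i) := fun q hq => by
  rw [ap_sum]; exact Finset.sum_eq_zero fun i hi => h i hi q hq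
lemma Supp.mono (hUV : U ⊆ V) (h : Supp U f) : Supp V f := fun q hq => h q fun h' => hq (hUV h')

lemma Supp.pdir (hU : IsClosed U) (h : Supp U f) (e : Pt) : Supp U (Sm.pdir e f) := by
  intro q hq
  have : f.ap =ᶠ[nhds q] fun _ => 0 := by
    filter_upwards [hU.isOpen_compl.mem_nhds hq] with y hy using h y hy
  rw [ap_pdir, this.fderiv_eq]
  simp

lemma Supp.dx (hU : IsClosed U) (h : Supp U f) (j : Fin 3) : Supp U (Sm.dx j f) := h.pdir hU _
lemma Supp.dt (hU : IsClosed U) (h : Supp U f) : Supp U (Sm.dt f) := h.pdir hU _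
lemma Supp.DD (hU : IsClosed U) (h : Supp U f) (v : Fin 3 → Sm) : Supp U (Sm.DD v f) := by
  rw [DD_apply]
  exact (h.dt hU).add (Supp.sum _ fun j _ => (h.dx hU j).mul_left _)

lemma Bd.univ_of_supp (hU : IsClosed U) (hs : Supp U f) (hA : 0 ≤ A) (hμ : 0 ≤ μ)
    (h : Bd U n A μ f) : Bd Set.univ n A μ f := by
  have key : ∀ (A : ℝ) (f : Sm), 0 ≤ A → Supp U f → (∀ q ∈ U, ‖f.ap q‖ ≤ A) →
      ∀ q ∈ Set.univ, ‖f.ap q‖ ≤ A := by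
    intro A f hA hs h q _
    by_cases hq : q ∈ U
    · exact h q hq
    · rw [hs q hq]; simpa using hA
  induction n generalizing A f with
  | zero => exact key _ _ hA hs h
  | succ n ih => exact ⟨key _ _ hA hs h.1, fun j => ih (hs.dx hU j) (mul_nonneg hA hμ) (h.2 j)⟩

lemma norm_sum_overlap {ι : Type*} (s : Finset ι) (U : ι → Set Pt) {M : ℕ} (F : ι → Sm) (q : Pt)
    (hM : ∀ t ⊆ s, (∀ i ∈ t, q ∈ U i) → t.card ≤ M) (hA : 0 ≤ A)
    (hs : ∀ i ∈ s, Supp (U i) (F i)) (h : ∀ i ∈ s, q ∈ U i → ‖(F i).ap q‖ ≤ A) :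
    ‖(∑ i ∈ s, F i).ap q‖ ≤ M * A := by
  classical
  rw [ap_sum]
  have h1 : ∑ i ∈ s, (F i).ap q = ∑ i ∈ s.filter (fun i => q ∈ U i), (F i).ap q := by
    rw [Finset.sum_filter]
    refine Finset.sum_congr rfl fun i hi => ?_
    split_ifs with hq
    · rfl
    · exact hs i hi q hq
  rw [h1]
  have h2 : (s.filter (fun i => q ∈ U i)).card ≤ M :=
    hM _ (Finset.filter_subset _ _) fun i hi => (Finset.mem_filter.1 hi).2
  calc _ ≤ ∑ i ∈ s.filter (fun i => q ∈ U i), A :=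
        norm_sum_le_of_le _ fun i hi => h i (Finset.mem_filter.1 hi).1 (Finset.mem_filter.1 hi).2
    _ = (s.filter (fun i => q ∈ U i)).card * A := by simp
    _ ≤ M * A := by
        apply mul_le_mul_of_nonneg_right _ hA
        exact_mod_cast h2

lemma Bd.sum_overlap {ι : Type*} (s : Finset ι) (U : ι → Set Pt) (hU : ∀ i ∈ s, IsClosed (U i))
    {M : ℕ} (F : ι → Sm)
    (hM : ∀ q, ∀ t ⊆ s, (∀ i ∈ t, q ∈ U i) → t.card ≤ M) (hA : 0 ≤ A) (hμ : 0 ≤ μ)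
    (hs : ∀ i ∈ s, Supp (U i) (F i)) (h : ∀ i ∈ s, Bd (U i) n A μ (F i)) :
    Bd Set.univ n (M * A) μ (∑ i ∈ s, F i) := by
  induction n generalizing A F with
  | zero => exact fun q _ => norm_sum_overlap s U F q (hM q) hA hs fun i hi hq => h i hi q hq
  | succ n ih =>
    refine ⟨fun q _ => norm_sum_overlap s U F q (hM q) hA hs fun i hi hq => (h i hi).1 q hq,
      fun j => ?_⟩
    rw [map_sum, mul_assoc]
    exact ih _ (mul_nonneg hA hμ) (fun i hi => (hs i hi).dx (hU i hi) j) fun i hi => (h i hi).2 j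

/-- bounds for function and advective derivative -/
def GG (v : Fin 3 → Sm) (U : Set Pt) (n : ℕ) (A μ ν : ℝ) (f : Sm) : Prop :=
  Bd U n A μ f ∧ Bd U n (A * ν) μ (DD v f)

variable {v : Fin 3 → Sm}

lemma GG.mono (hAB : A ≤ B) (hμ : 0 ≤ μ) (hν : 0 ≤ ν) (h : GG v U n A μ ν f) :
    GG v U n B μ ν f :=
  ⟨h.1.mono hAB hμ, h.2.mono (mul_le_mul_of_nonneg_right hAB hν) hμ⟩

lemma GG.mono_U (hUV : V ⊆ U) (h : GG v U n A μ ν f) : GG v V n A μ ν f :=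
  ⟨h.1.mono_U hUV, h.2.mono_U hUV⟩

lemma GG.of_le (hmn : m ≤ n) (h : GG v U n A μ ν f) : GG v U m A μ ν f :=
  ⟨h.1.of_le hmn, h.2.of_le hmn⟩

lemma GG.mono_μ {μ' : ℝ} (hA : 0 ≤ A) (hμ : 0 ≤ μ) (hν : 0 ≤ ν) (hμν : μ ≤ μ')
    (h : GG v U n A μ ν f) : GG v U n A μ' ν f :=
  ⟨h.1.mono_μ hA hμ hμν, h.2.mono_μ (mul_nonneg hA hν) hμ hμν⟩

lemma GG.add (hf : GG v U n A μ ν f) (hg : GG v U n B μ ν g) : GG v U n (A + B) μ ν (f + g) :=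
  ⟨hf.1.add hg.1, by rw [map_add, add_mul]; exact hf.2.add hg.2⟩

lemma GG.smul (c : ℂ) (hf : GG v U n A μ ν f) : GG v U n (‖c‖ * A) μ ν (c • f) :=
  ⟨hf.1.smul c, by rw [(DD v).map_smul, mul_assoc]; exact hf.2.smul c⟩

lemma GG.neg (hf : GG v U n A μ ν f) : GG v U n A μ ν (-f) := by
  have := hf.smul (-1)
  simpa using this

lemma GG.sub (hf : GG v U n A μ ν f) (hg : GG v U n B μ ν g) : GG v U n (A + B) μ ν (f - g) := by
  rw [sub_eq_add_neg]; exact hf.add hg.neg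

lemma GG.zero (hA : 0 ≤ A) (hμ : 0 ≤ μ) (hν : 0 ≤ ν) : GG v U n A μ ν 0 :=
  ⟨Bd.zero hA hμ, by rw [map_zero]; exact Bd.zero (mul_nonneg hA hν) hμ⟩

lemma GG.sum {ι : Type*} (s : Finset ι) {F : ι → Sm} {a : ι → ℝ} (hμ : 0 ≤ μ)
    (h : ∀ i ∈ s, GG v U n (a i) μ ν (F i)) : GG v U n (∑ i ∈ s, a i) μ ν (∑ i ∈ s, F i) :=
  ⟨Bd.sum s hμ fun i hi => (h i hi).1, by
    rw [map_sum, Finset.sum_mul]; exact Bd.sum s hμ fun i hi => (h i hi).2⟩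

lemma GG.sum3 {F : Fin 3 → Sm} (hμ : 0 ≤ μ)
    (h : ∀ i, GG v U n A μ ν (F i)) : GG v U n (3 * A) μ ν (∑ i, F i) := by
  have := GG.sum Finset.univ (a := fun _ => A) hμ (fun i _ => h i)
  simpa using this

lemma Bd.nonneg (h : Bd U n A μ f) (hU : U.Nonempty) : 0 ≤ A :=
  (norm_nonneg _).trans (h.le hU.some_mem)

lemma GG.mul (hμ : 0 ≤ μ) (hν : 0 ≤ ν) (hA : 0 ≤ A) (hB : 0 ≤ B)
    (hf : GG v U n A μ ν f) (hg : GG v U n B μ ν g) :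
    GG v U n (2 ^ (n + 1) * (A * B)) μ ν (f * g) := by
  refine ⟨(hf.1.mul hg.1).mono ?_ hμ, ?_⟩
  · exact mul_le_mul_of_nonneg_right (pow_le_pow_right₀ (by norm_num) (by omega)) (by positivity)
  · rw [leib]
    convert (hf.2.mul hg.1).add (hf.1.mul hg.2) using 1
    ring

lemma GG.dx {L : ℝ} (hμ : 0 ≤ μ) (hA : 0 ≤ A)
    (hv : ∀ i j, Bd U n L μ (Sm.dx j (v i))) (hL : L ≤ ν)
    (hf : GG v U (n + 1) A μ ν f) (j : Fin 3) :
    GG v U n ((1 + 3 * 2 ^ n) * (A * μ)) μ ν (Sm.dx j f) := by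
  have h2n : (0:ℝ) < 2 ^ n := by positivity
  have hAμ : 0 ≤ A * μ := mul_nonneg hA hμ
  refine ⟨(hf.1.2 j).mono ?_ hμ, ?_⟩
  · nlinarith [mul_nonneg h2n.le hAμ]
  · rw [DD_dx]
    have h1 := (hf.2.2 j).sub (Bd.sum3 hμ fun i => (hv i j).mul (hf.1.2 i))
    refine h1.mono ?_ hμ
    have : L * (A * μ) ≤ ν * (A * μ) := mul_le_mul_of_nonneg_right hL hAμ
    nlinarith [mul_le_mul_of_nonneg_left this h2n.le]

lemma GG.const (c : ℂ) (hc : ‖c‖ ≤ A) (hμ : 0 ≤ μ) (hν : 0 ≤ ν) :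
    GG v U n A μ ν (algebraMap ℂ Sm c) :=
  ⟨Bd.const c hc hμ, by
    rw [Derivation.map_algebraMap]
    exact Bd.zero (mul_nonneg ((norm_nonneg _).trans hc) hν) hμ⟩

lemma GG.univ_of_supp (hU : IsClosed U) (hs : Supp U f) (hA : 0 ≤ A) (hμ : 0 ≤ μ) (hν : 0 ≤ ν)
    (h : GG v U n A μ ν f) : GG v Set.univ n A μ ν f :=
  ⟨h.1.univ_of_supp hU hs hA hμ, h.2.univ_of_supp hU (hs.DD hU v) (mul_nonneg hA hν) hμ⟩

lemma GG.sum_overlap {ι : Type*} (s : Finset ι) (U : ι → Set Pt) (hU : ∀ i ∈ s, IsClosed (U i))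
    {M : ℕ} (F : ι → Sm)
    (hM : ∀ q, ∀ t ⊆ s, (∀ i ∈ t, q ∈ U i) → t.card ≤ M) (hA : 0 ≤ A) (hμ : 0 ≤ μ) (hν : 0 ≤ ν)
    (hs : ∀ i ∈ s, Supp (U i) (F i)) (h : ∀ i ∈ s, GG v (U i) n A μ ν (F i)) :
    GG v Set.univ n (M * A) μ ν (∑ i ∈ s, F i) :=
  ⟨Bd.sum_overlap s U hU F hM hA hμ hs fun i hi => (h i hi).1, by
    rw [map_sum, mul_assoc]
    exact Bd.sum_overlap s U hU _ hM (mul_nonneg hA hν) hμ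
      (fun i hi => (hs i hi).DD (hU i hi) v) fun i hi => (h i hi).2⟩

end Sm

end

/-! ### Part 3 -/

section

open scoped ContDiff

namespace Sm

lemma hasFDerivAt_avg {F : Type} [NormedAddCommGroup F] [NormedSpace ℝ F] [CompleteSpace F]
    {w : ℝ → ℝ} (hw : Continuous w) (e : Pt) {f : Pt → F} (hf : ContDiff ℝ 1 f) (x0 : Pt) :
    HasFDerivAt (fun x : Pt => ∫ s in (0:ℝ)..1, w s • f (x + s • e))
      (∫ s in (0:ℝ)..1, w s • fderiv ℝ f (x0 + s • e)) x0 := by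
  have hcf : Continuous f := hf.continuous
  have hcd : Continuous (fderiv ℝ f) := hf.continuous_fderiv (by simp)
  have hK : IsCompact (Metric.closedBall x0 1 ×ˢ Set.Icc (0:ℝ) 1) :=
    (isCompact_closedBall x0 1).prod isCompact_Icc
  have hcg : Continuous fun p : Pt × ℝ => w p.2 • fderiv ℝ f (p.1 + p.2 • e) := by fun_prop
  obtain ⟨C, hC⟩ := hK.exists_bound_of_continuousOn hcg.continuousOn
  refine intervalIntegral.hasFDerivAt_integral_of_dominated_of_fderiv_le
    (bound := fun _ => C) (F := fun x s => w s • f (x + s • e))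
    (F' := fun x s => w s • fderiv ℝ f (x + s • e))
    (s := Metric.ball x0 1) (Metric.ball_mem_nhds x0 one_pos) ?_ ?_ ?_ ?_ ?_ ?_
  · refine Filter.Eventually.of_forall fun x => Continuous.aestronglyMeasurable ?_
    fun_prop
  · apply Continuous.intervalIntegrable
    fun_prop
  · haveI : SecondCountableTopologyEither ℝ (Pt →L[ℝ] F) := secondCountableTopologyEither_of_left ℝ _
    apply Continuous.aestronglyMeasurable
    fun_prop
  · refine Filter.Eventually.of_forall fun s hs x hx => ?_
    rw [Set.uIoc_of_le zero_le_one] at hs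
    exact hC (x, s) ⟨Metric.ball_subset_closedBall hx, ⟨hs.1.le, hs.2⟩⟩
  · exact intervalIntegrable_const
  · refine Filter.Eventually.of_forall fun s _ x _ => ?_
    have h1 : HasFDerivAt f (fderiv ℝ f (x + s • e)) (x + s • e) :=
      (hf.differentiable (by simp) _).hasFDerivAt
    have h2 : HasFDerivAt (fun x : Pt => x + s • e) (ContinuousLinearMap.id ℝ Pt) x :=
      (hasFDerivAt_id x).add_const _
    have := (h1.comp x h2).const_smul (w s)
    rw [ContinuousLinearMap.comp_id] at this
    exact this

lemma contDiff_avg {w : ℝ → ℝ} (hw : Continuous w) (e : Pt) (n : ℕ) :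
    ∀ {F : Type} [NormedAddCommGroup F] [NormedSpace ℝ F] [CompleteSpace F]
    {f : Pt → F}, ContDiff ℝ n f →
    ContDiff ℝ n (fun x : Pt => ∫ s in (0:ℝ)..1, w s • f (x + s • e)) := by
  induction n with
  | zero =>
    intro F _ _ _ f hf
    have hcf : Continuous f := hf.continuous
    rw [CharP.cast_eq_zero, contDiff_zero]
    apply intervalIntegral.continuous_parametric_intervalIntegral_of_continuous'
    show Continuous fun p : Pt × ℝ => w p.2 • f (p.1 + p.2 • e)
    fun_prop
  | succ n ih =>
    intro F _ _ _ f hf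
    have h1 : ContDiff ℝ 1 f := hf.of_le (by simp)
    have h2 : ContDiff ℝ n (fderiv ℝ f) := hf.fderiv_right (by simp)
    have h3 := fun x => hasFDerivAt_avg hw e h1 x
    have : ((n + 1 : ℕ) : WithTop ℕ∞) = (n : WithTop ℕ∞) + 1 := by simp
    rw [this, contDiff_succ_iff_fderiv]
    refine ⟨fun x => (h3 x).differentiableAt, by simp, ?_⟩
    have h4 : fderiv ℝ (fun x : Pt => ∫ s in (0:ℝ)..1, w s • f (x + s • e)) =
      fun x => ∫ s in (0:ℝ)..1, w s • fderiv ℝ f (x + s • e) := funext fun x => (h3 x).fderiv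
    rw [h4]
    exact ih h2

/-- weighted average in direction `i` -/
def avg (w : ℝ → ℝ) (hw : Continuous w) (i : Fin 3) (f : Sm) : Sm :=
  mk' (fun q => ∫ s in (0:ℝ)..1, w s • f.ap (q + s • ((0, Pi.single i 1) : Pt)))
    (contDiff_infty.2 fun n => contDiff_avg hw _ n (contDiff_infty.1 f.smooth n))
    (by
      intro t x k
      refine intervalIntegral.integral_congr fun s _ => ?_
      have := f.per t (x + s • (Pi.single i 1 : Spc)) k
      congr 1
      convert this using 2
      · simp
        funext l
        simp; ring
      · simp)

lemma ap_avg (w hw i) (f : Sm) (q : Pt) : (avg w hw i f).ap q =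
  ∫ s in (0:ℝ)..1, w s • f.ap (q + s • ((0, Pi.single i 1) : Pt)) := rfl

lemma pdir_avg (w hw i) (f : Sm) (e : Pt) : pdir e (avg w hw i f) = avg w hw i (pdir e f) := by
  ext q
  have h1 := hasFDerivAt_avg hw ((0, Pi.single i 1) : Pt) (contDiff_infty.1 f.smooth 1) q
  rw [ap_pdir]
  have h2 : (avg w hw i f).ap = fun q => ∫ s in (0:ℝ)..1, w s • f.ap (q + s • ((0, Pi.single i 1) : Pt)) := rfl
  rw [h2, h1.fderiv, ap_avg, ContinuousLinearMap.intervalIntegral_apply]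
  · rfl
  · apply Continuous.intervalIntegrable
    have : Continuous (fderiv ℝ f.ap) := f.smooth.continuous_fderiv (by simp)
    fun_prop

lemma dx_avg (w hw i) (f : Sm) (j) : dx j (avg w hw i f) = avg w hw i (dx j f) := pdir_avg _ _ _ _ _
lemma dt_avg (w hw i) (f : Sm) : dt (avg w hw i f) = avg w hw i (dt f) := pdir_avg _ _ _ _ _

/-- sup bound at a fixed time -/
def TB (t A : ℝ) (f : Sm) : Prop := ∀ x, ‖f.ap (t, x)‖ ≤ A

lemma TB.avg {t A : ℝ} {f : Sm} (h : TB t A f) (w : ℝ → ℝ) (hw : Continuous w) (i : Fin 3)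
    (hb : ∀ s ∈ Set.Icc (0:ℝ) 1, |w s| ≤ 1) : TB t A (avg w hw i f) := by
  intro x
  rw [ap_avg]
  have hA : 0 ≤ A := (norm_nonneg _).trans (h x)
  have := intervalIntegral.norm_integral_le_of_norm_le_const (a := 0) (b := 1) (C := A)
    (f := fun s => w s • f.ap ((t, x) + s • ((0, Pi.single i 1) : Pt))) ?_
  · simpa using this
  · intro s hs
    rw [Set.uIoc_of_le zero_le_one] at hs
    rw [norm_smul, Real.norm_eq_abs]
    have h1 := hb s ⟨hs.1.le, hs.2⟩
    have h2 : ‖f.ap ((t, x) + s • ((0, Pi.single i 1) : Pt))‖ ≤ A := by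
      have := h (x + s • Pi.single i 1)
      simpa using this
    calc _ ≤ 1 * A := mul_le_mul h1 h2 (norm_nonneg _) zero_le_one
      _ = A := one_mul _

def PP (i : Fin 3) (f : Sm) : Sm := avg (fun _ => 1) continuous_const i f
def II (i : Fin 3) (f : Sm) : Sm := avg (fun s => s - 1/2) (by fun_prop) i f

lemma hasDerivAt_dir (f : Sm) (q : Pt) (i : Fin 3) (s : ℝ) :
    HasDerivAt (fun s : ℝ => f.ap (q + s • ((0, Pi.single i 1) : Pt)))
      ((dx i f).ap (q + s • ((0, Pi.single i 1) : Pt))) s := by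
  have h1 : HasDerivAt (fun s : ℝ => q + s • ((0, Pi.single i 1) : Pt)) (0, Pi.single i 1) s := by
    have := ((hasDerivAt_id s).smul_const ((0, Pi.single i 1) : Pt)).const_add q
    simpa using this
  exact (f.diff _).hasFDerivAt.comp_hasDerivAt s h1

lemma ap_shift (f : Sm) (q : Pt) (i : Fin 3) : f.ap (q + ((0, Pi.single i 1) : Pt)) = f.ap q := by
  have := f.per q.1 q.2 (Pi.single i 1)
  convert this using 2
  ext l
  · simp
  · simp [Pi.single_apply]

lemma PP_dx_self (i : Fin 3) (f : Sm) : PP i (dx i f) = 0 := by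
  ext q
  unfold PP
  rw [ap_avg]
  simp only [one_smul, ap_zero]
  rw [intervalIntegral.integral_eq_sub_of_hasDerivAt (fun s _ => hasDerivAt_dir f q i s)]
  · simp [ap_shift]
  · apply Continuous.intervalIntegrable
    have := (dx i f).cont
    fun_prop

lemma dx_II (i : Fin 3) (f : Sm) : dx i (II i f) = f - PP i f := by
  unfold II
  rw [dx_avg]
  ext q
  rw [ap_avg]
  have hc := (dx i f).cont
  have hc' := f.cont
  have h := intervalIntegral.integral_eq_sub_of_hasDerivAt (a := 0) (b := 1)
    (f := fun s : ℝ => ((s - 1/2 : ℝ)) • f.ap (q + s • ((0, Pi.single i 1) : Pt)))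
    (f' := fun s : ℝ => ((s - 1/2 : ℝ)) • (dx i f).ap (q + s • ((0, Pi.single i 1) : Pt)) +
      (1:ℝ) • f.ap (q + s • ((0, Pi.single i 1) : Pt)))
    (fun s _ => ((hasDerivAt_id s).sub_const (1/2)).smul (hasDerivAt_dir f q i s))
    (by apply Continuous.intervalIntegrable; fun_prop)
  rw [intervalIntegral.integral_add] at h
  · rw [ap_sub]
    unfold PP
    rw [ap_avg, eq_sub_iff_add_eq]
    rw [h]
    simp only [one_smul, ap_shift, zero_smul, add_zero]
    rw [← sub_smul]; norm_num
  · apply Continuous.intervalIntegrable; fun_prop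
  · apply Continuous.intervalIntegrable; fun_prop

lemma PP_add (i f g) : PP i (f + g) = PP i f + PP i g := by
  ext q
  unfold PP
  simp only [ap_avg, ap_add, one_smul]
  have hc := g.cont
  have hc' := f.cont
  rw [intervalIntegral.integral_add] <;> apply Continuous.intervalIntegrable <;> fun_prop

lemma PP_zero (i) : PP i 0 = 0 := by
  ext q
  unfold PP
  simp [ap_avg]

lemma II_zero (i) : II i 0 = 0 := by
  ext q
  unfold II
  simp [ap_avg]

lemma dx_PP (i j f) : dx j (PP i f) = PP i (dx j f) := dx_avg _ _ _ _ _
lemma dx_II' (i j f) : dx j (II i f) = II i (dx j f) := dx_avg _ _ _ _ _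

lemma PP_sum (i) (f : Fin 3 → Sm) : PP i (∑ j, f j) = ∑ j, PP i (f j) := by
  simp only [Fin.sum_univ_three, PP_add]

/-- triple average of a divergence vanishes -/
lemma PPP_div (l : Fin 3) (g : Fin 3 → Sm) : PP (l+2) (PP (l+1) (PP l (∑ j, dx j (g j)))) = 0 := by
  have key : ∀ j, PP (l+2) (PP (l+1) (PP l (dx j (g j)))) = 0 := by
    intro j
    have : j = l ∨ j = l + 1 ∨ j = l + 2 := by revert j l; decide
    rcases this with rfl | rfl | rfl
    · rw [PP_dx_self, PP_zero, PP_zero]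
    · rw [← dx_PP, PP_dx_self, PP_zero]
    · rw [← dx_PP, ← dx_PP, PP_dx_self]
  simp only [PP_sum, key, Finset.sum_const_zero]

def qa (W : Fin 3 → Sm) (l : Fin 3) : Sm := II (l+1) (PP l (W l))
def qb (W : Fin 3 → Sm) (l : Fin 3) : Sm := II (l+2) (PP (l+1) (PP l (W l)))

/-- symmetric matrix: diagonal `II l W_l`, entry `{l,l+1}` is `qa l + qb (l+1)` -/
def adiv (W : Fin 3 → Sm) (j l : Fin 3) : Sm :=
  if j = l then II l (W l) else if j = l + 1 then qa W l + qb W (l+1) else qa W j + qb W (j+1)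

lemma adiv_symm (W : Fin 3 → Sm) (j l : Fin 3) : adiv W j l = adiv W l j := by
  unfold adiv
  have h : j = l ∨ j = l + 1 ∨ l = j + 1 := by revert j l; decide
  have h1 : ∀ a : Fin 3, a + 1 ≠ a := by decide
  have h2 : ∀ a : Fin 3, a ≠ a + 1 + 1 := by decide
  rcases h with rfl | rfl | rfl
  · rfl
  · simp [h1, h2, (h1 l).symm]
  · simp [h1, h2, (h1 j).symm]

lemma adiv_div (W : Fin 3 → Sm) (h0 : ∀ l, PP (l+2) (PP (l+1) (PP l (W l))) = 0) (l : Fin 3) :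
    ∑ j, dx j (adiv W j l) = W l := by
  have hs : ∑ j, dx j (adiv W j l) = dx l (adiv W l l) + dx (l+1) (adiv W (l+1) l) +
      dx (l+2) (adiv W (l+2) l) := by
    rw [Fin.sum_univ_three]
    have : l = 0 ∨ l = 1 ∨ l = 2 := by clear * -; revert l; decide
    rcases this with rfl | rfl | rfl
    · rfl
    · show _ = dx 1 (adiv W 1 1) + dx 2 (adiv W 2 1) + dx 0 (adiv W 0 1)
      ring
    · show _ = dx 2 (adiv W 2 2) + dx 0 (adiv W 0 2) + dx 1 (adiv W 1 2)
      ring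
  rw [hs]
  have e1 : adiv W l l = II l (W l) := by simp [adiv]
  have e2 : adiv W (l+1) l = qa W l + qb W (l+1) := by
    have : l + 1 ≠ l := by clear * -; revert l; decide
    simp [adiv, this]
  have e3 : adiv W (l+2) l = qa W (l+2) + qb W l := by
    have a : l + 2 ≠ l := by clear * -; revert l; decide
    have b : l + 2 ≠ l + 1 := by clear * -; revert l; decide
    have c : l + 2 + 1 = l := by clear * -; revert l; decide
    simp only [adiv, a, b, if_false, c]
  rw [e1, e2, e3, map_add, map_add]
  have z1 : dx (l+1) (qb W (l+1)) = 0 := by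
    unfold qb
    rw [dx_II', dx_PP, dx_PP, PP_dx_self, PP_zero, II_zero]
  have z2 : dx (l+2) (qa W (l+2)) = 0 := by
    unfold qa
    rw [dx_II', dx_PP, PP_dx_self, II_zero]
  rw [z1, z2]
  unfold qa qb
  rw [dx_II, dx_II, dx_II, h0 l]
  ring

lemma TB.PP {t A : ℝ} {f : Sm} (h : TB t A f) (i) : TB t A (PP i f) :=
  h.avg _ _ _ (by simp)
lemma TB.II {t A : ℝ} {f : Sm} (h : TB t A f) (i) : TB t A (II i f) :=
  h.avg _ _ _ (by intro s hs; rw [abs_le]; constructor <;> linarith [hs.1, hs.2])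
lemma TB.add {t A B : ℝ} {f g : Sm} (h : TB t A f) (h' : TB t B g) : TB t (A + B) (f + g) :=
  fun x => (norm_add_le _ _).trans (add_le_add (h x) (h' x))

lemma TB.adiv {t A : ℝ} {W : Fin 3 → Sm} (h : ∀ l, TB t A (W l)) (j l) :
    TB t (2 * A) (adiv W j l) := by
  have hA : 0 ≤ A := (norm_nonneg _).trans (h 0 0)
  have h1 : ∀ l, TB t A (Sm.II l (W l)) := fun l => (h l).II l
  have h2 : ∀ l, TB t A (qa W l) := fun l => ((h l).PP l).II _
  have h3 : ∀ l, TB t A (qb W l) := fun l => (((h l).PP l).PP _).II _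
  unfold Sm.adiv
  rw [two_mul]
  split_ifs
  · exact fun x => (h1 _ x).trans (by linarith)
  · exact (h2 _).add (h3 _)
  · exact (h2 _).add (h3 _)

lemma adiv_pdir (W : Fin 3 → Sm) (e : Pt) (j l) :
    pdir e (adiv W j l) = adiv (fun l => pdir e (W l)) j l := by
  unfold adiv qa qb
  have h1 : ∀ i f, pdir e (II i f) = II i (pdir e f) := fun i f => pdir_avg _ _ _ _ _
  have h2 : ∀ i f, pdir e (PP i f) = PP i (pdir e f) := fun i f => pdir_avg _ _ _ _ _
  split_ifs <;> simp only [map_add, h1, h2]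

end Sm

end

/-! ### Part 4 -/

section

lemma ode_global {f : ℝ → Spc → Spc} {B K : ℝ≥0} (hc : Continuous (fun q : Pt => f q.1 q.2))
    (hl : ∀ t, LipschitzWith K (f t)) (hb : ∀ t x, ‖f t x‖ ≤ B) (t0 : ℝ) (x0 : Spc) :
    ∃ X : ℝ → Spc, X t0 = x0 ∧ ∀ t, HasDerivAt X (f t (X t)) t := by
  have hloc : ∀ n : ℕ, ∃ α : ℝ → Spc, α t0 = x0 ∧ ∀ t ∈ Set.Ioo (t0 - (n + 1)) (t0 + (n + 1)),
      HasDerivAt α (f t (α t)) t := by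
    intro n
    have hn : (0:ℝ) ≤ n := n.cast_nonneg
    have hmem : t0 ∈ Set.Icc (t0 - (n + 1)) (t0 + (n + 1)) := ⟨by linarith, by linarith⟩
    have hPL : IsPicardLindelof f (tmin := t0 - (n + 1)) (tmax := t0 + (n + 1)) ⟨t0, hmem⟩ x0
        (B * (n + 1)) 0 B K :=
      { lipschitzOnWith := fun t _ => (hl t).lipschitzOnWith
        continuousOn := fun x _ =>
          (hc.comp (continuous_id.prodMk continuous_const)).continuousOn
        norm_le := fun t _ x _ => hb t x
        mul_max_le := by simp }
    obtain ⟨α, h0, h1⟩ := hPL.exists_eq_forall_mem_Icc_hasDerivWithinAt₀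
    exact ⟨α, h0, fun t ht => (h1 t ⟨ht.1.le, ht.2.le⟩).hasDerivAt (Icc_mem_nhds ht.1 ht.2)⟩
  choose α h0 h1 using hloc
  have huniq : ∀ m n : ℕ, m ≤ n → Set.EqOn (α m) (α n) (Set.Ioo (t0 - (m + 1)) (t0 + (m + 1))) := by
    intro m n hmn
    have hm : (0:ℝ) ≤ m := m.cast_nonneg
    have hmn' : (m:ℝ) ≤ n := by exact_mod_cast hmn
    refine ODE_solution_unique_of_mem_Ioo (v := f) (s := fun _ => Set.univ) (K := K) (t₀ := t0)
      (fun t _ => (hl t).lipschitzOnWith) ⟨by linarith, by linarith⟩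
      (fun t ht => ⟨h1 m t ht, trivial⟩)
      (fun t ht => ⟨h1 n t ⟨by linarith [ht.1], by linarith [ht.2]⟩, trivial⟩) (by rw [h0, h0])
  have huniq' : ∀ m n : ℕ, ∀ t ∈ Set.Ioo (t0 - (m + 1)) (t0 + (m + 1)),
      t ∈ Set.Ioo (t0 - (n + 1)) (t0 + (n + 1)) → α m t = α n t := by
    intro m n t hm hn
    rcases le_total m n with h | h
    · exact huniq m n h hm
    · exact (huniq n m h hn).symm
  have hmem : ∀ t, t ∈ Set.Ioo (t0 - ((⌈|t - t0|⌉₊ : ℕ) + 1 : ℝ)) (t0 + ((⌈|t - t0|⌉₊ : ℕ) + 1)) := by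
    intro t
    have h2 := Nat.le_ceil |t - t0|
    have h3 := abs_le.1 h2
    exact ⟨by linarith [h3.1], by linarith [h3.2]⟩
  refine ⟨fun t => α ⌈|t - t0|⌉₊ t, by simp [h0], fun t => ?_⟩
  have hev : (fun t => α ⌈|t - t0|⌉₊ t) =ᶠ[nhds t] α ⌈|t - t0|⌉₊ := by
    filter_upwards [Ioo_mem_nhds (hmem t).1 (hmem t).2] with s hs
    exact huniq' _ _ s (hmem s) hs
  exact (h1 _ t (hmem t)).congr_of_eventuallyEq hev

lemma ode_smooth {f : ℝ → Spc → Spc} (hc : ContDiff ℝ ∞ (fun q : Pt => f q.1 q.2))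
    {X : ℝ → Spc} (hX : ∀ t, HasDerivAt X (f t (X t)) t) : ContDiff ℝ ∞ X := by
  rw [contDiff_infty]
  intro n
  induction n with
  | zero =>
    rw [CharP.cast_eq_zero, contDiff_zero]
    exact continuous_iff_continuousAt.2 fun t => (hX t).continuousAt
  | succ n ih =>
    have : ((n + 1 : ℕ) : WithTop ℕ∞) = (n : WithTop ℕ∞) + 1 := by simp
    rw [this, contDiff_succ_iff_deriv]
    refine ⟨fun t => (hX t).differentiableAt, by simp, ?_⟩
    have h : deriv X = fun t => f t (X t) := funext fun t => (hX t).deriv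
    rw [h]
    exact (contDiff_infty.1 hc n).comp (contDiff_id.prodMk ih)

/-- two-sided separation -/
lemma ode_sep {f : ℝ → Spc → Spc} {K : ℝ≥0} (hl : ∀ t, LipschitzWith K (f t))
    {X Y : ℝ → Spc} (hX : ∀ t, HasDerivAt X (f t (X t)) t) (hY : ∀ t, HasDerivAt Y (f t (Y t)) t)
    (s t : ℝ) : dist (X s) (Y s) ≤ dist (X t) (Y t) * Real.exp (K * |t - s|) := by
  rcases le_total t s with h | h
  · have := dist_le_of_trajectories_ODE (f := X) (g := Y) (v := f) (a := t) (b := s) hl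
      (fun r _ => (hX r).continuousAt.continuousWithinAt) (fun r _ => (hX r).hasDerivWithinAt)
      (fun r _ => (hY r).continuousAt.continuousWithinAt) (fun r _ => (hY r).hasDerivWithinAt)
      le_rfl s ⟨h, le_rfl⟩
    rwa [abs_of_nonpos (by linarith), neg_sub]
  · have key : ∀ Z : ℝ → Spc, (∀ t, HasDerivAt Z (f t (Z t)) t) →
        ∀ r, HasDerivAt (fun r => Z (-r)) (-(f (-r) (Z (-r)))) r := by
      intro Z hZ r
      have := (hZ (-r)).scomp r (hasDerivAt_neg r)
      simpa [Function.comp_def] using this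
    have := dist_le_of_trajectories_ODE (f := fun r => X (-r)) (g := fun r => Y (-r))
      (v := fun r x => -(f (-r) x)) (a := -t) (b := -s) (K := K) (fun r => (hl (-r)).neg)
      (fun r _ => (key X hX r).continuousAt.continuousWithinAt)
      (fun r _ => (key X hX r).hasDerivWithinAt)
      (fun r _ => (key Y hY r).continuousAt.continuousWithinAt)
      (fun r _ => (key Y hY r).hasDerivWithinAt)
      le_rfl (-s) ⟨by linarith, le_rfl⟩
    rw [abs_of_nonneg (by linarith)]
    simpa [sub_eq_add_neg, add_comm] using this

namespace Sm

/-- the real vector field -/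
def vf (v : Fin 3 → Sm) (t : ℝ) (x : Spc) : Spc := fun i => ((v i).ap (t, x)).re

def IsRe (f : Sm) : Prop := cj f = f

lemma IsRe.ofReal {f : Sm} (h : IsRe f) (q : Pt) : ((f.ap q).re : ℂ) = f.ap q := by
  have h1 : (starRingEnd ℂ) (f.ap q) = f.ap q := by rw [← ap_cj, h]
  exact Complex.conj_eq_iff_re.1 h1

lemma vf_smooth (v : Fin 3 → Sm) : ContDiff ℝ ∞ (fun q : Pt => vf v q.1 q.2) := by
  rw [contDiff_pi]
  intro i
  exact Complex.reCLM.contDiff.comp (v i).smooth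

/-- spatial Lipschitz bound in sup norm -/
lemma lip_x (f : Sm) {A : ℝ} {t : ℝ} (h : ∀ j, TB t A (dx j f)) (x y : Spc) :
    ‖f.ap (t, x) - f.ap (t, y)‖ ≤ 3 * A * dist x y := by
  have hd : ∀ s : ℝ, HasDerivAt (fun s : ℝ => f.ap (t, y + s • (x - y)))
      (∑ j, ((x - y) j : ℂ) * (dx j f).ap (t, y + s • (x - y))) s :=
    fun s => hasDerivAt_line f t y (x - y) s
  have := norm_image_sub_le_of_norm_deriv_le_segment_01' (f := fun s : ℝ => f.ap (t, y + s • (x - y)))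
    (C := 3 * A * dist x y) (fun s _ => (hd s).hasDerivWithinAt) (fun s _ => ?_)
  · simpa using this
  · calc _ ≤ ∑ j : Fin 3, dist x y * A := by
          refine norm_sum_le_of_le _ fun j _ => ?_
          rw [norm_mul]
          refine mul_le_mul ?_ (h j _) (norm_nonneg _) dist_nonneg
          rw [Complex.norm_real, dist_eq_norm]
          exact norm_le_pi_norm (x - y) j
      _ = 3 * A * dist x y := by simp; ring

lemma vf_lip {v : Fin 3 → Sm} {A : ℝ≥0} (h : ∀ i j t, TB t A (dx j (v i))) (t : ℝ) :
    LipschitzWith (3 * A) (vf v t) := by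
  apply LipschitzWith.of_dist_le_mul
  intro x y
  rw [dist_pi_le_iff (by positivity)]
  intro i
  have h1 := lip_x (v i) (fun j => h i j t) x y
  have h2 : dist (vf v t x i) (vf v t y i) ≤ ‖(v i).ap (t, x) - (v i).ap (t, y)‖ := by
    rw [Real.dist_eq]
    unfold vf
    rw [← Complex.sub_re]
    exact Complex.abs_re_le_norm _
  exact h2.trans (by simpa using h1)

end Sm

end

/-! ### Part 5 -/

section

namespace Sm

/-- profile moved along a curve -/
def mv (F : Sm) (X : ℝ → Spc) (hX : ContDiff ℝ ∞ X) : Sm :=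
  mk' (fun q => F.ap (0, q.2 - X q.1))
    (F.smooth.comp (contDiff_const.prodMk (contDiff_snd.sub (hX.comp contDiff_fst))))
    (fun t x k => by
      have := F.per 0 (x - X t) k
      rw [← this]
      congr 2
      funext i
      simp; ring)

lemma ap_mv (F : Sm) (X hX) (q : Pt) : (mv F X hX).ap q = F.ap (0, q.2 - X q.1) := rfl

lemma dx_mv (F : Sm) (X hX) (j : Fin 3) : dx j (mv F X hX) = mv (dx j F) X hX := by
  ext ⟨t, x⟩
  have h1 := hasDerivAt_dir (mv F X hX) (t, x) j 0
  have h2 := hasDerivAt_dir F (0, x - X t) j 0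
  have h3 : (fun s : ℝ => (mv F X hX).ap ((t, x) + s • ((0, Pi.single j 1) : Pt))) =
      fun s : ℝ => F.ap ((0, x - X t) + s • ((0, Pi.single j 1) : Pt)) := by
    funext s
    rw [ap_mv]
    congr 1
    apply Prod.ext
    · simp
    · simp; abel
  rw [h3] at h1
  have := h1.unique h2
  simpa [ap_mv] using this

lemma dt_mv (F : Sm) (X : ℝ → Spc) (hX) {X' : Spc} {t : ℝ} (hd : HasDerivAt X X' t) (x : Spc) :
    (dt (mv F X hX)).ap (t, x) = -∑ i, (X' i : ℂ) * (dx i F).ap (0, x - X t) := by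
  have h1 := hasDerivAt_time (mv F X hX) t x
  have hc : HasDerivAt (fun s : ℝ => ((0, x - X s) : Pt)) (0, -X') t := by
    have := hd.const_sub x
    exact (hasDerivAt_const t (0:ℝ)).prodMk this
  have h2 := (F.diff (0, x - X t)).hasFDerivAt.comp_hasDerivAt t hc
  have h3 := h1.unique h2
  rw [h3]
  have : ((0, -X') : Pt) = -∑ j, X' j • ((0, Pi.single j 1) : Pt) := by
    apply Prod.ext
    · simp [Prod.fst_sum]
    · simp only [Prod.snd_neg, Prod.snd_sum, Prod.smul_snd]
      funext i
      simp [Finset.sum_apply, Pi.single_apply]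
  rw [this, map_neg, map_sum]
  simp only [map_smul]
  rfl

/-- function along a curve -/
def al (f : Sm) (X : ℝ → Spc) (hX : ContDiff ℝ ∞ X) : Sm :=
  mk' (fun q => f.ap (q.1, X q.1))
    (f.smooth.comp (contDiff_fst.prodMk (hX.comp contDiff_fst))) (fun t x k => rfl)

lemma ap_al (f : Sm) (X hX) (q : Pt) : (al f X hX).ap q = f.ap (q.1, X q.1) := rfl

lemma dx_al (f : Sm) (X hX) (j : Fin 3) : dx j (al f X hX) = 0 := by
  ext ⟨t, x⟩
  have h1 := hasDerivAt_dir (al f X hX) (t, x) j 0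
  have h3 : (fun s : ℝ => (al f X hX).ap ((t, x) + s • ((0, Pi.single j 1) : Pt))) =
      fun s : ℝ => f.ap (t, X t) := by
    funext s
    simp [ap_al]
  rw [h3] at h1
  have := h1.unique (hasDerivAt_const _ _)
  simpa using this

/-- curve is a trajectory of `v` -/
def Traj (v : Fin 3 → Sm) (X : ℝ → Spc) : Prop := ∀ t, HasDerivAt X (vf v t (X t)) t

lemma Traj.smooth {v : Fin 3 → Sm} {X : ℝ → Spc} (h : Traj v X) : ContDiff ℝ ∞ X :=
  ode_smooth (vf_smooth v) h

variable {v : Fin 3 → Sm} {X : ℝ → Spc}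

lemma Traj.deriv_comp (hr : ∀ i, IsRe (v i)) (hT : Traj v X) (f : Sm) (t : ℝ) :
    HasDerivAt (fun s => f.ap (s, X s)) ((DD v f).ap (t, X t)) t := by
  have := f.hasDerivAt_curve (hT t)
  convert this using 1
  rw [DD_apply]
  simp only [ap_add, ap_sum, ap_mul]
  congr 1
  refine Finset.sum_congr rfl fun j _ => ?_
  rw [vf, (hr j).ofReal]

lemma DD_al (hr : ∀ i, IsRe (v i)) (hT : Traj v X) (f : Sm) :
    DD v (al f X hT.smooth) = al (DD v f) X hT.smooth := by
  rw [DD_apply]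
  simp only [dx_al, mul_zero, Finset.sum_const_zero, add_zero]
  ext ⟨t, x⟩
  exact (hasDerivAt_time (al f X hT.smooth) t x).unique (hT.deriv_comp hr f t)

/-- relative velocity -/
def uu (v : Fin 3 → Sm) (X : ℝ → Spc) (hX : ContDiff ℝ ∞ X) (i : Fin 3) : Sm := v i - al (v i) X hX

lemma DD_mv (hr : ∀ i, IsRe (v i)) (hT : Traj v X) (F : Sm) :
    DD v (mv F X hT.smooth) = ∑ i, uu v X hT.smooth i * mv (dx i F) X hT.smooth := by
  rw [DD_apply]
  ext ⟨t, x⟩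
  simp only [ap_add, ap_sum, ap_mul, uu, ap_sub, dt_mv F X hT.smooth (hT t) x, dx_mv, sub_mul,
    Finset.sum_sub_distrib]
  have : ∀ i, ((vf v t (X t) i : ℝ) : ℂ) = (al (v i) X hT.smooth).ap (t, x) := by
    intro i
    rw [ap_al, vf, (hr i).ofReal]
  simp only [this, ap_mv]
  ring

lemma DD_uu (hr : ∀ i, IsRe (v i)) (hT : Traj v X) (i : Fin 3) :
    DD v (uu v X hT.smooth i) = DD v (v i) - al (DD v (v i)) X hT.smooth := by
  unfold uu
  rw [map_sub, DD_al hr hT]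

lemma Bd.mv {n : ℕ} {A μ : ℝ} {F : Sm} (h : Bd Set.univ n A μ F) (X hX) :
    Bd Set.univ n A μ (Sm.mv F X hX) := by
  induction n generalizing A F with
  | zero => exact fun q _ => h _ trivial
  | succ n ih => exact ⟨fun q _ => h.1 _ trivial, fun j => by rw [dx_mv]; exact ih (h.2 j)⟩

lemma exists_traj {B L : ℝ} (hb : ∀ i q, ‖(v i).ap q‖ ≤ B) (hL : ∀ i j t, TB t L (dx j (v i)))
    (t0 : ℝ) (x0 : Spc) : ∃ X, X t0 = x0 ∧ Traj v X := by
  have hB : 0 ≤ B := (norm_nonneg _).trans (hb 0 0)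
  have hL0 : 0 ≤ L := (norm_nonneg _).trans (hL 0 0 0 0)
  have hl : ∀ t, LipschitzWith (3 * L.toNNReal) (vf v t) := by
    apply vf_lip
    intro i j t
    rw [Real.coe_toNNReal _ hL0]
    exact hL i j t
  refine ode_global (B := B.toNNReal) (vf_smooth v).continuous hl ?_ t0 x0
  intro t x
  rw [Real.coe_toNNReal _ hB, pi_norm_le_iff_of_nonneg hB]
  intro i
  exact (Complex.abs_re_le_norm _).trans (hb i _)

/-- mean value inequality along trajectories -/
lemma Traj.mvt (hr : ∀ i, IsRe (v i)) (hT : Traj v X) (f : Sm) {C : ℝ} (s t : ℝ)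
    (h : ∀ r, |r - s| ≤ |t - s| → ‖(DD v f).ap (r, X r)‖ ≤ C) :
    ‖f.ap (t, X t) - f.ap (s, X s)‖ ≤ C * |t - s| := by
  have := (convex_uIcc s t).norm_image_sub_le_of_norm_hasDerivWithin_le (C := C)
    (f := fun s => f.ap (s, X s)) (fun r _ => (hT.deriv_comp hr f r).hasDerivWithinAt)
    (fun r hr' => h r (by
      rw [abs_sub_comm r s, abs_sub_comm t s, ← Real.dist_eq, ← Real.dist_eq]
      exact Real.dist_left_le_of_mem_uIcc hr'))
    (Set.left_mem_uIcc) (Set.right_mem_uIcc)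
  simpa using this

end Sm

end

/-! ### Part 6 -/

section

/-- cutoff profiles -/
structure Prof where
  h : ℝ → ℝ
  sm : ContDiff ℝ ∞ h
  z : ∀ y, 2/3 < |y| → h y = 0

namespace Prof

def der (p : Prof) : Prof where
  h := deriv p.h
  sm := (contDiff_infty_iff_deriv.1 p.sm).2
  z := by
    intro y hy
    have : p.h =ᶠ[nhds y] fun _ => 0 := by
      have : IsOpen {y : ℝ | 2/3 < |y|} := isOpen_lt continuous_const continuous_abs
      filter_upwards [this.mem_nhds hy] with x hx using p.z x hx
    rw [this.deriv_eq]; simp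

lemma bdd (p : Prof) : ∃ C, 0 ≤ C ∧ ∀ y, |p.h y| ≤ C := by
  obtain ⟨C, hC⟩ := (isCompact_Icc (a := (-1:ℝ)) (b := 1)).exists_bound_of_continuousOn
    p.sm.continuous.continuousOn
  refine ⟨max C 0, le_max_right _ _, fun y => ?_⟩
  by_cases hy : 2/3 < |y|
  · rw [p.z y hy]; simp
  · push Not at hy
    have := abs_le.1 hy
    exact (hC y ⟨by linarith [this.1], by linarith [this.2]⟩).trans (le_max_left _ _)

lemma hd (p : Prof) (y : ℝ) : HasDerivAt p.h (p.der.h y) y :=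
  (p.sm.differentiable (by simp) y).hasDerivAt

/-- periodized rescaled profile -/
def gK (p : Prof) (K : ℕ) (y : ℝ) : ℝ := p.h (K * (y - round y))

lemma round_eq_of {y : ℝ} {r : ℤ} (h1 : -(1/2) ≤ y - r) (h2 : y - r < 1/2) : round y = r := by
  rw [round_eq, Int.floor_eq_iff]
  constructor <;> linarith

lemma gK_hasDerivAt (p : Prof) {K : ℕ} (hK : 2 ≤ K) (y : ℝ) :
    HasDerivAt (p.gK K) (K * p.der.gK K y) y := by
  have hK' : (2:ℝ) ≤ K := by exact_mod_cast hK
  have hr := abs_sub_round y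
  rcases lt_or_eq_of_le hr with hlt | heq
  · have h1 := abs_lt.1 hlt
    have hev : p.gK K =ᶠ[nhds y] fun x => p.h (K * (x - round y)) := by
      filter_upwards [Ioo_mem_nhds (a := (round y : ℝ) - 1/2) (b := round y + 1/2)
        (by linarith [h1.1]) (by linarith [h1.2])] with x hx
      unfold gK
      rw [round_eq_of (y := x) (r := round y) (by linarith [hx.1]) (by linarith [hx.2])]
    refine HasDerivAt.congr_of_eventuallyEq ?_ hev
    have h2 : HasDerivAt (fun x : ℝ => (K:ℝ) * (x - round y)) (K * 1) y :=
      ((hasDerivAt_id y).sub_const _).const_mul _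
    have := (p.hd (K * (y - round y))).comp y h2
    refine this.congr_deriv ?_
    rw [mul_one, mul_comm]; rfl
  · have hzero : ∀ p : Prof, ∀ x : ℝ, 2/5 < |x - round x| → p.gK K x = 0 := by
      intro p x hx
      apply p.z
      rw [abs_mul, abs_of_nonneg (by linarith : (0:ℝ) ≤ K)]
      nlinarith
    have hcont : Continuous fun x : ℝ => |x - round x| := by
      have h3 : (fun x : ℝ => |x - round x|) = fun x : ℝ => ‖(x : UnitAddCircle)‖ := by
        funext x; rw [UnitAddCircle.norm_eq]
      rw [h3]
      exact continuous_norm.comp (AddCircle.continuous_mk' 1)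
    have hev : p.gK K =ᶠ[nhds y] fun _ => 0 := by
      have : IsOpen {x : ℝ | 2/5 < |x - round x|} := isOpen_lt continuous_const hcont
      filter_upwards [this.mem_nhds (show 2/5 < |y - round y| by rw [heq]; norm_num)] with x hx
      exact hzero p x hx
    refine HasDerivAt.congr_of_eventuallyEq ?_ hev
    rw [hzero p.der y (by rw [heq]; norm_num), mul_zero]
    exact hasDerivAt_const _ _

lemma gK_smooth (p : Prof) {K : ℕ} (hK : 2 ≤ K) : ContDiff ℝ ∞ (p.gK K) := by
  rw [contDiff_infty]
  intro n
  induction n generalizing p with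
  | zero =>
    rw [CharP.cast_eq_zero, contDiff_zero]
    exact continuous_iff_continuousAt.2 fun y => (p.gK_hasDerivAt hK y).continuousAt
  | succ n ih =>
    have : ((n + 1 : ℕ) : WithTop ℕ∞) = (n : WithTop ℕ∞) + 1 := by simp
    rw [this, contDiff_succ_iff_deriv]
    refine ⟨fun t => (p.gK_hasDerivAt hK t).differentiableAt, by simp, ?_⟩
    have h : deriv (p.gK K) = fun t => K * p.der.gK K t :=
      funext fun t => (p.gK_hasDerivAt hK t).deriv
    rw [h]
    exact contDiff_const.mul (ih _)

lemma gK_per (p : Prof) (K : ℕ) (y : ℝ) (k : ℤ) : p.gK K (y + k) = p.gK K y := by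
  unfold gK
  rw [round_add_intCast]
  congr 2
  push_cast; ring

/-- the base profile -/
def base : Prof where
  h := fun z => Real.sin (Real.pi / 2 * Real.smoothTransition (3 * z + 2)) *
    Real.cos (Real.pi / 2 * Real.smoothTransition (3 * z - 1))
  sm := by
    have : ContDiff ℝ ∞ Real.smoothTransition := Real.smoothTransition.contDiff
    apply ContDiff.mul
    · apply Real.contDiff_sin.comp
      apply contDiff_const.mul
      apply this.comp
      fun_prop
    · apply Real.contDiff_cos.comp
      apply contDiff_const.mul
      apply this.comp
      fun_prop
  z := by
    intro y hy
    rcases lt_abs.1 hy with h | h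
    · rw [Real.smoothTransition.one_of_one_le (by linarith : 1 ≤ 3 * y - 1)]
      simp
    · rw [Real.smoothTransition.zero_of_nonpos (by linarith : 3 * y + 2 ≤ 0)]
      simp

lemma base_one {z : ℝ} (h0 : 0 ≤ z) (h1 : z ≤ 1) : base.h z ^ 2 + base.h (z - 1) ^ 2 = 1 := by
  unfold base
  simp only
  rw [Real.smoothTransition.one_of_one_le (by linarith : 1 ≤ 3 * z + 2),
    Real.smoothTransition.zero_of_nonpos (by linarith : 3 * (z - 1) - 1 ≤ 0)]
  have : 3 * (z - 1) + 2 = 3 * z - 1 := by ring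
  rw [this]
  simp [Real.cos_sq_add_sin_sq]

lemma base_time {z : ℝ} {m : ℕ} (h : |z| < m) :
    ∑ l ∈ Finset.Icc (-(m:ℤ)) m, base.h (z - l) ^ 2 = 1 := by
  have h' := abs_lt.1 h
  have hf1 := Int.floor_le z
  have hf2 := Int.lt_floor_add_one z
  have m1 : ⌊z⌋ ∈ Finset.Icc (-(m:ℤ)) m := by
    rw [Finset.mem_Icc]
    constructor
    · rw [Int.le_floor]; push_cast; linarith
    · have : ((⌊z⌋ : ℤ) : ℝ) < ((m : ℤ) : ℝ) := by push_cast; linarith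
      exact (Int.cast_lt.1 this).le
  have m2 : ⌊z⌋ + 1 ∈ Finset.Icc (-(m:ℤ)) m := by
    rw [Finset.mem_Icc] at *
    constructor
    · linarith [m1.1]
    · have : ((⌊z⌋ : ℤ) : ℝ) < ((m : ℤ) : ℝ) := by push_cast; linarith
      have := (Int.cast_lt.1 this)
      omega
  rw [Finset.sum_eq_add_of_mem ⌊z⌋ (⌊z⌋ + 1) m1 m2 (by omega)]
  · have := base_one (z := z - ⌊z⌋) (by linarith) (by linarith)
    convert this using 4
    push_cast; ring
  · intro c _ hc
    rw [base.z]
    · simp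
    · have hlt : c < ⌊z⌋ ∨ ⌊z⌋ + 1 < c := by have := hc.1; have := hc.2; omega
      rw [lt_abs]
      rcases hlt with h | h
      · left
        have : (c:ℝ) + 1 ≤ ⌊z⌋ := by exact_mod_cast h
        linarith
      · right
        have : ((⌊z⌋:ℤ):ℝ) + 1 + 1 ≤ c := by exact_mod_cast h
        linarith

lemma base_space {K : ℕ} (hK : 2 ≤ K) (y : ℝ) :
    ∑ j : Fin K, base.gK K (y - (j : ℕ) / (K:ℝ)) ^ 2 = 1 := by
  have hK' : (2:ℝ) ≤ K := by exact_mod_cast hK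
  have hK0 : (0:ℝ) < K := by linarith
  have hKz : (0:ℤ) < K := by exact_mod_cast (by omega : 0 < K)
  set z := K * y with hz
  have hy : y = z / K := by rw [hz]; field_simp
  set n := ⌊z⌋ with hn
  have hf1 := Int.floor_le z
  have hf2 := Int.lt_floor_add_one z
  rw [← hn] at hf1 hf2
  -- value at index congruent to p
  have val : ∀ p r : ℤ, ∀ j : Fin K, (j : ℤ) = p - K * r → -(1:ℝ) ≤ z - p → z - p < 1 →
      base.gK K (y - (j : ℕ) / (K:ℝ)) = base.h (z - p) := by
    intro p r j hj h1 h2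
    have hjr : ((j : ℕ) : ℝ) = p - K * r := by exact_mod_cast hj
    have e : y - (j : ℕ) / (K:ℝ) - r = (z - p) / K := by
      rw [hy, hjr]; field_simp; ring
    have hround : round (y - (j : ℕ) / (K:ℝ)) = r := by
      apply round_eq_of
      · rw [e, le_div_iff₀ hK0]; linarith
      · rw [e, div_lt_iff₀ hK0]; linarith
    unfold gK
    rw [hround, e]
    congr 1
    field_simp
  have hlt : ∀ p : ℤ, (p % K).toNat < K := by
    intro p
    have := Int.emod_lt_of_pos p hKz
    have := Int.emod_nonneg p hKz.ne'
    omega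
  have hco : ∀ p : ℤ, (((⟨(p % K).toNat, hlt p⟩ : Fin K) : ℕ) : ℤ) = p - K * (p / K) := by
    intro p
    have := Int.emod_nonneg p hKz.ne'
    have := Int.emod_add_mul_ediv p K
    simp only
    omega
  have hne : (⟨(n % K).toNat, hlt n⟩ : Fin K) ≠ ⟨((n+1) % K).toNat, hlt (n+1)⟩ := by
    intro h
    have h1 := hco n
    have h2 := hco (n+1)
    rw [← h] at h2
    have h3 : (K:ℤ) * ((n+1)/K - n/K) = 1 := by linarith
    have h4 := Int.eq_one_or_neg_one_of_mul_eq_one h3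
    omega
  rw [Fintype.sum_eq_add _ _ hne]
  · rw [val n _ _ (hco n) (by linarith) (by linarith),
      val (n+1) _ _ (hco (n+1)) (by push_cast; linarith) (by push_cast; linarith)]
    have := base_one (z := z - n) (by linarith) (by linarith)
    convert this using 4
    push_cast; ring
  · intro j hj
    by_contra hcon
    have hnz : ¬ (2/3 < |(K:ℝ) * (y - (j : ℕ) / (K:ℝ) - round (y - (j : ℕ) / (K:ℝ)))|) := by
      intro h
      apply hcon
      unfold gK
      rw [base.z _ h]; simp
    push Not at hnz
    set r := round (y - (j : ℕ) / (K:ℝ)) with hr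
    have e : (K:ℝ) * (y - (j : ℕ) / (K:ℝ) - r) = z - ((j + K * r : ℤ) : ℝ) := by
      push_cast
      rw [hy]; field_simp; ring
    rw [e] at hnz
    have h1 := abs_le.1 hnz
    set p : ℤ := j + K * r with hp
    have hp2 : p = n ∨ p = n + 1 := by
      have a : (p:ℝ) < n + 2 := by linarith [h1.1]
      have b : ((n:ℤ):ℝ) < p + 1 := by linarith [h1.2]
      have a' : p < n + 2 := by exact_mod_cast a
      have b' : n < p + 1 := by exact_mod_cast b
      omega
    have hjm : (j : ℤ) = p % K := by
      rw [hp, Int.add_mul_emod_self_left, Int.emod_eq_of_lt] <;> omega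
    have hj2 : j = ⟨(p % K).toNat, hlt p⟩ := by
      ext
      simp only
      omega
    rcases hp2 with h | h
    · apply hj.1; rw [hj2]; congr 2; rw [h]
    · apply hj.2; rw [hj2]; congr 2; rw [h]

lemma base_space3 {K : ℕ} (hK : 2 ≤ K) (y : Spc) :
    ∑ j : Fin 3 → Fin K, ∏ i, base.gK K (y i - (j i : ℕ) / (K:ℝ)) ^ 2 = 1 := by
  have := Finset.prod_univ_sum (fun _ : Fin 3 => (Finset.univ : Finset (Fin K)))
    (fun i j => base.gK K (y i - (j : ℕ) / (K:ℝ)) ^ 2)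
  rw [Fintype.piFinset_univ] at this
  rw [← this]
  simp [base_space hK]

end Prof

end

/-! ### Part 7 -/

section

namespace Sm

/-- periodic cutoff in one coordinate -/
def gf (p : Prof) (K : ℕ) (hK : 2 ≤ K) (i : Fin 3) : Sm :=
  mk' (fun q => (p.gK K (q.2 i) : ℂ))
    (Complex.ofRealCLM.contDiff.comp ((p.gK_smooth hK).comp
      ((contDiff_apply ℝ ℝ i).comp contDiff_snd)))
    (fun t x k => by simp only [p.gK_per])

lemma ap_gf (p : Prof) (K hK i) (q : Pt) : (gf p K hK i).ap q = (p.gK K (q.2 i) : ℂ) := rfl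

lemma dx_gf (p : Prof) (K hK i j) :
    dx j (gf p K hK i) = if j = i then (K : ℂ) • gf p.der K hK i else 0 := by
  ext ⟨t, x⟩
  have h1 := hasDerivAt_dir (gf p K hK i) (t, x) j 0
  have h2 : HasDerivAt (fun s : ℝ => (gf p K hK i).ap ((t, x) + s • ((0, Pi.single j 1) : Pt)))
      (((if j = i then (K * p.der.gK K (x i)) else 0 : ℝ) : ℝ) : ℂ) 0 := by
    have h3 : (fun s : ℝ => (gf p K hK i).ap ((t, x) + s • ((0, Pi.single j 1) : Pt))) =
      fun s : ℝ => ((p.gK K (x i + s * (if i = j then 1 else 0)) : ℝ) : ℂ) := by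
      funext s
      simp [ap_gf, Pi.single_apply]
    rw [h3]
    refine HasDerivAt.ofReal_comp ?_
    by_cases hij : j = i
    · subst hij
      simp only [if_true, mul_one]
      have h4 : HasDerivAt (fun s : ℝ => x j + s) 1 0 := (hasDerivAt_id _).const_add _
      have h5 := p.gK_hasDerivAt hK (x j + 0)
      have := h5.comp (0:ℝ) h4
      simpa [Function.comp_def] using this
    · have : ¬ i = j := fun h => hij h.symm
      simp only [this, hij, if_false, mul_zero, add_zero]
      exact hasDerivAt_const _ _
  have := h1.unique h2
  simp only [zero_smul, add_zero] at this
  rw [this]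
  split_ifs <;> simp [ap_gf]

lemma Bd_gf (n : ℕ) : ∀ p : Prof, ∃ C : ℝ, 0 ≤ C ∧ ∀ (K : ℕ) (hK : 2 ≤ K) (i : Fin 3),
    Bd Set.univ n C K (gf p K hK i) := by
  induction n with
  | zero =>
    intro p
    obtain ⟨C, hC, h⟩ := p.bdd
    refine ⟨C, hC, fun K hK i q _ => ?_⟩
    rw [ap_gf, Complex.norm_real]
    exact h _
  | succ n ih =>
    intro p
    obtain ⟨C, hC, h⟩ := p.bdd
    obtain ⟨C', hC', h'⟩ := ih p.der
    refine ⟨max C C', hC.trans (le_max_left _ _), fun K hK i => ⟨fun q _ => ?_, fun j => ?_⟩⟩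
    · rw [ap_gf, Complex.norm_real]
      exact (h _).trans (le_max_left _ _)
    · rw [dx_gf]
      split_ifs
      · refine ((h' K hK i).smul (K:ℂ)).mono ?_ (by positivity)
        rw [Complex.norm_natCast, mul_comm]
        exact mul_le_mul_of_nonneg_right (le_max_right _ _) (by positivity)
      · exact Bd.zero (mul_nonneg (hC.trans (le_max_left _ _)) (by positivity)) (by positivity)

/-- cell profile -/
def Fc (K : ℕ) (hK : 2 ≤ K) : Sm := gf Prof.base K hK 0 * gf Prof.base K hK 1 * gf Prof.base K hK 2

lemma ap_Fc (K hK) (q : Pt) : (Fc K hK).ap q = ((∏ i, Prof.base.gK K (q.2 i) : ℝ) : ℂ) := by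
  simp [Fc, ap_gf, Fin.prod_univ_three]

lemma Bd_Fc (n : ℕ) : ∃ C : ℝ, 0 ≤ C ∧ ∀ (K : ℕ) (hK : 2 ≤ K), Bd Set.univ n C K (Fc K hK) := by
  obtain ⟨C, hC, h⟩ := Bd_gf n Prof.base
  exact ⟨_, by positivity, fun K hK => ((h K hK 0).mul (h K hK 1)).mul (h K hK 2)⟩

/-- time cutoff -/
def tc (p : Prof) (ν : ℝ) (l : ℤ) : Sm :=
  mk' (fun q => (p.h (ν * q.1 - l) : ℂ))
    (Complex.ofRealCLM.contDiff.comp (p.sm.comp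
      ((contDiff_const.mul contDiff_fst).sub contDiff_const)))
    (fun _ _ _ => rfl)

lemma ap_tc (p : Prof) (ν l) (q : Pt) : (tc p ν l).ap q = (p.h (ν * q.1 - l) : ℂ) := rfl

lemma dx_tc (p : Prof) (ν l j) : dx j (tc p ν l) = 0 := by
  ext ⟨t, x⟩
  have h1 := hasDerivAt_dir (tc p ν l) (t, x) j 0
  have h3 : (fun s : ℝ => (tc p ν l).ap ((t, x) + s • ((0, Pi.single j 1) : Pt))) =
      fun s : ℝ => (tc p ν l).ap (t, x) := by
    funext s
    simp [ap_tc]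
  rw [h3] at h1
  have := h1.unique (hasDerivAt_const _ _)
  simpa using this

lemma dt_tc (p : Prof) (ν l) : dt (tc p ν l) = (ν : ℂ) • tc p.der ν l := by
  ext ⟨t, x⟩
  have h1 := hasDerivAt_time (tc p ν l) t x
  have h2 : HasDerivAt (fun s : ℝ => (tc p ν l).ap (s, x)) ((p.der.h (ν * t - l) * ν : ℝ) : ℂ) t := by
    have h3 : (fun s : ℝ => (tc p ν l).ap (s, x)) = fun s : ℝ => ((p.h (ν * s - l) : ℝ) : ℂ) := rfl
    rw [h3]
    refine HasDerivAt.ofReal_comp ?_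
    have h4 : HasDerivAt (fun s : ℝ => ν * s - l) ν t := by
      simpa using ((hasDerivAt_id t).const_mul ν).sub_const (l:ℝ)
    exact (p.hd (ν * t - l)).comp t h4
  rw [h1.unique h2, ap_smul, ap_tc, Complex.ofReal_mul, mul_comm]

lemma DD_tc (v) (p : Prof) (ν l) : DD v (tc p ν l) = (ν : ℂ) • tc p.der ν l := by
  rw [DD_apply, dt_tc]
  simp [dx_tc]

lemma Bd_tc (p : Prof) : ∃ C : ℝ, 0 ≤ C ∧ ∀ (n : ℕ) (U : Set Pt) (μ ν : ℝ) (l : ℤ), 0 ≤ μ →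
    Bd U n C μ (tc p ν l) := by
  obtain ⟨C, hC, h⟩ := p.bdd
  have key : ∀ (ν : ℝ) (l : ℤ) (q : Pt), ‖(tc p ν l).ap q‖ ≤ C := by
    intro ν l q
    rw [ap_tc, Complex.norm_real]
    exact h _
  refine ⟨C, hC, fun n U μ ν l hμ => ?_⟩
  cases n with
  | zero => exact fun q _ => key ν l q
  | succ n => exact ⟨fun q _ => key ν l q, fun j => by
      rw [dx_tc]; exact Bd.zero (mul_nonneg hC hμ) hμ⟩

lemma GG_tc (p : Prof) : ∃ C : ℝ, 0 ≤ C ∧ ∀ (v : Fin 3 → Sm) (n : ℕ) (U : Set Pt) (μ ν : ℝ) (l : ℤ),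
    0 ≤ μ → 0 ≤ ν → GG v U n C μ ν (tc p ν l) := by
  obtain ⟨C, hC, h⟩ := Bd_tc p
  obtain ⟨C', hC', h'⟩ := Bd_tc p.der
  refine ⟨max C C', hC.trans (le_max_left _ _), fun v n U μ ν l hμ hν =>
    ⟨(h n U μ ν l hμ).mono (le_max_left _ _) hμ, ?_⟩⟩
  rw [DD_tc]
  refine ((h' n U μ ν l hμ).smul _).mono ?_ hμ
  rw [Complex.norm_real, Real.norm_of_nonneg hν, mul_comm]
  exact mul_le_mul_of_nonneg_right (le_max_right _ _) hν

end Sm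

end

/-! ### Part 8 -/

section

namespace Sm

/-- A stage of the iteration together with the parameters of the next step. -/
structure Dat (N : ℕ) where
  v : Fin 3 → Sm
  R : Fin 3 → Fin 3 → Sm
  p : Sm
  L : ℝ
  lam : ℝ
  ν : ℝ
  δ : ℝ
  T : ℝ
  K : ℕ
  Λ : ℕ
  hvr : ∀ i, IsRe (v i)
  hRr : ∀ i j, IsRe (R i j)
  hpr : IsRe p
  hdiv : ∑ j, dx j (v j) = 0
  heq : ∀ l, DD v (v l) + dx l p = ∑ j, dx j (R j l)
  hsym : ∀ i j, R i j = R j i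
  lam1 : 1 ≤ lam
  L1 : 1 ≤ L
  lamK : lam ≤ K
  K2 : 2 ≤ K
  Ke : Even K
  KΛ : K ≤ Λ
  Lν : 100 * L ≤ ν
  νΛ : ν ≤ Λ
  ΛL : Λ * L ≤ K * ν
  δ0 : 0 < δ
  δ1 : δ ≤ 1
  T0 : 0 ≤ T
  hv1 : ∀ i q, ‖(v i).ap q‖ ≤ 1
  hdv : ∀ i j, Bd Set.univ (N + 1) L lam (dx j (v i))
  hdDv : ∀ i j, Bd Set.univ N (L ^ 2) lam (dx j (DD v (v i)))
  hR : ∀ i j q, ‖(R i j).ap q‖ ≤ δ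
  hdR : ∀ i j k q, ‖(dx k (R i j)).ap q‖ ≤ δ * lam
  hDR : ∀ i j q, ‖(DD v (R i j)).ap q‖ ≤ δ * L
  hsupp : ∀ i j q, T < |q.1| → (R i j).ap q = 0

lemma norm_sum_overlap' {ι : Type*} {A : ℝ} (s : Finset ι) (U : ι → Set Pt) {M : ℕ} (F : ι → Sm) (q : Pt)
    (hM : ∀ t ⊆ s, (∀ i ∈ t, q ∈ U i) → t.card ≤ M) (hA : 0 ≤ A)
    (hs : ∀ i ∈ s, q ∉ U i → (F i).ap q = 0) (h : ∀ i ∈ s, q ∈ U i → ‖(F i).ap q‖ ≤ A) :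
    ‖(∑ i ∈ s, F i).ap q‖ ≤ M * A := by
  classical
  rw [ap_sum]
  have h1 : ∑ i ∈ s, (F i).ap q = ∑ i ∈ s.filter (fun i => q ∈ U i), (F i).ap q := by
    rw [Finset.sum_filter]
    refine Finset.sum_congr rfl fun i hi => ?_
    split_ifs with hq
    · rfl
    · exact hs i hi hq
  rw [h1]
  have h2 : (s.filter (fun i => q ∈ U i)).card ≤ M :=
    hM _ (Finset.filter_subset _ _) fun i hi => (Finset.mem_filter.1 hi).2
  calc _ ≤ ∑ i ∈ s.filter (fun i => q ∈ U i), A :=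
        norm_sum_le_of_le _ fun i hi => h i (Finset.mem_filter.1 hi).1 (Finset.mem_filter.1 hi).2
    _ = (s.filter (fun i => q ∈ U i)).card * A := by simp
    _ ≤ M * A := by
        apply mul_le_mul_of_nonneg_right _ hA
        exact_mod_cast h2

/-- static cell -/
def U0 (K : ℕ) : Set Pt := {q | ∀ i, ‖((q.2 i : ℝ) : UnitAddCircle)‖ ≤ 2 / (3 * K)}

lemma U0_closed (K : ℕ) : IsClosed (U0 K) := by
  have : U0 K = ⋂ i, {q : Pt | ‖((q.2 i : ℝ) : UnitAddCircle)‖ ≤ 2 / (3 * K)} := by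
    ext q; simp [U0]
  rw [this]
  refine isClosed_iInter fun i => isClosed_le ?_ continuous_const
  have h1 : Continuous (fun y : ℝ => ((y : ℝ) : UnitAddCircle)) := continuous_quotient_mk'
  exact (h1.comp ((continuous_apply i).comp continuous_snd)).norm

lemma Fc_supp (K : ℕ) (hK : 2 ≤ K) : Supp (U0 K) (Fc K hK) := by
  intro q hq
  obtain ⟨i, hi⟩ := not_forall.1 hq
  rw [ap_Fc, Finset.prod_eq_zero (Finset.mem_univ i)]
  · simp
  · apply Prof.z
    have hK0 : (0:ℝ) < K := by positivity
    rw [UnitAddCircle.norm_eq, not_le, div_lt_iff₀ (by positivity)] at hi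
    rw [abs_mul, abs_of_pos hK0]
    linarith

namespace Dat
variable {N : ℕ} (d : Dat N)

lemma L0 : 0 < d.L := by linarith [d.L1]
lemma ν0 : 0 < d.ν := by linarith [d.L1, d.Lν]
lemma ν1 : 1 ≤ d.ν := by linarith [d.L1, d.Lν]
lemma K0 : (0:ℝ) < d.K := by have := d.K2; positivity
lemma lam0 : 0 ≤ d.lam := by linarith [d.lam1]
lemma Λ0 : (0:ℝ) < d.Λ := by linarith [d.ν0, d.νΛ]
lemma KΛ' : (d.K:ℝ) ≤ d.Λ := by exact_mod_cast d.KΛ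
lemma K1 : (1:ℝ) ≤ d.K := by linarith [d.lamK, d.lam1]
lemma Λ1 : (1:ℝ) ≤ d.Λ := by linarith [d.K1, d.KΛ']
lemma LLν : d.L ≤ d.ν := by linarith [d.L1, d.Lν]

lemma TBv (i j : Fin 3) (t : ℝ) : TB t d.L (dx j (d.v i)) := fun _ => (d.hdv i j).le trivial

abbrev Cell : Type := ℤ × (Fin 3 → Fin d.K)

lemma exX (c : d.Cell) : ∃ X : ℝ → Spc, X (c.1 / d.ν) = (fun i => ((c.2 i : ℕ) : ℝ) / d.K) ∧ Traj d.v X :=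
  exists_traj d.hv1 d.TBv _ _

def X (c : d.Cell) : ℝ → Spc := Classical.choose (d.exX c)
lemma X_init (c : d.Cell) : d.X c (c.1 / d.ν) = (fun i => ((c.2 i : ℕ) : ℝ) / d.K) :=
  (Classical.choose_spec (d.exX c)).1
lemma X_traj (c : d.Cell) : Traj d.v (d.X c) := (Classical.choose_spec (d.exX c)).2
lemma X_sm (c : d.Cell) : ContDiff ℝ ∞ (d.X c) := (d.X_traj c).smooth

def U (c : d.Cell) : Set Pt := {q | |d.ν * q.1 - c.1| ≤ 2 / 3 ∧
  ∀ i, ‖((q.2 i - d.X c q.1 i : ℝ) : UnitAddCircle)‖ ≤ 2 / (3 * d.K)}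

lemma U_closed (c : d.Cell) : IsClosed (d.U c) := by
  have hX := (d.X_sm c).continuous
  have h0 : IsClosed {q : Pt | |d.ν * q.1 - c.1| ≤ 2 / 3} :=
    isClosed_le (by fun_prop) continuous_const
  have h1 : Continuous (fun q : Pt => ((0, q.2 - d.X c q.1) : Pt)) := by fun_prop
  exact h0.inter ((U0_closed d.K).preimage h1)

lemma supp_tcmv (c : d.Cell) (p : Prof) {F : Sm} (hF : Supp (U0 d.K) F) :
    Supp (d.U c) (tc p d.ν c.1 * mv F (d.X c) (d.X_sm c)) := by
  intro q hq
  rw [ap_mul, ap_tc, ap_mv]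
  by_cases h : |d.ν * q.1 - c.1| ≤ 2 / 3
  · have : ((0, q.2 - d.X c q.1) : Pt) ∉ U0 d.K := fun h' => hq ⟨h, h'⟩
    rw [hF _ this, mul_zero]
  · rw [p.z _ (not_le.1 h)]
    simp

/-- nearest shift -/
lemma exists_shift {c : d.Cell} {q : Pt} (hq : q ∈ d.U c) :
    ∃ r : Fin 3 → ℤ, ∀ i, |q.2 i - (d.X c q.1 i + r i)| ≤ 2 / (3 * d.K) := by
  refine ⟨fun i => round (q.2 i - d.X c q.1 i), fun i => ?_⟩
  have := hq.2 i
  rw [UnitAddCircle.norm_eq] at this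
  rwa [← sub_sub]

lemma vf_per (t : ℝ) (x : Spc) (r : Fin 3 → ℤ) :
    vf d.v t (fun i => x i + r i) = vf d.v t x := by
  funext i
  simp only [vf, per]

lemma traj_shift {X : ℝ → Spc} (h : Traj d.v X) (r : Fin 3 → ℤ) :
    Traj d.v (fun t i => X t i + r i) := by
  intro t
  rw [d.vf_per]
  have := (h t).add_const (fun i => (r i : ℝ))
  exact this

lemma vlip (t : ℝ) : LipschitzWith (3 * d.L.toNNReal) (vf d.v t) := by
  apply vf_lip
  intro i j t
  rw [Real.coe_toNNReal _ d.L0.le]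
  exact d.TBv i j t

def col (c : d.Cell) : Bool × (Fin 3 → Bool) :=
  (decide (Even c.1), fun i => decide (Even (c.2 i : ℕ)))

lemma disjoint_col {c c' : d.Cell} {q : Pt} (h : q ∈ d.U c) (h' : q ∈ d.U c')
    (hc : d.col c = d.col c') : c = c' := by
  obtain ⟨l, j⟩ := c
  obtain ⟨l', j'⟩ := c'
  simp only [col, Prod.mk.injEq, decide_eq_decide] at hc
  have hl : l = l' := by
    have h1 := abs_le.1 h.1
    have h2 := abs_le.1 h'.1
    simp only at h1 h2
    have h3 : (l:ℝ) - l' < 2 := by linarith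
    have h4 : (l':ℝ) - l < 2 := by linarith
    have h5 : l - l' < 2 := by exact_mod_cast h3
    have h6 : l' - l < 2 := by exact_mod_cast h4
    have h7 : Even (l - l') := by rw [Int.even_sub]; exact hc.1
    obtain ⟨m, hm⟩ := h7
    omega
  subst hl
  obtain ⟨r, hr⟩ := d.exists_shift h
  obtain ⟨r', hr'⟩ := d.exists_shift h'
  have hK0 := d.K0
  have hν0 := d.ν0
  have hsep := ode_sep d.vlip (d.traj_shift (d.X_traj (l, j)) r) (d.traj_shift (d.X_traj (l, j')) r')
    (l / d.ν) q.1
  have hd : dist (fun i => d.X (l, j) q.1 i + (r i : ℝ)) (fun i => d.X (l, j') q.1 i + (r' i : ℝ))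
      ≤ 4 / (3 * d.K) := by
    rw [dist_pi_le_iff (by positivity)]
    intro i
    rw [Real.dist_eq]
    have e : (4:ℝ) / (3 * d.K) = 2 / (3 * d.K) + 2 / (3 * d.K) := by ring
    have h1 := hr i
    have h2 := hr' i
    rw [abs_sub_comm] at h1
    rw [e]
    exact (abs_sub_le _ (q.2 i) _).trans (add_le_add h1 h2)
  have ht : |q.1 - l / d.ν| ≤ 2 / (3 * d.ν) := by
    have := h.1
    simp only at this
    have e : q.1 - l / d.ν = (d.ν * q.1 - l) / d.ν := by field_simp
    rw [e, abs_div, abs_of_pos hν0, div_le_div_iff₀ hν0 (by positivity)]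
    nlinarith
  have hexp : Real.exp (((3 * d.L.toNNReal : ℝ≥0) : ℝ) * |q.1 - l / d.ν|) ≤ 5 / 4 := by
    rw [NNReal.coe_mul, Real.coe_toNNReal _ d.L0.le]
    have h1 : ((3:ℝ≥0):ℝ) * d.L * |q.1 - l / d.ν| ≤ 1 / 50 := by
      calc _ ≤ 3 * d.L * (2 / (3 * d.ν)) := by
            have := d.L0
            push_cast
            gcongr
        _ = 2 * d.L / d.ν := by field_simp
        _ ≤ 1 / 50 := by rw [div_le_div_iff₀ hν0 (by norm_num)]; linarith [d.Lν]
    calc _ ≤ Real.exp (1/50) := Real.exp_le_exp.2 h1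
      _ ≤ 1 / (1 - 1/50) := Real.exp_bound_div_one_sub_of_interval (by norm_num) (by norm_num)
      _ ≤ 5 / 4 := by norm_num
  have hfin : dist (fun i => d.X (l, j) (l / d.ν) i + (r i : ℝ))
      (fun i => d.X (l, j') (l / d.ν) i + (r' i : ℝ)) < 2 / d.K := by
    refine hsep.trans_lt ?_
    calc _ ≤ 4 / (3 * (d.K:ℝ)) * (5 / 4) := by gcongr
      _ < 2 / (d.K:ℝ) := by
        rw [div_mul_div_comm, div_lt_div_iff₀ (by positivity) hK0]
        nlinarith
  have e1 := d.X_init (l, j)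
  have e2 := d.X_init (l, j')
  simp only at e1 e2
  rw [e1, e2] at hfin
  congr 1
  funext i
  have h1 : dist (((j i : ℕ):ℝ) / d.K + r i) (((j' i : ℕ):ℝ) / d.K + r' i) < 2 / d.K :=
    (dist_le_pi_dist (fun i => ((j i : ℕ):ℝ) / d.K + (r i:ℝ)) (fun i => ((j' i : ℕ):ℝ) / d.K + (r' i:ℝ)) i).trans_lt hfin
  rw [Real.dist_eq] at h1
  have e3 : ((j i : ℕ):ℝ) / d.K + r i - (((j' i : ℕ):ℝ) / d.K + r' i)
      = (((j i : ℕ) : ℤ) - ((j' i : ℕ) : ℤ) + d.K * (r i - r' i) : ℤ) / (d.K : ℝ) := by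
    push_cast
    field_simp
    ring
  rw [e3, abs_div, abs_of_pos hK0, div_lt_div_iff_of_pos_right hK0] at h1
  have h2 : |(((j i : ℕ) : ℤ) - ((j' i : ℕ) : ℤ) + d.K * (r i - r' i) : ℤ)| < 2 := by exact_mod_cast h1
  have hev := congrFun hc.2 i
  rw [decide_eq_decide] at hev
  have h3 : Even (((j i : ℕ) : ℤ) - ((j' i : ℕ) : ℤ) + d.K * (r i - r' i) : ℤ) := by
    apply Even.add
    · rw [Int.even_sub, Int.even_coe_nat, Int.even_coe_nat]; exact hev
    · exact ((Int.even_coe_nat d.K).2 d.Ke).mul_right _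
  obtain ⟨a, ha⟩ := h3
  rw [ha] at h2
  have h4 : a = 0 := by
    rw [abs_lt] at h2; omega
  rw [h4] at ha
  have hj := (j i).2
  have hj' := (j' i).2
  have h5 : r i - r' i = 0 := by
    by_contra hne
    rcases lt_or_gt_of_ne hne with h6 | h6 <;> nlinarith
  rw [h5] at ha
  apply Fin.ext
  omega

lemma overlap (q : Pt) (t : Finset d.Cell) (h : ∀ c ∈ t, q ∈ d.U c) : t.card ≤ 16 := by
  classical
  have h1 : t.card = (t.image d.col).card :=
    (Finset.card_image_of_injOn fun c hc c' hc' he => d.disjoint_col (h c hc) (h c' hc') he).symm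
  rw [h1]
  refine (Finset.card_le_univ _).trans ?_
  simp [Fintype.card_prod, Fintype.card_pi]

end Dat
end Sm

end

/-! ### Part 9 -/

section

namespace Sm
namespace Dat

lemma near {N : ℕ} (d : Dat N) {c : d.Cell} {q : Pt} (hq : q ∈ d.U c) (f : Sm) {A : ℝ} (hA : 0 ≤ A)
    (h : ∀ j p, ‖(dx j f).ap p‖ ≤ A) :
    ‖f.ap q - f.ap (q.1, d.X c q.1)‖ ≤ 2 * A / d.K := by
  obtain ⟨r, hr⟩ := d.exists_shift hq
  obtain ⟨t, x⟩ := q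
  have h1 := lip_x f (t := t) (fun j x => h j (t, x)) x (fun i => d.X c t i + r i)
  rw [per] at h1
  have h2 : dist x (fun i => d.X c t i + (r i:ℝ)) ≤ 2 / (3 * d.K) := by
    have := d.K0
    rw [dist_pi_le_iff (by positivity)]
    intro i
    rw [Real.dist_eq]
    exact hr i
  refine h1.trans ?_
  calc 3 * A * dist x (fun i => d.X c t i + (r i:ℝ)) ≤ 3 * A * (2 / (3 * d.K)) := by gcongr
    _ = 2 * A / d.K := by have := d.K0; field_simp

/-- relative velocity in a cell -/
def u {N : ℕ} (d : Dat N) (c : d.Cell) (i : Fin 3) : Sm := uu d.v (d.X c) (d.X_sm c) i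

section
variable {N : ℕ} (d : Dat N)

lemma dx_u (c : d.Cell) (i j : Fin 3) : dx j (d.u c i) = dx j (d.v i) := by
  rw [u, uu, map_sub, dx_al, sub_zero]

lemma u_Bd (c : d.Cell) (i : Fin 3) : Bd (d.U c) (N + 2) (2 * d.L / d.K) d.K (d.u c i) := by
  refine ⟨fun q hq => ?_, fun j => ?_⟩
  · rw [u, uu, ap_sub, ap_al]
    exact d.near hq _ d.L0.le fun j p => (d.hdv i j).le trivial
  · rw [dx_u]
    refine (((d.hdv i j).mono_U (Set.subset_univ _)).mono_μ d.L0.le d.lam0 d.lamK).mono ?_ d.K0.le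
    rw [div_mul_cancel₀ _ d.K0.ne']
    linarith [d.L0]

lemma u_GG (c : d.Cell) (i : Fin 3) : GG d.v (d.U c) (N + 1) (2 * d.L / d.K) d.K d.ν (d.u c i) := by
  refine ⟨(d.u_Bd c i).pred, ?_⟩
  have hL := d.L0
  have hK := d.K0
  rw [u, DD_uu d.hvr (d.X_traj c)]
  refine ⟨fun q hq => ?_, fun j => ?_⟩
  · rw [ap_sub, ap_al]
    refine (d.near hq _ (sq_nonneg d.L) fun j p => (d.hdDv i j).le trivial).trans ?_
    rw [div_mul_eq_mul_div]
    refine div_le_div_of_nonneg_right ?_ hK.le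
    nlinarith [d.LLν]
  · rw [map_sub, dx_al, sub_zero]
    refine (((d.hdDv i j).mono_U (Set.subset_univ _)).mono_μ (sq_nonneg _) d.lam0 d.lamK).mono ?_ d.K0.le
    have : 2 * d.L / d.K * d.ν * d.K = 2 * d.L * d.ν := by field_simp
    rw [this]
    nlinarith [d.LLν]

lemma dv_GG (i j : Fin 3) : GG d.v Set.univ N ((1 + 3 * 2 ^ N) * d.L) d.K d.ν (dx j (d.v i)) := by
  have hL := d.L0
  have h2 : (0:ℝ) < 2 ^ N := by positivity
  have hv : ∀ i j, Bd Set.univ N d.L d.K (dx j (d.v i)) := fun i j =>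
    ((d.hdv i j).pred).mono_μ d.L0.le d.lam0 d.lamK
  refine ⟨(hv i j).mono (by nlinarith) d.K0.le, ?_⟩
  rw [DD_dx]
  refine (((d.hdDv i j).mono_μ (sq_nonneg _) d.lam0 d.lamK).sub
    (Bd.sum3 d.K0.le fun k => (hv k j).mul (hv i k))).mono ?_ d.K0.le
  have := mul_le_mul_of_nonneg_left d.LLν hL.le
  nlinarith [mul_le_mul_of_nonneg_left this h2.le]

lemma Dmv_Bd (c : d.Cell) {F : Sm} {A : ℝ} (hF : Bd Set.univ (N + 3) A d.K F) :
    Bd (d.U c) (N + 2) (6 * 2 ^ (N + 2) * (A * d.L)) d.K (DD d.v (mv F (d.X c) (d.X_sm c))) := by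
  have hK := d.K0
  rw [DD_mv d.hvr (d.X_traj c)]
  refine (Bd.sum3 hK.le fun i => (d.u_Bd c i).mul
    (((hF.dx i).mv (d.X c) (d.X_sm c)).mono_U (Set.subset_univ _))).mono (le_of_eq ?_) hK.le
  field_simp
  ring

lemma mv_GG (c : d.Cell) {F : Sm} {A : ℝ} (hA : 0 ≤ A) (hF : Bd Set.univ (N + 3) A d.K F) :
    GG d.v (d.U c) (N + 2) (6 * 2 ^ (N + 2) * A) d.K d.ν (mv F (d.X c) (d.X_sm c)) := by
  have hK := d.K0
  have h2 : (1:ℝ) ≤ 2 ^ (N + 2) := one_le_pow₀ (by norm_num)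
  refine ⟨((hF.pred.mv (d.X c) (d.X_sm c)).mono_U (Set.subset_univ _)).mono (by nlinarith) hK.le,
    (d.Dmv_Bd c hF).mono ?_ hK.le⟩
  have := d.LLν
  calc 6 * 2 ^ (N + 2) * (A * d.L) ≤ 6 * 2 ^ (N + 2) * (A * d.ν) := by gcongr
    _ = _ := by ring

lemma Dmv_GG (c : d.Cell) {F : Sm} {A : ℝ} (hA : 0 ≤ A) (hF : Bd Set.univ (N + 4) A d.K F) :
    GG d.v (d.U c) (N + 1) (36 * 2 ^ (N + 2) * 2 ^ (N + 2) * (A * d.L)) d.K d.ν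
      (DD d.v (mv F (d.X c) (d.X_sm c))) := by
  have hK := d.K0
  have hL := d.L0
  rw [DD_mv d.hvr (d.X_traj c)]
  refine (GG.sum3 hK.le fun i => (d.u_GG c i).mul hK.le d.ν0.le (by positivity) (by positivity)
    ((d.mv_GG c (A := A * d.K) (by positivity) (hF.dx i)).of_le (by omega))).mono (le_of_eq ?_) hK.le d.ν0.le
  field_simp
  ring
end

lemma cellfn (N : ℕ) (p : Prof) : ∃ C : ℝ, 0 ≤ C ∧ ∀ (d : Dat N) (c : d.Cell) (F : Sm) (A : ℝ), 0 ≤ A →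
    Bd Set.univ (N + 4) A d.K F →
    GG d.v (d.U c) (N + 2) (C * A) d.K d.ν (tc p d.ν c.1 * mv F (d.X c) (d.X_sm c)) ∧
    GG d.v (d.U c) (N + 1) (C * A * d.ν) d.K d.ν (DD d.v (tc p d.ν c.1 * mv F (d.X c) (d.X_sm c))) := by
  obtain ⟨C1, h1, hC1⟩ := GG_tc p
  obtain ⟨C2, h2, hC2⟩ := GG_tc p.der
  set a : ℝ := 2 ^ (N + 3) * (C1 * (6 * 2 ^ (N + 2))) with ha
  set b : ℝ := 2 ^ (N + 2) * (C2 * (6 * 2 ^ (N + 2))) + 2 ^ (N + 2) * (C1 * (36 * 2 ^ (N + 2) * 2 ^ (N + 2))) with hb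
  have ha0 : 0 ≤ a := by positivity
  have hb0 : 0 ≤ b := by positivity
  refine ⟨a + b, by positivity, fun d c F A hA hF => ⟨?_, ?_⟩⟩
  · have hK := d.K0
    have hν := d.ν0
    refine ((hC1 d.v (N + 2) (d.U c) d.K d.ν c.1 hK.le hν.le).mul hK.le hν.le h1 (by positivity)
      (d.mv_GG c hA hF.pred)).mono ?_ hK.le hν.le
    have : 0 ≤ b * A := by positivity
    rw [ha]
    linarith
  · have hK := d.K0
    have hν := d.ν0
    have hL := d.L0
    rw [leib, DD_tc, smul_mul_assoc]
    have e1 := ((hC2 d.v (N + 1) (d.U c) d.K d.ν c.1 hK.le hν.le).mul hK.le hν.le h2 (by positivity)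
      ((d.mv_GG c hA hF.pred).of_le (by omega))).smul (d.ν : ℂ)
    have e2 := (hC1 d.v (N + 1) (d.U c) d.K d.ν c.1 hK.le hν.le).mul hK.le hν.le h1 (by positivity)
      (d.Dmv_GG c hA hF)
    refine (e1.add e2).mono ?_ hK.le hν.le
    rw [Complex.norm_real, Real.norm_of_nonneg hν.le]
    calc _ ≤ d.ν * (2 ^ (N + 1 + 1) * (C2 * (6 * 2 ^ (N + 2) * A))) +
          2 ^ (N + 1 + 1) * (C1 * (36 * 2 ^ (N + 2) * 2 ^ (N + 2) * (A * d.ν))) := by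
            have := d.LLν
            gcongr
      _ = b * A * d.ν := by rw [hb]; ring
      _ ≤ _ := by
        have : 0 ≤ a * A * d.ν := by positivity
        linarith

section
variable {N : ℕ} (d : Dat N)

/-- cutoff of a cell -/
def ζ (c : d.Cell) : Sm := tc Prof.base d.ν c.1 * mv (Fc d.K d.K2) (d.X c) (d.X_sm c)

lemma ζ_supp (c : d.Cell) : Supp (d.U c) (d.ζ c) := d.supp_tcmv c _ (Fc_supp _ _)

lemma ζ_re (c : d.Cell) : cj (d.ζ c) = d.ζ c := by
  ext q
  rw [ap_cj, ζ, ap_mul, ap_tc, ap_mv, ap_Fc, map_mul, Complex.conj_ofReal, Complex.conj_ofReal]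

lemma dx_ζ (c : d.Cell) (j : Fin 3) :
    dx j (d.ζ c) = tc Prof.base d.ν c.1 * mv (dx j (Fc d.K d.K2)) (d.X c) (d.X_sm c) := by
  rw [ζ, leib, dx_tc, dx_mv, zero_mul, zero_add]
end

lemma ζ_GG (N : ℕ) : ∃ C : ℝ, 0 ≤ C ∧ ∀ (d : Dat N) (c : d.Cell),
    GG d.v (d.U c) (N + 2) C d.K d.ν (d.ζ c) ∧
    GG d.v (d.U c) (N + 1) (C * d.ν) d.K d.ν (DD d.v (d.ζ c)) ∧
    (∀ j, GG d.v (d.U c) (N + 2) (C * d.K) d.K d.ν (dx j (d.ζ c))) ∧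
    ∀ j, GG d.v (d.U c) (N + 1) (C * d.K * d.ν) d.K d.ν (DD d.v (dx j (d.ζ c))) := by
  obtain ⟨C, hC, h⟩ := cellfn N Prof.base
  obtain ⟨C', hC', h'⟩ := Bd_Fc (N + 5)
  refine ⟨C * C', by positivity, fun d c => ⟨?_, ?_, fun j => ?_, fun j => ?_⟩⟩
  · exact (h d c _ C' hC' (h' d.K d.K2).pred).1
  · exact (h d c _ C' hC' (h' d.K d.K2).pred).2
  · rw [dx_ζ]
    have := (h d c _ (C' * d.K) (by positivity) ((h' d.K d.K2).dx j)).1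
    rwa [← mul_assoc] at this
  · rw [dx_ζ]
    have := (h d c _ (C' * d.K) (by positivity) ((h' d.K d.K2).dx j)).2
    rwa [← mul_assoc C] at this

/-- spatial sum of squares -/
def S {N : ℕ} (d : Dat N) (l : ℤ) : Sm := ∑ j : Fin 3 → Fin d.K,
  mv (Fc d.K d.K2) (d.X (l, j)) (d.X_sm (l, j)) * mv (Fc d.K d.K2) (d.X (l, j)) (d.X_sm (l, j))

lemma S_init {N : ℕ} (d : Dat N) (l : ℤ) (x : Spc) : (d.S l).ap (l / d.ν, x) = 1 := by
  rw [S, ap_sum]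
  have := Prof.base_space3 d.K2 x
  rw [← Complex.ofReal_one, ← this, Complex.ofReal_sum]
  refine Finset.sum_congr rfl fun j _ => ?_
  have e := d.X_init (l, j)
  simp only at e
  rw [ap_mul, ap_mv, ap_Fc, e, Finset.prod_pow]
  push_cast
  rw [sq]
  rfl

lemma time_le {N : ℕ} (d : Dat N) {l : ℤ} {t : ℝ} (h : |d.ν * t - l| ≤ 2 / 3) :
    |t - l / d.ν| ≤ 2 / (3 * d.ν) := by
  have hν0 := d.ν0
  have e : t - l / d.ν = (d.ν * t - l) / d.ν := by field_simp
  rw [e, abs_div, abs_of_pos hν0, div_le_div_iff₀ hν0 (by positivity)]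
  nlinarith

lemma S_near (N : ℕ) : ∃ C : ℝ, 0 ≤ C ∧ ∀ (d : Dat N) (l : ℤ) (q : Pt), |d.ν * q.1 - l| ≤ 2 / 3 →
    ‖(d.S l).ap q - 1‖ ≤ C * (d.L / d.ν) ∧ ‖(DD d.v (d.S l)).ap q‖ ≤ C * d.L := by
  obtain ⟨C, hC, h⟩ := Bd_Fc (N + 3)
  set C1 : ℝ := 16 * (2 * (C * (6 * 2 ^ (N + 2) * C))) with hC1
  have key : ∀ (d : Dat N) (l : ℤ) (q : Pt), |d.ν * q.1 - l| ≤ 2 / 3 →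
      ‖(DD d.v (d.S l)).ap q‖ ≤ C1 * d.L := by
    intro d l q hq
    have hL := d.L0
    rw [S, map_sum]
    have := norm_sum_overlap' (A := 2 * (C * (6 * 2 ^ (N + 2) * C * d.L))) (M := 16) Finset.univ (fun j => d.U (l, j))
      (fun j => DD d.v (mv (Fc d.K d.K2) (d.X (l, j)) (d.X_sm (l, j)) *
        mv (Fc d.K d.K2) (d.X (l, j)) (d.X_sm (l, j)))) q ?_ (by positivity) ?_ ?_
    · refine this.trans (le_of_eq ?_)
      rw [hC1]; push_cast; ring
    · intro t _ ht
      have := d.overlap q (t.map ⟨fun j => (l, j), fun a b hab => by simpa using hab⟩) ?_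
      · simpa using this
      · intro c hc
        rw [Finset.mem_map] at hc
        obtain ⟨j, hj, rfl⟩ := hc
        exact ht j hj
    · intro j _ hj
      have : (mv (Fc d.K d.K2) (d.X (l, j)) (d.X_sm (l, j))).ap q = 0 := by
        rw [ap_mv]
        exact Fc_supp _ _ _ fun h' => hj ⟨hq, h'⟩
      rw [leib, ap_add, ap_mul, ap_mul, this]
      simp
    · intro j _ hj
      rw [leib, ap_add, ap_mul, ap_mul, mul_comm, ← two_mul, norm_mul, norm_mul]
      have e1 : ‖(mv (Fc d.K d.K2) (d.X (l, j)) (d.X_sm (l, j))).ap q‖ ≤ C :=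
        ((h d.K d.K2).mv _ _).le trivial
      have e2 := (d.Dmv_Bd (l, j) (h d.K d.K2)).le hj
      rw [Complex.norm_ofNat, ← mul_assoc] at *
      rw [mul_assoc]
      gcongr
  have hC1' : 0 ≤ C1 := by positivity
  refine ⟨C1, hC1', fun d l q hq => ⟨?_, key d l q hq⟩⟩
  obtain ⟨Y, hY, hT⟩ := exists_traj d.hv1 d.TBv q.1 q.2
  have ht := d.time_le hq
  have hν := d.ν0
  have hL := d.L0
  have := hT.mvt d.hvr (d.S l) (C := C1 * d.L) (l / d.ν) q.1 (fun r hr => key d l _ (by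
    have h1 := hr.trans ht
    have e : d.ν * r - l = (r - l / d.ν) * d.ν := by field_simp
    simp only
    rw [e, abs_mul, abs_of_pos hν]
    calc _ ≤ 2 / (3 * d.ν) * d.ν := by gcongr
      _ = _ := by field_simp))
  rw [S_init, hY] at this
  refine this.trans ?_
  calc _ ≤ C1 * d.L * (2 / (3 * d.ν)) := by gcongr
    _ = C1 * (d.L / d.ν) * (2 / 3) := by field_simp
    _ ≤ _ := by
      have : 0 ≤ C1 * (d.L / d.ν) := by positivity
      linarith

section
variable {N : ℕ} (d : Dat N)
def m : ℕ := ⌈d.ν * d.T⌉₊ + 1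

def cells : Finset d.Cell := Finset.Icc (-(d.m:ℤ)) d.m ×ˢ Finset.univ

/-- total sum of squares -/
def G : Sm := ∑ c ∈ d.cells, d.ζ c * d.ζ c

lemma G_eq : d.G = ∑ l ∈ Finset.Icc (-(d.m:ℤ)) d.m,
    (tc Prof.base d.ν l * tc Prof.base d.ν l) * d.S l := by
  rw [G, cells, Finset.sum_product]
  refine Finset.sum_congr rfl fun l _ => ?_
  rw [S, Finset.mul_sum]
  refine Finset.sum_congr rfl fun j _ => ?_
  rw [ζ]
  ring

lemma sum_tc {q : Pt} (hq : |d.ν * q.1| < d.m) :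
    ∑ l ∈ Finset.Icc (-(d.m:ℤ)) d.m, Prof.base.h (d.ν * q.1 - l) ^ 2 = 1 := Prof.base_time hq

lemma D_sum_tc {q : Pt} (hq : |d.ν * q.1| < d.m) :
    (DD d.v (∑ l ∈ Finset.Icc (-(d.m:ℤ)) d.m, tc Prof.base d.ν l * tc Prof.base d.ν l)).ap q = 0 := by
  have hc : IsClosed {q : Pt | (d.m:ℝ) ≤ |d.ν * q.1|} := isClosed_le continuous_const (by fun_prop)
  have hs : Supp {q : Pt | (d.m:ℝ) ≤ |d.ν * q.1|}
      (∑ l ∈ Finset.Icc (-(d.m:ℤ)) d.m, tc Prof.base d.ν l * tc Prof.base d.ν l - algebraMap ℂ Sm 1) := by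
    intro q hq
    have h1 := d.sum_tc (q := q) (not_le.1 hq)
    rw [ap_sub, ap_sum, ap_algebraMap, sub_eq_zero, ← Complex.ofReal_one, ← h1, Complex.ofReal_sum]
    refine Finset.sum_congr rfl fun l _ => ?_
    rw [ap_mul, ap_tc, sq, Complex.ofReal_mul]
  have := (hs.DD hc d.v) q (not_le.2 hq)
  rwa [map_sub, Derivation.map_algebraMap, sub_zero] at this
end

lemma G_near (N : ℕ) : ∃ C : ℝ, 0 ≤ C ∧ ∀ (d : Dat N) (q : Pt), |d.ν * q.1| < d.m →
    ‖d.G.ap q - 1‖ ≤ C * (d.L / d.ν) ∧ ‖(DD d.v d.G).ap q‖ ≤ C * d.L := by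
  obtain ⟨C, hC, h⟩ := S_near N
  obtain ⟨C1, hC1, h1⟩ := Prof.base.bdd
  obtain ⟨C2, hC2, h2⟩ := Prof.base.der.bdd
  have hb : ∀ (d : Dat N) (q : Pt) (l : ℤ), ¬ |d.ν * q.1 - l| ≤ 2 / 3 → Prof.base.h (d.ν * q.1 - l) = 0 :=
    fun d q l hn => Prof.base.z _ (not_le.1 hn)
  set C3 : ℝ := 2 * (2 * C2 * C1 * C) with hC3
  have hC30 : 0 ≤ C3 := by positivity
  refine ⟨C3 + C, by positivity, fun d q hq => ?_⟩
  have hL := d.L0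
  have hν := d.ν0
  have hsum := d.sum_tc hq
  have gen : ∀ (f : ℤ → ℂ) (A : ℝ), (∀ l : ℤ, |d.ν * q.1 - l| ≤ 2 / 3 → ‖f l‖ ≤ A) →
      ‖∑ l ∈ Finset.Icc (-(d.m:ℤ)) d.m, ((Prof.base.h (d.ν * q.1 - l) ^ 2 : ℝ) : ℂ) * f l‖ ≤ A := by
    intro f A hf
    calc _ ≤ ∑ l ∈ Finset.Icc (-(d.m:ℤ)) d.m, Prof.base.h (d.ν * q.1 - l) ^ 2 * A := by
          refine norm_sum_le_of_le _ fun l _ => ?_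
          rw [norm_mul, Complex.norm_real, Real.norm_of_nonneg (sq_nonneg _)]
          by_cases hl : |d.ν * q.1 - l| ≤ 2 / 3
          · exact mul_le_mul_of_nonneg_left (hf l hl) (sq_nonneg _)
          · rw [hb d q l hl]; simp
      _ = A := by rw [← Finset.sum_mul, hsum, one_mul]
  have esum : (1:ℂ) = ∑ l ∈ Finset.Icc (-(d.m:ℤ)) d.m, ((Prof.base.h (d.ν * q.1 - l) ^ 2 : ℝ) : ℂ) := by
    rw [← Complex.ofReal_sum, hsum, Complex.ofReal_one]
  constructor
  · have e : d.G.ap q - 1 = ∑ l ∈ Finset.Icc (-(d.m:ℤ)) d.m,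
        ((Prof.base.h (d.ν * q.1 - l) ^ 2 : ℝ) : ℂ) * ((d.S l).ap q - 1) := by
      simp only [mul_sub, mul_one, Finset.sum_sub_distrib]
      rw [← esum, G_eq, ap_sum]
      congr 1
      refine Finset.sum_congr rfl fun l _ => ?_
      rw [ap_mul, ap_mul, ap_tc, sq, Complex.ofReal_mul]
    rw [e]
    refine (gen _ _ fun l hl => (h d l q hl).1).trans ?_
    have : 0 ≤ C3 * (d.L / d.ν) := by positivity
    linarith
  · have hD := d.D_sum_tc hq
    have e : (DD d.v d.G).ap q = (∑ l ∈ Finset.Icc (-(d.m:ℤ)) d.m,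
        DD d.v (tc Prof.base d.ν l * tc Prof.base d.ν l) * (d.S l - algebraMap ℂ Sm 1)).ap q +
        ∑ l ∈ Finset.Icc (-(d.m:ℤ)) d.m,
        ((Prof.base.h (d.ν * q.1 - l) ^ 2 : ℝ) : ℂ) * (DD d.v (d.S l)).ap q := by
      rw [map_sum, ap_sum] at hD
      rw [G_eq, map_sum, ap_sum, ap_sum]
      rw [← sub_eq_zero]
      rw [← hD, ← Finset.sum_add_distrib, ← Finset.sum_sub_distrib]
      refine Finset.sum_congr rfl fun l _ => ?_
      rw [leib (DD d.v) (tc Prof.base d.ν l * tc Prof.base d.ν l)]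
      simp only [ap_add, ap_mul, ap_sub, ap_algebraMap, ap_tc, Complex.ofReal_pow]
      ring_nf
    have hlast := gen (fun l => (DD d.v (d.S l)).ap q) _ fun l hl => (h d l q hl).2
    rw [e]
    have hfirst := norm_sum_overlap' (A := 2 * C2 * C1 * C * d.L) (M := 2)
      (Finset.Icc (-(d.m:ℤ)) d.m) (fun l => {q : Pt | |d.ν * q.1 - l| ≤ 2 / 3})
      (fun l => DD d.v (tc Prof.base d.ν l * tc Prof.base d.ν l) * (d.S l - algebraMap ℂ Sm 1)) q ?_
      (by positivity) ?_ ?_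
    · refine (norm_add_le _ _).trans ((add_le_add hfirst hlast).trans (le_of_eq ?_))
      rw [hC3]; push_cast; ring
    · intro t _ ht
      classical
      have e1 : t.card = (t.image fun l : ℤ => decide (Even l)).card := by
        refine (Finset.card_image_of_injOn fun l hl l' hl' he => ?_).symm
        simp only [decide_eq_decide] at he
        have h1 : |d.ν * q.1 - l| ≤ 2 / 3 := ht l hl
        have h2 : |d.ν * q.1 - l'| ≤ 2 / 3 := ht l' hl'
        rw [abs_le] at h1 h2
        have h3 : (l:ℝ) - l' < 2 := by linarith
        have h4 : (l':ℝ) - l < 2 := by linarith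
        have h5 : l - l' < 2 := by exact_mod_cast h3
        have h6 : l' - l < 2 := by exact_mod_cast h4
        have h7 : Even (l - l') := by rw [Int.even_sub]; exact he
        obtain ⟨m, hm⟩ := h7
        omega
      rw [e1]
      refine (Finset.card_le_univ _).trans ?_
      simp
    · intro l _ hl
      rw [ap_mul, leib, ap_add, ap_mul, ap_mul, ap_tc, hb d q l hl]
      simp
    · intro l _ hl
      rw [ap_mul, leib, mul_comm (tc _ _ _) (DD _ _), ← two_mul, DD_tc]
      have e1 := (h d l q hl).1
      simp only [ap_sub, ap_algebraMap, ap_mul, ap_smul, ap_tc, norm_mul, Complex.norm_real]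
      have e2 : ‖(2:Sm).ap q‖ = 2 := by
        have : (2:Sm).ap q = 2 := rfl
        rw [this, Complex.norm_ofNat]
      rw [e2, Real.norm_of_nonneg hν.le, Real.norm_eq_abs, Real.norm_eq_abs]
      calc _ ≤ 2 * (d.ν * C2 * C1) * (C * (d.L / d.ν)) := by
            have e3 := h1 (d.ν * q.1 - l)
            have e4 := h2 (d.ν * q.1 - l)
            gcongr
        _ = _ := by field_simp

end Dat
end Sm

end

/-! ### Part 10 -/

section

namespace Sm
namespace Dat

section
variable {N : ℕ} (d : Dat N)

/-- stress at the centre of a cell -/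
def Rc (c : d.Cell) (i j : Fin 3) : ℂ := (d.R i j).ap (c.1 / d.ν, d.X c (c.1 / d.ν))

lemma Rc_near {c : d.Cell} {q : Pt} (hq : q ∈ d.U c) (i j : Fin 3) :
    ‖(d.R i j).ap q - d.Rc c i j‖ ≤ 2 * (d.δ * (d.L / d.ν + d.lam / d.K)) := by
  have hδ := d.δ0
  have hL := d.L0
  have hν := d.ν0
  have hl := d.lam0
  have h1 := d.near hq (d.R i j) (A := d.δ * d.lam) (by positivity) (d.hdR i j)
  have h2 := (d.X_traj c).mvt d.hvr (d.R i j) (C := d.δ * d.L) (c.1 / d.ν) q.1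
    (fun r _ => d.hDR i j _)
  have ht := d.time_le hq.1
  have h3 : d.δ * d.L * |q.1 - c.1 / d.ν| ≤ 2 * (d.δ * (d.L / d.ν)) := by
    calc _ ≤ d.δ * d.L * (2 / (3 * d.ν)) := by gcongr
      _ = d.δ * (d.L / d.ν) * (2 / 3) := by field_simp
      _ ≤ _ := by
        have : 0 ≤ d.δ * (d.L / d.ν) := by positivity
        linarith
  have e : (d.R i j).ap q - d.Rc c i j = ((d.R i j).ap q - (d.R i j).ap (q.1, d.X c q.1)) +
    ((d.R i j).ap (q.1, d.X c q.1) - d.Rc c i j) := by ring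
  rw [e]
  refine (norm_add_le _ _).trans ((add_le_add h1 (h2.trans h3)).trans (le_of_eq ?_))
  ring

lemma Rc_le (c : d.Cell) (i j : Fin 3) : ‖d.Rc c i j‖ ≤ d.δ := d.hR _ _ _

/-- low frequency error -/
def E (i j : Fin 3) : Sm := d.R i j - ∑ c ∈ d.cells, d.Rc c i j • (d.ζ c * d.ζ c)

lemma E_eq (i j : Fin 3) (q : Pt) : (d.E i j).ap q = (d.R i j).ap q * (1 - d.G.ap q) +
    (∑ c ∈ d.cells, (d.R i j - algebraMap ℂ Sm (d.Rc c i j)) * (d.ζ c * d.ζ c)).ap q := by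
  rw [E, G, ap_sub, ap_sum, ap_sum, ap_sum, mul_sub, Finset.mul_sum, mul_one]
  rw [sub_add_eq_add_sub, add_sub_assoc, ← Finset.sum_sub_distrib, sub_eq_add_neg, ← Finset.sum_neg_distrib]
  congr 1
  refine Finset.sum_congr rfl fun c _ => ?_
  simp only [ap_mul, ap_sub, ap_smul, ap_algebraMap]
  ring

lemma DE_eq (i j : Fin 3) (q : Pt) : (DD d.v (d.E i j)).ap q = (DD d.v (d.R i j)).ap q -
    (d.R i j).ap q * (DD d.v d.G).ap q +
    (∑ c ∈ d.cells, (d.R i j - algebraMap ℂ Sm (d.Rc c i j)) * DD d.v (d.ζ c * d.ζ c)).ap q := by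
  rw [E, G, map_sub, map_sum, map_sum, ap_sub, ap_sum, ap_sum, ap_sum, Finset.mul_sum]
  rw [sub_add, ← Finset.sum_sub_distrib]
  congr 1
  refine Finset.sum_congr rfl fun c _ => ?_
  rw [(DD d.v).map_smul]
  simp only [ap_mul, ap_sub, ap_smul, ap_algebraMap]
  ring

lemma m_gt {q : Pt} (h : |q.1| ≤ d.T) : |d.ν * q.1| < d.m := by
  have hν := d.ν0
  rw [abs_mul, abs_of_pos hν, m]
  have := Nat.le_ceil (d.ν * d.T)
  push_cast
  nlinarith

lemma overlap' (q : Pt) (t : Finset d.Cell) (_ : t ⊆ d.cells) (h : ∀ c ∈ t, q ∈ d.U c) : t.card ≤ 16 :=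
  d.overlap q t h

lemma U_time {c : d.Cell} (hc : c ∈ d.cells) {q : Pt} (hq : q ∈ d.U c) : |q.1| ≤ d.T + 4 / d.ν := by
  have hν := d.ν0
  have h1 := abs_le.1 hq.1
  rw [cells, Finset.mem_product, Finset.mem_Icc] at hc
  have h2 : -(d.m:ℝ) ≤ c.1 := by exact_mod_cast hc.1.1
  have h3 : (c.1:ℝ) ≤ d.m := by exact_mod_cast hc.1.2
  have h4 := Nat.ceil_lt_add_one (a := d.ν * d.T) (mul_nonneg hν.le d.T0)
  have h5 : (d.m:ℝ) = ⌈d.ν * d.T⌉₊ + 1 := by rw [m]; push_cast; rfl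
  have h6 : |d.ν * q.1| ≤ d.ν * d.T + 4 := by rw [abs_le]; constructor <;> linarith [h1.1, h1.2]
  rw [abs_mul, abs_of_pos hν] at h6
  have h7 : d.T + 4 / d.ν = (d.ν * d.T + 4) / d.ν := by field_simp
  rw [h7, le_div_iff₀ hν]
  linarith

lemma ζ_time {c : d.Cell} (hc : c ∈ d.cells) {q : Pt} (hq : d.T + 4 / d.ν < |q.1|) : q ∉ d.U c :=
  fun h => absurd (d.U_time hc h) (not_le.2 hq)

lemma E_time (i j : Fin 3) {q : Pt} (hq : d.T + 4 / d.ν < |q.1|) : (d.E i j).ap q = 0 := by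
  have h4 : 0 < 4 / d.ν := div_pos (by norm_num) d.ν0
  rw [E, ap_sub, d.hsupp i j q (by linarith), ap_sum, Finset.sum_eq_zero, sub_zero]
  intro c hc
  rw [ap_smul, ap_mul, d.ζ_supp c q (d.ζ_time hc hq)]
  simp

end

lemma E_bd (N : ℕ) : ∃ C : ℝ, 0 ≤ C ∧ ∀ (d : Dat N) (i j : Fin 3) (q : Pt),
    ‖(d.E i j).ap q‖ ≤ C * (d.δ * (d.L / d.ν + d.lam / d.K)) ∧
    (∀ k, ‖(dx k (d.E i j)).ap q‖ ≤ C * (d.δ * d.K)) ∧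
    ‖(DD d.v (d.E i j)).ap q‖ ≤ C * (d.δ * (d.L / d.ν + d.lam / d.K)) * d.ν := by
  obtain ⟨C1, hC1, h1⟩ := G_near N
  obtain ⟨C2, hC2, h2⟩ := ζ_GG N
  refine ⟨1 + C1 + 64 * C2 ^ 2, by positivity, fun d i j q => ?_⟩
  have hδ := d.δ0
  have hL := d.L0
  have hν := d.ν0
  have hl := d.lam0
  have hK := d.K0
  set η : ℝ := d.δ * (d.L / d.ν + d.lam / d.K) with hη
  have hη0 : 0 ≤ η := by positivity
  have hLη : d.δ * (d.L / d.ν) ≤ η := by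
    rw [hη]; gcongr; linarith [div_nonneg hl hK.le]
  have hLη' : d.δ * d.L ≤ η * d.ν := by
    have : d.δ * d.L = d.δ * (d.L / d.ν) * d.ν := by field_simp
    rw [this]; gcongr
  refine ⟨?_, fun k => ?_, ?_⟩
  · rw [E_eq]
    have a1 : ‖(d.R i j).ap q * (1 - d.G.ap q)‖ ≤ C1 * η := by
      by_cases hq : |q.1| ≤ d.T
      · rw [norm_mul, norm_sub_rev]
        calc _ ≤ d.δ * (C1 * (d.L / d.ν)) := by
              have := (h1 d q (d.m_gt hq)).1
              have := d.hR i j q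
              gcongr
          _ = C1 * (d.δ * (d.L / d.ν)) := by ring
          _ ≤ _ := by gcongr
      · rw [d.hsupp i j q (not_le.1 hq), zero_mul, norm_zero]; positivity
    have a2 := norm_sum_overlap (A := 2 * η * (C2 * C2)) (M := 16) d.cells d.U
      (fun c => (d.R i j - algebraMap ℂ Sm (d.Rc c i j)) * (d.ζ c * d.ζ c)) q (d.overlap' q)
      (by positivity) (fun c _ => ((d.ζ_supp c).mul_left _).mul_left _) (fun c _ hc => by
        have e1 := d.Rc_near hc i j
        have e2 := (h2 d c).1.1.le hc
        simp only [ap_mul, ap_sub, ap_algebraMap, norm_mul]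
        gcongr)
    refine (norm_add_le _ _).trans ((add_le_add a1 a2).trans ?_)
    have : 0 ≤ C2 ^ 2 * η := by positivity
    push_cast
    nlinarith
  · rw [E, map_sub, map_sum, ap_sub]
    have a2 := norm_sum_overlap (A := d.δ * (2 * (C2 * (C2 * d.K)))) (M := 16) d.cells d.U
      (fun c => dx k (d.Rc c i j • (d.ζ c * d.ζ c))) q (d.overlap' q)
      (by positivity) (fun c _ => Supp.dx (d.U_closed c) (((d.ζ_supp c).mul_left _).smul _) _) (fun c _ hc => by
        have e1 := d.Rc_le c i j
        have e2 := (h2 d c).1.1.le hc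
        have e3 := ((h2 d c).2.2.1 k).1.le hc
        rw [(dx k).map_smul, leib, mul_comm (dx k _), ← two_mul, ap_smul, ap_mul, ap_mul]
        have : (2:Sm).ap q = 2 := rfl
        rw [this]
        simp only [norm_mul, Complex.norm_ofNat]
        gcongr)
    refine (norm_sub_le _ _).trans ((add_le_add (d.hdR i j k q) a2).trans ?_)
    have b1 : d.δ * d.lam ≤ d.δ * d.K := by have := d.lamK; gcongr
    have : 0 ≤ C2 ^ 2 * (d.δ * d.K) := by positivity
    have b2 : 0 ≤ C1 * (d.δ * d.K) := by positivity
    push_cast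
    nlinarith
  · rw [DE_eq]
    have a1 : ‖(d.R i j).ap q * (DD d.v d.G).ap q‖ ≤ C1 * (η * d.ν) := by
      by_cases hq : |q.1| ≤ d.T
      · rw [norm_mul]
        calc _ ≤ d.δ * (C1 * d.L) := by
              have := (h1 d q (d.m_gt hq)).2
              have := d.hR i j q
              gcongr
          _ = C1 * (d.δ * d.L) := by ring
          _ ≤ _ := by gcongr
      · rw [d.hsupp i j q (not_le.1 hq), zero_mul, norm_zero]; positivity
    have a2 := norm_sum_overlap (A := 2 * η * (2 * (C2 * (C2 * d.ν)))) (M := 16) d.cells d.U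
      (fun c => (d.R i j - algebraMap ℂ Sm (d.Rc c i j)) * DD d.v (d.ζ c * d.ζ c)) q (d.overlap' q)
      (by positivity) (fun c _ => (Supp.DD (d.U_closed c) ((d.ζ_supp c).mul_left _) _).mul_left _) (fun c _ hc => by
        have e1 := d.Rc_near hc i j
        have e2 := (h2 d c).1.1.le hc
        have e3 := (h2 d c).2.1.1.le hc
        rw [leib, mul_comm (DD d.v _), ← two_mul, ap_mul, ap_mul, ap_mul]
        have : (2:Sm).ap q = 2 := rfl
        rw [this]
        simp only [norm_mul, Complex.norm_ofNat, ap_sub, ap_algebraMap]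
        gcongr)
    refine (norm_add_le _ _).trans ((add_le_add ((norm_sub_le _ _).trans
      (add_le_add ((d.hDR i j q).trans hLη') a1)) a2).trans ?_)
    have : 0 ≤ C2 ^ 2 * (η * d.ν) := by positivity
    push_cast
    nlinarith

end Dat
end Sm

end

/-! ### Part 11 -/

section

namespace Sm

/-- abstract oscillating wave -/
structure Wv (v : Fin 3 → Sm) (κ : ℝ) (k : Fin 3 → ℤ) (θ e : Sm) : Prop where
  hdx : ∀ j, dx j e = (Complex.I * κ * (k j : ℂ)) • e
  hD : DD v e = (Complex.I * κ) • (θ * e)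
  hn : ∀ q, ‖e.ap q‖ ≤ 1

lemma Wv.mul {v : Fin 3 → Sm} {κ : ℝ} {k k' : Fin 3 → ℤ} {θ θ' e e' : Sm}
    (h : Wv v κ k θ e) (h' : Wv v κ k' θ' e') : Wv v κ (k + k') (θ + θ') (e * e') where
  hdx j := by
    rw [leib, h.hdx, h'.hdx]
    ext q
    simp only [ap_add, ap_mul, ap_smul, Pi.add_apply, Int.cast_add]
    ring
  hD := by
    rw [leib, h.hD, h'.hD]
    ext q
    simp only [ap_add, ap_mul, ap_smul]
    ring
  hn q := by
    rw [ap_mul, norm_mul]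
    exact mul_le_one₀ (h.hn q) (norm_nonneg _) (h'.hn q)

lemma Wv.Bd {v : Fin 3 → Sm} {κ : ℝ} {k : Fin 3 → ℤ} {θ e : Sm} (h : Wv v κ k θ e) {c Λ : ℝ}
    (hc : 1 ≤ c) (hΛ : 0 ≤ Λ) (hk : ∀ j, |κ * k j| ≤ c * Λ) (U : Set Pt) (n : ℕ) :
    Bd U n (c ^ n) Λ e := by
  induction n with
  | zero => intro q _; rw [pow_zero]; exact h.hn q
  | succ n ih =>
    refine ⟨fun q _ => (h.hn q).trans (one_le_pow₀ hc), fun j => ?_⟩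
    rw [h.hdx]
    refine (ih.smul _).mono ?_ hΛ
    have e1 : ‖Complex.I * κ * (k j : ℂ)‖ = |κ * k j| := by
      rw [mul_assoc, norm_mul, Complex.norm_I, one_mul, ← Complex.ofReal_intCast, ← Complex.ofReal_mul,
        Complex.norm_real, Real.norm_eq_abs]
    rw [e1, pow_succ]
    calc _ ≤ c * Λ * c ^ n := by have := hk j; gcongr
      _ = _ := by ring

lemma Wv.GG {v : Fin 3 → Sm} {κ : ℝ} {k : Fin 3 → ℤ} {θ e : Sm} (h : Wv v κ k θ e) {c Λ B ν : ℝ}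
    (hc : 1 ≤ c) (hΛ : 0 ≤ Λ) (hκ : 0 < κ) (hB : 0 ≤ B) (hν : 0 ≤ ν)
    (hk : ∀ j, |κ * k j| ≤ c * Λ) {U : Set Pt} {n : ℕ}
    (hθ : Sm.Bd U n (B * ν / κ) Λ θ) :
    GG v U n (c ^ n * (1 + 2 ^ n * B)) Λ ν e := by
  have hb := h.Bd hc hΛ hk U n
  have hcn : 0 ≤ c ^ n := by positivity
  have h2 : 0 ≤ c ^ n * (2 ^ n * B) := by positivity
  refine ⟨hb.mono (by linarith) hΛ, ?_⟩
  rw [h.hD]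
  refine ((hθ.mul hb).smul _).mono ?_ hΛ
  rw [norm_mul, Complex.norm_I, one_mul, Complex.norm_real, Real.norm_of_nonneg hκ.le]
  have : κ * (2 ^ n * (B * ν / κ * c ^ n)) = c ^ n * (2 ^ n * B) * ν := by field_simp
  rw [this]
  gcongr
  linarith

/-- squared length -/
def n2 (k : Fin 3 → ℤ) : ℤ := ∑ i, k i ^ 2

lemma n2_pos {k : Fin 3 → ℤ} (hk : k ≠ 0) : 0 < n2 k := by
  obtain ⟨i, hi⟩ := Function.ne_iff.1 hk
  refine Finset.sum_pos' (fun _ _ => sq_nonneg _) ⟨i, Finset.mem_univ i, ?_⟩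
  have : k i ≠ 0 := hi
  positivity

lemma abs_mul_le_n2 (k : Fin 3 → ℤ) (i j : Fin 3) : |k i * k j| ≤ n2 k := by
  have h : ∀ i, k i ^ 2 ≤ n2 k := fun i =>
    Finset.single_le_sum (f := fun i => k i ^ 2) (fun _ _ => sq_nonneg _) (Finset.mem_univ i)
  rw [abs_mul]
  have := h i
  have := h j
  nlinarith [sq_abs (k i), sq_abs (k j), sq_nonneg (|k i| - |k j|)]

lemma abs_le_n2 (k : Fin 3 → ℤ) (i : Fin 3) : |k i| ≤ n2 k := by
  have h := abs_mul_le_n2 k i i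
  rw [abs_mul] at h
  by_cases h0 : k i = 0
  · rw [h0] at h ⊢; simpa using h
  · have : 1 ≤ |k i| := Int.one_le_abs h0
    nlinarith

/-- symbol of the parametrix -/
def sk (k : Fin 3 → ℤ) (V : Fin 3 → Sm) (j l : Fin 3) : Sm :=
  ((k j : ℂ) * (n2 k : ℂ)⁻¹) • V l + ((k l : ℂ) * (n2 k : ℂ)⁻¹) • V j -
    ∑ i, ((k i * k j : ℤ) * (n2 k : ℂ)⁻¹ * ((k l : ℂ) * (n2 k : ℂ)⁻¹)) • V i

lemma sk_symm (k V j l) : sk k V j l = sk k V l j := by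
  rw [sk, sk, add_comm]
  congr 1
  refine Finset.sum_congr rfl fun i _ => ?_
  congr 1
  push_cast
  ring

lemma sk_contract {k : Fin 3 → ℤ} (hk : k ≠ 0) (V : Fin 3 → Sm) (l : Fin 3) :
    ∑ j, (k j : ℂ) • sk k V j l = V l := by
  have h0 : (n2 k : ℂ) ≠ 0 := by exact_mod_cast (n2_pos hk).ne'
  have hn : ((k 0 : ℂ) ^ 2 + (k 1 : ℂ) ^ 2 + (k 2 : ℂ) ^ 2) * (n2 k : ℂ)⁻¹ = 1 := by
    have : (n2 k : ℂ) = (k 0 : ℂ) ^ 2 + (k 1 : ℂ) ^ 2 + (k 2 : ℂ) ^ 2 := by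
      rw [n2, Fin.sum_univ_three]; push_cast; rfl
    rw [← this]
    exact mul_inv_cancel₀ h0
  ext q
  simp only [sk, ap_smul, ap_sub, ap_add, Fin.sum_univ_three, Int.cast_mul]
  generalize (n2 k : ℂ)⁻¹ = a at *
  linear_combination ((V l).ap q - (k l : ℂ) * a * ((k 0 : ℂ) * (V 0).ap q + (k 1 : ℂ) * (V 1).ap q +
    (k 2 : ℂ) * (V 2).ap q)) * hn

lemma coef1 {k : Fin 3 → ℤ} (hk : k ≠ 0) (j : Fin 3) : ‖(k j : ℂ) * (n2 k : ℂ)⁻¹‖ ≤ 1 := by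
  have h0 : (0:ℝ) < n2 k := by exact_mod_cast n2_pos hk
  rw [norm_mul, norm_inv, Complex.norm_intCast, Complex.norm_intCast, abs_of_pos h0,
    ← div_eq_mul_inv, div_le_one h0]
  exact_mod_cast abs_le_n2 k j

lemma coef2 {k : Fin 3 → ℤ} (hk : k ≠ 0) (i j : Fin 3) : ‖((k i * k j : ℤ) : ℂ) * (n2 k : ℂ)⁻¹‖ ≤ 1 := by
  have h0 : (0:ℝ) < n2 k := by exact_mod_cast n2_pos hk
  rw [norm_mul, norm_inv, Complex.norm_intCast, Complex.norm_intCast, abs_of_pos h0,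
    ← div_eq_mul_inv, div_le_one h0]
  exact_mod_cast abs_mul_le_n2 k i j

lemma sk_GG {v : Fin 3 → Sm} {U : Set Pt} {n : ℕ} {A μ ν : ℝ} (hA : 0 ≤ A) (hμ : 0 ≤ μ) (hν : 0 ≤ ν)
    {k : Fin 3 → ℤ} (hk : k ≠ 0) {V : Fin 3 → Sm} (hV : ∀ l, GG v U n A μ ν (V l)) (j l : Fin 3) :
    GG v U n (5 * A) μ ν (sk k V j l) := by
  have key : ∀ (c : ℂ) (i : Fin 3), ‖c‖ ≤ 1 → GG v U n A μ ν (c • V i) := fun c i hc =>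
    ((hV i).smul c).mono (by nlinarith) hμ hν
  refine (((key _ l (coef1 hk j)).add (key _ j (coef1 hk l))).sub
    (GG.sum3 hμ fun i => key _ i ?_)).mono (by linarith) hμ hν
  rw [norm_mul]
  exact mul_le_one₀ (coef2 hk i j) (norm_nonneg _) (coef1 hk l)

lemma sk_supp {U : Set Pt} {k : Fin 3 → ℤ} {V : Fin 3 → Sm} (hV : ∀ l, Supp U (V l)) (j l : Fin 3) :
    Supp U (sk k V j l) :=
  (((hV l).smul _).add ((hV j).smul _)).sub (Supp.sum _ fun i _ => (hV i).smul _)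

lemma sk_step {v : Fin 3 → Sm} {κ : ℝ} (hκ : 0 < κ) {k : Fin 3 → ℤ} (hk : k ≠ 0) {θ e : Sm}
    (h : Wv v κ k θ e) (V : Fin 3 → Sm) (l : Fin 3) :
    V l * e = ∑ j, dx j (((Complex.I * κ)⁻¹ • sk k V j l) * e) +
      (-(Complex.I * κ)⁻¹ • ∑ j, dx j (sk k V j l)) * e := by
  have hc : (κ:ℂ) ≠ 0 := by exact_mod_cast hκ.ne'
  have hI : (Complex.I:ℂ) ≠ 0 := Complex.I_ne_zero
  have hcon : (∑ j, (k j : ℂ) • sk k V j l) * e = V l * e := by rw [sk_contract hk]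
  rw [← hcon]
  ext q
  simp only [leib, h.hdx, ap_add, ap_mul, ap_smul, ap_sum, (dx _).map_smul, Finset.sum_mul,
    Finset.mul_sum, ← Finset.sum_add_distrib]
  refine Finset.sum_congr rfl fun j _ => ?_
  field_simp
  ring

lemma parametrix (q n : ℕ) : ∃ C : ℝ, 0 ≤ C ∧ ∀ (v : Fin 3 → Sm) (U : Set Pt) (L κ μ ν : ℝ),
    0 < κ → 0 ≤ μ → μ ≤ κ → 0 ≤ ν → L ≤ ν → IsClosed U →
    (∀ i j, Bd U (n + q) L μ (dx j (v i))) → ∀ (k : Fin 3 → ℤ) (θ e : Sm), k ≠ 0 → Wv v κ k θ e →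
    ∀ (V : Fin 3 → Sm) (A : ℝ), 0 ≤ A → (∀ l, GG v U (n + q) A μ ν (V l)) → (∀ l, Supp U (V l)) →
    ∃ (Q : Fin 3 → Fin 3 → Sm) (V' : Fin 3 → Sm), (∀ j l, Q j l = Q l j) ∧
      (∀ j l, GG v U q (C * A / κ) μ ν (Q j l)) ∧ (∀ j l, Supp U (Q j l)) ∧
      (∀ l, GG v U q (C * A * (μ / κ) ^ n) μ ν (V' l)) ∧ (∀ l, Supp U (V' l)) ∧
      ∀ l, V l * e = ∑ j, dx j (Q j l * e) + V' l * e := by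
  induction n with
  | zero =>
    refine ⟨1, zero_le_one, fun v U L κ μ ν hκ hμ hμκ hν hL hU hv k θ e hk hw V A hA hV hs =>
      ⟨fun _ _ => 0, V, fun _ _ => rfl, fun _ _ => GG.zero (by positivity) hμ hν,
        fun _ _ _ _ => rfl, fun l => ?_, hs, fun l => by simp⟩⟩
    have := hV l
    simpa using this
  | succ n ih =>
    obtain ⟨C, hC, h⟩ := ih
    set D : ℝ := 3 * ((1 + 3 * 2 ^ (n + q)) * 5) with hD
    have hD0 : 0 ≤ D := by positivity
    refine ⟨5 + C * D, by positivity, fun v U L κ μ ν hκ hμ hμκ hν hL hU hv k θ e hk hw V A hA hV hs => ?_⟩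
    have hnq : n + 1 + q = n + q + 1 := by ring
    rw [hnq] at hV hv
    have hnorm : ‖(Complex.I * (κ:ℂ))⁻¹‖ = κ⁻¹ := by
      rw [norm_inv, norm_mul, Complex.norm_I, one_mul, Complex.norm_real, Real.norm_of_nonneg hκ.le]
    have hsk := fun j l => sk_GG hA hμ hν hk hV j l
    have hV1 : ∀ l, GG v U (n + q) (D * A * (μ / κ)) μ ν (-(Complex.I * (κ:ℂ))⁻¹ • ∑ j, dx j (sk k V j l)) := by
      intro l
      refine ((GG.sum3 hμ fun j => GG.dx hμ (by positivity) (fun i j => (hv i j).pred) hL (hsk j l) j).smul _).mono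
        (le_of_eq ?_) hμ hν
      rw [norm_neg, hnorm, hD]
      field_simp
    have hs1 : ∀ l, Supp U (-(Complex.I * (κ:ℂ))⁻¹ • ∑ j, dx j (sk k V j l)) := fun l =>
      Supp.smul _ (Supp.sum _ fun j _ => (sk_supp hs j l).dx hU j)
    obtain ⟨Q, V', h1, h2, h3, h4, h5, h6⟩ := h v U L κ μ ν hκ hμ hμκ hν hL hU
      (fun i j => (hv i j).pred) k θ e hk hw _ (D * A * (μ / κ)) (by positivity) hV1 hs1
    have hr : μ / κ ≤ 1 := (div_le_one hκ).2 hμκ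
    have hr0 : 0 ≤ μ / κ := by positivity
    refine ⟨fun j l => (Complex.I * (κ:ℂ))⁻¹ • sk k V j l + Q j l, V', fun j l => ?_, fun j l => ?_,
      fun j l => ?_, fun l => ?_, h5, fun l => ?_⟩
    · show _ • sk k V j l + Q j l = _ • sk k V l j + Q l j
      rw [sk_symm, h1]
    · refine ((((hsk j l).of_le (by omega)).smul _).add (h2 j l)).mono ?_ hμ hν
      rw [hnorm]
      calc κ⁻¹ * (5 * A) + C * (D * A * (μ / κ)) / κ ≤ κ⁻¹ * (5 * A) + C * (D * A * 1) / κ := by gcongr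
        _ = _ := by field_simp
    · exact ((sk_supp hs j l).smul _).add (h3 j l)
    · refine (h4 l).mono ?_ hμ hν
      have : 0 ≤ 5 * A * (μ / κ) ^ (n + 1) := by positivity
      calc _ = C * D * A * (μ / κ) ^ (n + 1) := by ring
        _ ≤ _ := by nlinarith
    · rw [sk_step hκ hk hw V l, h6 l, ← add_assoc, ← Finset.sum_add_distrib]
      congr 1
      refine Finset.sum_congr rfl fun j _ => ?_
      rw [add_mul, map_add]

/-- plane wave -/
def Ek (Λ : ℕ) (k : Fin 3 → ℤ) : Sm :=
  mk' (fun q => Complex.exp (((2 * Real.pi * Λ : ℝ) * ∑ j, (k j : ℝ) * q.2 j : ℝ) * Complex.I))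
    (by
      refine Complex.contDiff_exp.comp (ContDiff.mul ?_ contDiff_const)
      refine Complex.ofRealCLM.contDiff.comp ?_
      refine contDiff_const.mul (ContDiff.sum fun j _ => contDiff_const.mul ?_)
      exact (contDiff_apply ℝ ℝ j).comp contDiff_snd)
    (fun t x r => by
      simp only
      rw [Complex.exp_eq_exp_iff_exists_int]
      refine ⟨Λ * ∑ j, k j * r j, ?_⟩
      push_cast
      simp only [mul_add, Finset.sum_add_distrib]
      ring)

lemma ap_Ek (Λ k) (q : Pt) : (Ek Λ k).ap q =
    Complex.exp (((2 * Real.pi * Λ : ℝ) * ∑ j, (k j : ℝ) * q.2 j : ℝ) * Complex.I) := rfl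

lemma dx_Ek (Λ k j) : dx j (Ek Λ k) = (Complex.I * ((2 * Real.pi * Λ : ℝ) : ℂ) * (k j : ℂ)) • Ek Λ k := by
  ext ⟨t, x⟩
  have h1 := hasDerivAt_dir (Ek Λ k) (t, x) j 0
  have h2 : HasDerivAt (fun s : ℝ => (Ek Λ k).ap ((t, x) + s • ((0, Pi.single j 1) : Pt)))
      ((Complex.I * ((2 * Real.pi * Λ : ℝ) : ℂ) * (k j : ℂ)) * (Ek Λ k).ap (t, x)) 0 := by
    have h3 : (fun s : ℝ => (Ek Λ k).ap ((t, x) + s • ((0, Pi.single j 1) : Pt))) =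
      fun s : ℝ => Complex.exp (((2 * Real.pi * Λ : ℝ) * (∑ i, (k i : ℝ) * x i + s * k j) : ℝ) * Complex.I) := by
      funext s
      rw [ap_Ek]
      congr 4
      simp only [Prod.snd_add, Prod.smul_snd, Pi.add_apply, Pi.smul_apply, Pi.single_apply, smul_eq_mul,
        mul_add, Finset.sum_add_distrib]
      simp
      ring
    rw [h3]
    have h4 : HasDerivAt (fun s : ℝ => ((2 * Real.pi * Λ : ℝ) * (∑ i, (k i : ℝ) * x i + s * k j) : ℝ))
        ((2 * Real.pi * Λ : ℝ) * (1 * k j)) 0 :=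
      (((hasDerivAt_id (0:ℝ)).mul_const (k j:ℝ)).const_add _).const_mul _
    have h5 := (h4.ofReal_comp.mul_const Complex.I).cexp
    refine h5.congr_deriv ?_
    rw [ap_Ek]
    simp only [zero_mul, add_zero]
    push_cast
    ring
  have := h1.unique h2
  simp only [zero_smul, add_zero] at this
  rw [this, ap_smul]

lemma norm_Ek (Λ k) (q : Pt) : ‖(Ek Λ k).ap q‖ = 1 := by
  rw [ap_Ek, Complex.norm_exp_ofReal_mul_I]

lemma cj_Ek (Λ k) : cj (Ek Λ k) = Ek Λ (-k) := by
  ext q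
  rw [ap_cj, ap_Ek, ap_Ek, ← Complex.exp_conj, map_mul, Complex.conj_ofReal, Complex.conj_I]
  congr 1
  simp [Finset.sum_neg_distrib]

lemma Ek_mul (Λ k k') : Ek Λ k * Ek Λ k' = Ek Λ (k + k') := by
  ext q
  rw [ap_mul, ap_Ek, ap_Ek, ap_Ek, ← Complex.exp_add]
  congr 1
  simp only [Pi.add_apply, Int.cast_add, add_mul, Finset.sum_add_distrib, mul_add]
  push_cast
  ring

lemma Ek_zero (Λ) : Ek Λ 0 = 1 := by
  ext q
  rw [ap_Ek]
  simp

namespace Dat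
variable {N : ℕ} (d : Dat N)

def κ : ℝ := 2 * Real.pi * d.Λ
lemma κ0 : 0 < d.κ := by have := d.Λ0; have := Real.pi_pos; unfold κ; positivity
lemma κΛ : (d.Λ:ℝ) ≤ d.κ := by have := d.Λ0; have := Real.pi_gt_three; unfold κ; nlinarith
lemma κ7 : d.κ ≤ 7 * d.Λ := by
  have := d.Λ0; have := Real.pi_lt_d2; unfold κ; nlinarith

def ew (c : d.Cell) (k : Fin 3 → ℤ) : Sm := mv (Ek d.Λ k) (d.X c) (d.X_sm c)
def θ (c : d.Cell) (k : Fin 3 → ℤ) : Sm := ∑ i, (k i : ℂ) • d.u c i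

lemma mv_smul (a : ℂ) (F : Sm) (X hX) : mv (a • F) X hX = a • mv F X hX := by
  ext q; rfl

lemma ew_Wv (c : d.Cell) (k : Fin 3 → ℤ) : Wv d.v d.κ k (d.θ c k) (d.ew c k) where
  hdx j := by
    rw [ew, dx_mv, dx_Ek, mv_smul]
    rfl
  hD := by
    rw [ew, DD_mv d.hvr (d.X_traj c), θ, Finset.sum_mul, Finset.smul_sum]
    refine Finset.sum_congr rfl fun i _ => ?_
    rw [dx_Ek, mv_smul]
    ext q
    simp only [ap_mul, ap_smul, u, κ]
    ring
  hn q := by rw [ew, ap_mv, norm_Ek]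

lemma cj_ew (c : d.Cell) (k : Fin 3 → ℤ) : cj (d.ew c k) = d.ew c (-k) := by
  have := cj_Ek d.Λ k
  ext q
  rw [ew, ew, ap_mv, ← this, ap_cj, ap_mv, ap_cj]

lemma ew_mul_neg (c : d.Cell) (k : Fin 3 → ℤ) : d.ew c k * d.ew c (-k) = 1 := by
  have := Ek_mul d.Λ k (-k)
  rw [add_neg_cancel, Ek_zero] at this
  ext q
  rw [ew, ew, ap_mul, ap_mv, ap_mv, ← ap_mul, this]
  rfl

end Dat
end Sm

end

/-! ### Part 12 -/

section

/-- sign -/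
def sg (b : Bool) : ℤ := if b then 1 else -1

lemma sg_sq (b : Bool) : sg b * sg b = 1 := by cases b <;> rfl
lemma sg_not (b : Bool) : sg (!b) = -sg b := by cases b <;> rfl
lemma sg_ne (b : Bool) : sg b ≠ 0 := by cases b <;> decide
lemma sg_sqC (b : Bool) : (sg b : ℂ) * (sg b : ℂ) = 1 := by exact_mod_cast sg_sq b

/-- Pythagorean pairs -/
def pa : Fin 16 → ℤ := ![264, 272, 425, 468, 520, 561, 576, 663, 700, 744, 817, 855, 884, 943, 952, 975]
def pb : Fin 16 → ℤ := ![1073, 1071, 1020, 1001, 975, 952, 943, 884, 855, 817, 744, 700, 663, 576, 561, 520]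

lemma pab : ∀ c, pa c ^ 2 + pb c ^ 2 = 1105 ^ 2 ∧ 0 < pa c ∧ 0 < pb c ∧ 1105 ^ 2 ≤ 5 * (pa c * pb c) := by decide
lemma pa_inj : ∀ c c', pa c = pa c' → c = c' := by decide

abbrev FI : Type := Fin 3 × Bool × Bool

def kk (c : Fin 16) (f : FI) (l : Fin 3) : ℤ :=
  (![sg f.2.2 * pa c, sg f.2.2 * (sg f.2.1 * pb c), 0] : Fin 3 → ℤ) (l - f.1)

def BB (c : Fin 16) (f : FI) (l : Fin 3) : ℂ :=
  (![Complex.I * (sg f.2.2 * (sg f.2.1 * (pb c / 1105))), -(Complex.I * (sg f.2.2 * (pa c / 1105))), 1] :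
    Fin 3 → ℂ) (l - f.1)

def op (f : FI) : FI := (f.1, f.2.1, !f.2.2)

lemma op_op (f : FI) : op (op f) = f := by simp [op]
lemma op_ne (f : FI) : op f ≠ f := by
  intro h
  have := congrArg (fun g : FI => g.2.2) h
  simp [op] at this

lemma kk_op (c f) : kk c (op f) = - kk c f := by
  funext l
  rw [Pi.neg_apply, kk, kk, op]
  generalize l - f.1 = t
  fin_cases t <;> simp [sg_not]

lemma BB_op (c f l) : BB c (op f) l = (starRingEnd ℂ) (BB c f l) := by
  rw [BB, BB, op]
  generalize l - f.1 = t
  have h5 : (starRingEnd ℂ) 1105 = 1105 := map_ofNat _ _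
  fin_cases t <;> simp [sg_not, h5]

lemma BB_le (c f l) : ‖BB c f l‖ ≤ 1 := by
  have h := pab c
  have ha : |(pa c : ℝ)| ≤ 1105 := by
    rw [abs_of_pos (by exact_mod_cast h.2.1)]
    have : pa c ≤ 1105 := by nlinarith [sq_nonneg (pb c)]
    exact_mod_cast this
  have hb : |(pb c : ℝ)| ≤ 1105 := by
    rw [abs_of_pos (by exact_mod_cast h.2.2.1)]
    have : pb c ≤ 1105 := by nlinarith [sq_nonneg (pa c)]
    exact_mod_cast this
  have hs : ∀ b, ‖(sg b : ℂ)‖ = 1 := by intro b; cases b <;> simp [sg]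
  have ha' : ‖(pa c : ℂ)‖ ≤ 1105 := by rw [Complex.norm_intCast]; exact ha
  have hb' : ‖(pb c : ℂ)‖ ≤ 1105 := by rw [Complex.norm_intCast]; exact hb
  rw [BB]
  generalize l - f.1 = t
  fin_cases t
  · show ‖Complex.I * (sg f.2.2 * (sg f.2.1 * (pb c / 1105)))‖ ≤ 1
    rw [norm_mul, norm_mul, norm_mul, hs, hs, norm_div, Complex.norm_I, Complex.norm_ofNat]
    linarith
  · show ‖-(Complex.I * (sg f.2.2 * (pa c / 1105)))‖ ≤ 1
    rw [norm_neg, norm_mul, norm_mul, hs, norm_div, Complex.norm_I, Complex.norm_ofNat]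
    linarith
  · show ‖(1:ℂ)‖ ≤ 1
    simp

lemma kk_le (c f l) : |kk c f l| ≤ 1105 := by
  have h := pab c
  have ha : |pa c| ≤ 1105 := by
    rw [abs_of_pos h.2.1]; nlinarith [sq_nonneg (pb c)]
  have hb : |pb c| ≤ 1105 := by
    rw [abs_of_pos h.2.2.1]; nlinarith [sq_nonneg (pa c)]
  have hs : ∀ b, |sg b| = 1 := by intro b; cases b <;> rfl
  rw [kk]
  generalize l - f.1 = t
  fin_cases t
  · show |sg f.2.2 * pa c| ≤ 1105
    rw [abs_mul, hs, one_mul]; exact ha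
  · show |sg f.2.2 * (sg f.2.1 * pb c)| ≤ 1105
    rw [abs_mul, abs_mul, hs, hs, one_mul, one_mul]; exact hb
  · show |(0:ℤ)| ≤ 1105
    norm_num

lemma beltrami (c f l) : Complex.I * ((kk c f (l + 1) : ℂ) * BB c f (l + 2) - (kk c f (l + 2) : ℂ) * BB c f (l + 1)) =
    1105 * BB c f l := by
  have h := (pab c).1
  have h' : ((pa c : ℂ)) ^ 2 + (pb c : ℂ) ^ 2 = 1105 ^ 2 := by exact_mod_cast h
  simp only [BB, kk, add_sub_right_comm]
  generalize l - f.1 = t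
  have h1 := sg_sqC f.2.1
  have h2 := sg_sqC f.2.2
  have hI := Complex.I_mul_I
  fin_cases t
  · simp
    ring
  · simp [Fin.add_def]
    ring
  · simp [Fin.add_def]
    linear_combination (-(pa c:ℂ) ^ 2 / 1105 - (sg f.2.1 : ℂ) * (sg f.2.1 : ℂ) * (pb c:ℂ) ^ 2 / 1105) * ((sg f.2.2 : ℂ) * (sg f.2.2 : ℂ)) * hI +
      ((pa c:ℂ) ^ 2 / 1105 + (sg f.2.1 : ℂ) * (sg f.2.1 : ℂ) * (pb c:ℂ) ^ 2 / 1105) * h2 + (pb c : ℂ) ^ 2 / 1105 * h1 + h' / 1105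

lemma kk_add {c c' : Fin 16} {f f' : FI} (h : kk c f + kk c' f' = 0) : c = c' ∧ f' = op f := by
  obtain ⟨r, s1, s2⟩ := f
  obtain ⟨r', s1', s2'⟩ := f'
  have ha := (pab c).2.1
  have hb := (pab c).2.2.1
  have ha' := (pab c').2.1
  have hb' := (pab c').2.2.1
  have e0 := congrFun h 0
  have e1 := congrFun h 1
  have e2 := congrFun h 2
  have key : r = r' ∧ s1' = s1 ∧ s2' = !s2 ∧ pa c = pa c' := by
    fin_cases r <;> fin_cases r' <;> cases s1 <;> cases s1' <;> cases s2 <;> cases s2' <;>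
      simp [kk, sg, Fin.sub_def] at e0 e1 e2 ⊢ <;> omega
  obtain ⟨h1, h2, h3, h4⟩ := key
  subst h1 h2 h3
  exact ⟨pa_inj _ _ h4, rfl⟩

/-- Beltrami pair identity -/
lemma pair_id {k k' B B' : Fin 3 → ℂ} {m : ℂ}
    (h : ∀ l, Complex.I * (k (l + 1) * B (l + 2) - k (l + 2) * B (l + 1)) = m * B l)
    (h' : ∀ l, Complex.I * (k' (l + 1) * B' (l + 2) - k' (l + 2) * B' (l + 1)) = m * B' l) (l : Fin 3) :
    (∑ j, B j * k' j) * B' l + (∑ j, B' j * k j) * B l = (k l + k' l) * ∑ j, B j * B' j := by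
  have g0 := h 0
  have g1 := h 1
  have g2 := h 2
  have g0' := h' 0
  have g1' := h' 1
  have g2' := h' 2
  simp [Fin.add_def] at g0 g1 g2 g0' g1' g2'
  simp only [Fin.sum_univ_three]
  have hI := Complex.I_mul_I
  have hI0 := Complex.I_ne_zero
  apply mul_left_cancel₀ hI0
  fin_cases l
  · simp only [Fin.zero_eta, Fin.mk_one, Fin.reduceFinMk]
    linear_combination B' 2 * g1 - B' 1 * g2 + B 2 * g1' - B 1 * g2'
  · simp only [Fin.zero_eta, Fin.mk_one, Fin.reduceFinMk]
    linear_combination B' 0 * g2 - B' 2 * g0 + B 0 * g2' - B 2 * g0'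
  · simp only [Fin.zero_eta, Fin.mk_one, Fin.reduceFinMk]
    linear_combination B' 1 * g0 - B' 0 * g1 + B 1 * g0' - B 0 * g1'

lemma BB_div (c f) : ∑ j, BB c f j * (kk c f j : ℂ) = 0 := by
  have b := fun l => beltrami c f l
  have g0 := b 0
  have g1 := b 1
  have g2 := b 2
  simp [Fin.add_def] at g0 g1 g2
  simp only [Fin.sum_univ_three]
  apply mul_left_cancel₀ (show (1105:ℂ) ≠ 0 by norm_num)
  linear_combination (-(kk c f 0 : ℂ)) * g0 - (kk c f 1 : ℂ) * g1 - (kk c f 2 : ℂ) * g2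

lemma geo (c : Fin 16) (δ : ℝ) (R : Fin 3 → Fin 3 → ℝ) (hs : ∀ i j, R i j = R j i)
    (hR : ∀ i j, |R i j| ≤ δ) : ∃ a : FI → ℝ, (∀ f, a (op f) = a f) ∧ (∀ f, |a f| ≤ 3 * √δ) ∧
      ∀ i j, ∑ f, ((a f : ℂ) * a f) * (BB c f i * BB c (op f) j) = ((if i = j then 32 * δ else 0 : ℝ) : ℂ) - R i j := by
  have hδ : 0 ≤ δ := (abs_nonneg _).trans (hR 0 0)
  obtain ⟨h1, h2, h3, h4⟩ := pab c
  set α : ℝ := pa c / 1105 with hα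
  set β : ℝ := pb c / 1105 with hβ
  have hα0 : 0 < α := by have : (0:ℝ) < pa c := by exact_mod_cast h2
                         positivity
  have hβ0 : 0 < β := by have : (0:ℝ) < pb c := by exact_mod_cast h3
                         positivity
  have hu : α ^ 2 + β ^ 2 = 1 := by
    have : (pa c : ℝ) ^ 2 + (pb c:ℝ) ^ 2 = 1105 ^ 2 := by exact_mod_cast h1
    rw [hα, hβ]; field_simp; linarith
  have hm : 1 / 5 ≤ α * β := by
    have : (1105:ℝ) ^ 2 ≤ 5 * (pa c * pb c) := by exact_mod_cast h4
    rw [hα, hβ, div_mul_div_comm, le_div_iff₀ (by norm_num)]; linarith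
  have hq : 1 / 4 ≤ α ^ 6 + β ^ 6 := by
    have : α ^ 6 + β ^ 6 = (α ^ 2 + β ^ 2) ^ 3 - 3 * (α ^ 2 * β ^ 2) * (α ^ 2 + β ^ 2) := by ring
    rw [this, hu]
    nlinarith [sq_nonneg (α ^ 2 - β ^ 2)]
  have hq0 : α ^ 6 + β ^ 6 ≠ 0 := by linarith
  set ρ : Fin 3 → ℝ := fun i => R i i - (R 0 0 + R 1 1 + R 2 2) / 2 with hρ
  have hρb : ∀ i, |ρ i| ≤ 5 / 2 * δ := by
    intro i
    have a0 := abs_le.1 (hR 0 0)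
    have a1 := abs_le.1 (hR 1 1)
    have a2 := abs_le.1 (hR 2 2)
    have ai := abs_le.1 (hR i i)
    rw [hρ, abs_le]
    constructor <;> simp only <;> linarith
  set z : Fin 3 → ℝ := fun i => (α ^ 4 * ρ i - α ^ 2 * β ^ 2 * ρ (i + 2) + β ^ 4 * ρ (i + 1)) / (α ^ 6 + β ^ 6) with hz
  have hzb : ∀ i, |z i| ≤ 10 * δ := by
    intro i
    have e1 := hρb i
    have e2 := hρb (i + 2)
    have e3 := hρb (i + 1)
    have hn : |α ^ 4 * ρ i - α ^ 2 * β ^ 2 * ρ (i + 2) + β ^ 4 * ρ (i + 1)| ≤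
        α ^ 4 * (5 / 2 * δ) + α ^ 2 * β ^ 2 * (5 / 2 * δ) + β ^ 4 * (5 / 2 * δ) := by
      refine (abs_add_le _ _).trans (add_le_add ((abs_sub _ _).trans (add_le_add ?_ ?_)) ?_) <;>
      · rw [abs_mul, abs_of_nonneg (by positivity : (0:ℝ) ≤ _)]
        gcongr
    rw [hz]
    simp only
    rw [abs_div, abs_of_pos (show 0 < α ^ 6 + β ^ 6 by linarith), div_le_iff₀ (by linarith)]
    have h5 : α ^ 4 + α ^ 2 * β ^ 2 + β ^ 4 ≤ 1 := by
      have : (α ^ 2 + β ^ 2) ^ 2 = 1 := by rw [hu]; norm_num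
      nlinarith [mul_nonneg (sq_nonneg α) (sq_nonneg β)]
    nlinarith
  have hzi : ∀ i, α ^ 2 * z i + β ^ 2 * z (i + 2) = ρ i := by
    intro i
    have e1 : i + 2 + 2 = i + 1 := by fin_cases i <;> rfl
    have e2 : i + 2 + 1 = i := by fin_cases i <;> rfl
    simp only [hz, e1, e2]
    field_simp
    ring
  set x : Fin 3 → Bool → ℝ := fun r s => (16 * δ + z r + sg s * (R r (r + 1) / (α * β))) / 2 with hx
  have hxb : ∀ r s, 0 ≤ x r s ∧ x r s ≤ 16 * δ := by
    intro r s
    have e1 := abs_le.1 (hzb r)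
    have e2 : |R r (r + 1) / (α * β)| ≤ 5 * δ := by
      rw [abs_div, abs_of_pos (by positivity : 0 < α * β), div_le_iff₀ (by positivity)]
      nlinarith [hR r (r + 1)]
    have e3 := abs_le.1 e2
    cases s <;> simp [hx, sg] <;> constructor <;> linarith
  refine ⟨fun f => √(x f.1 f.2.1 / 2), fun f => rfl, fun f => ?_, fun i j => ?_⟩
  · have := hxb f.1 f.2.1
    rw [abs_of_nonneg (Real.sqrt_nonneg _), Real.sqrt_le_left (by positivity), mul_pow, Real.sq_sqrt hδ]
    linarith
  · have hsq : ∀ r s, ((√(x r s / 2) : ℝ) : ℂ) * ((√(x r s / 2) : ℝ) : ℂ) = ((x r s : ℝ) : ℂ) / 2 := by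
      intro r s
      rw [← Complex.ofReal_mul, Real.mul_self_sqrt (by linarith [(hxb r s).1])]
      push_cast; rfl
    have hdiff : ∀ r, α * β * (x r true - x r false) = R r (r + 1) := by
      intro r
      simp [hx, sg]
      field_simp
      ring
    have hsum : ∀ r, x r true + x r false = 16 * δ + z r := by
      intro r
      simp [hx, sg]
      ring
    have hdiag : ∀ i, α ^ 2 * (x i true + x i false) + β ^ 2 * (x (i + 2) true + x (i + 2) false) = 16 * δ + ρ i := by
      intro i
      rw [hsum, hsum, ← hzi i]
      linear_combination (16 * δ) * hu
    have eα : (pa c : ℂ) / 1105 = (α : ℂ) := by rw [hα]; push_cast; rfl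
    have eβ : (pb c : ℂ) / 1105 = (β : ℂ) := by rw [hβ]; push_cast; rfl
    clear_value α β x z ρ
    have d0 := congrArg (fun r : ℝ => (r:ℂ)) (hdiag 0)
    have d1 := congrArg (fun r : ℝ => (r:ℂ)) (hdiag 1)
    have d2 := congrArg (fun r : ℝ => (r:ℂ)) (hdiag 2)
    have o0 := congrArg (fun r : ℝ => (r:ℂ)) (hdiff 0)
    have o1 := congrArg (fun r : ℝ => (r:ℂ)) (hdiff 1)
    have o2 := congrArg (fun r : ℝ => (r:ℂ)) (hdiff 2)
    have huC := congrArg (fun r : ℝ => (r:ℂ)) hu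
    simp [Fin.add_def, hρ] at d0 d1 d2 o0 o1 o2 huC
    simp only [Fintype.sum_prod_type, Fin.sum_univ_three, Fintype.sum_bool, hsq, op, BB, eα, eβ]
    have hI2 : ∀ a b : ℂ, Complex.I * a * (Complex.I * b) = -(a * b) := fun a b => by
      linear_combination a * b * Complex.I_mul_I
    have s01 := hs 0 1
    have s02 := hs 0 2
    have s12 := hs 1 2
    fin_cases i <;> fin_cases j <;> simp [Fin.sub_def, sg, hI2]
    · linear_combination d1 + d2 - ((x 1 true : ℂ) + x 1 false) * huC
    · linear_combination -o0
    · rw [s02]; linear_combination -o2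
    · rw [← s01]; linear_combination -o0
    · linear_combination d2 + d0 - ((x 2 true : ℂ) + x 2 false) * huC
    · linear_combination -o1
    · linear_combination -o2
    · rw [← s12]; linear_combination -o1
    · linear_combination d0 + d1 - ((x 0 true : ℂ) + x 0 false) * huC

end

/-! ### Part 13 -/

section

def colE : (Bool × (Fin 3 → Bool)) ≃ Fin 16 := Fintype.equivFinOfCardEq (by decide)

namespace Sm
namespace Dat

section
variable {N : ℕ} (d : Dat N)

lemma Rc_re (c : d.Cell) (i j : Fin 3) : (((d.Rc c i j).re : ℝ) : ℂ) = d.Rc c i j := (d.hRr i j).ofReal _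

def cc (c : d.Cell) : Fin 16 := colE (d.col c)

lemma cc_eq {c c' : d.Cell} (h : d.cc c = d.cc c') : d.col c = d.col c' := colE.injective h

lemma exa (c : d.Cell) : ∃ a : FI → ℝ, (∀ f, a (op f) = a f) ∧ (∀ f, |a f| ≤ 3 * √d.δ) ∧
      ∀ i j, ∑ f, ((a f : ℂ) * a f) * (BB (d.cc c) f i * BB (d.cc c) (op f) j) =
        ((if i = j then 32 * d.δ else 0 : ℝ) : ℂ) - d.Rc c i j := by
  obtain ⟨a, h1, h2, h3⟩ := geo (d.cc c) d.δ (fun i j => (d.Rc c i j).re)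
    (fun i j => by simp only [Rc, d.hsym i j])
    (fun i j => (Complex.abs_re_le_norm _).trans (d.Rc_le c i j))
  exact ⟨a, h1, h2, fun i j => by rw [h3, d.Rc_re]⟩

abbrev Ix : Type := d.Cell × FI

def aI (i : d.Ix) : ℝ := Classical.choose (d.exa i.1) i.2
def kI (i : d.Ix) : Fin 3 → ℤ := kk (d.cc i.1) i.2
def bI (i : d.Ix) (l : Fin 3) : ℂ := BB (d.cc i.1) i.2 l
def eI (i : d.Ix) : Sm := d.ew i.1 (d.kI i)
def opI (i : d.Ix) : d.Ix := (i.1, op i.2)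

lemma aI_op (i : d.Ix) : d.aI (d.opI i) = d.aI i := (Classical.choose_spec (d.exa i.1)).1 i.2
lemma aI_le (i : d.Ix) : |d.aI i| ≤ 3 * √d.δ := (Classical.choose_spec (d.exa i.1)).2.1 i.2
lemma aI_le' (i : d.Ix) : ‖(d.aI i : ℂ)‖ ≤ 3 * √d.δ := by
  rw [Complex.norm_real]; exact d.aI_le i
lemma aI_sum (c : d.Cell) (i j : Fin 3) :
    ∑ f, ((d.aI (c, f) : ℂ) * d.aI (c, f)) * (d.bI (c, f) i * d.bI (c, op f) j) =
      ((if i = j then 32 * d.δ else 0 : ℝ) : ℂ) - d.Rc c i j :=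
  (Classical.choose_spec (d.exa c)).2.2 i j
lemma opI_opI (i : d.Ix) : d.opI (d.opI i) = i := by
  rw [opI, opI]; simp only [op_op]
lemma kI_op (i : d.Ix) : d.kI (d.opI i) = -d.kI i := kk_op _ _
lemma bI_op (i : d.Ix) (l) : d.bI (d.opI i) l = starRingEnd ℂ (d.bI i l) := BB_op _ _ _
lemma bI_le (i : d.Ix) (l) : ‖d.bI i l‖ ≤ 1 := BB_le _ _ _
lemma eI_op (i : d.Ix) : cj (d.eI i) = d.eI (d.opI i) := by
  rw [eI, eI, cj_ew, kI_op, opI]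
lemma kI_ne (i : d.Ix) : d.kI i ≠ 0 := by
  intro h
  have := kk_add (c := d.cc i.1) (c' := d.cc i.1) (f := i.2) (f' := i.2)
    (by change d.kI i + d.kI i = 0; rw [h, add_zero])
  exact op_ne _ this.2.symm

def ix : Finset d.Ix := d.cells ×ˢ Finset.univ

lemma mem_ix {i : d.Ix} (h : i ∈ d.ix) : i.1 ∈ d.cells := (Finset.mem_product.1 h).1
lemma opI_mem {i : d.Ix} (h : i ∈ d.ix) : d.opI i ∈ d.ix := by
  have h' := d.mem_ix h
  exact Finset.mem_product.2 ⟨h', Finset.mem_univ _⟩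

lemma sum_opI {M : Type*} [AddCommMonoid M] (F : d.Ix → M) : ∑ i ∈ d.ix, F (d.opI i) = ∑ i ∈ d.ix, F i :=
  Finset.sum_bij' (fun i _ => d.opI i) (fun i _ => d.opI i) (fun i hi => d.opI_mem hi)
    (fun i hi => d.opI_mem hi) (fun i _ => d.opI_opI i) (fun i _ => d.opI_opI i) (fun i _ => rfl)

lemma ov1 (q : Pt) (t : Finset d.Ix) (_ : t ⊆ d.ix) (h : ∀ i ∈ t, q ∈ d.U i.1) : t.card ≤ 192 := by
  classical
  have h1 : t ⊆ (t.image Prod.fst) ×ˢ (Finset.univ : Finset FI) := fun i hi =>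
    Finset.mem_product.2 ⟨Finset.mem_image_of_mem _ hi, Finset.mem_univ _⟩
  have h2 := d.overlap q (t.image Prod.fst) (by
    intro c hc
    obtain ⟨i, hi, rfl⟩ := Finset.mem_image.1 hc
    exact h i hi)
  have h3 := Finset.card_le_card h1
  rw [Finset.card_product] at h3
  have h4 : (Finset.univ : Finset FI).card = 12 := by decide
  rw [h4] at h3
  omega

lemma ov2 (q : Pt) (t : Finset (d.Ix × d.Ix)) (_ : t ⊆ d.ix ×ˢ d.ix)
    (h : ∀ i ∈ t, q ∈ d.U i.1.1 ∩ d.U i.2.1) : t.card ≤ 36864 := by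
  classical
  have h1 : t ⊆ (t.image Prod.fst) ×ˢ (t.image Prod.snd) := fun i hi =>
    Finset.mem_product.2 ⟨Finset.mem_image_of_mem _ hi, Finset.mem_image_of_mem _ hi⟩
  have hsub := fun i hi => Finset.mem_product.1 (‹t ⊆ d.ix ×ˢ d.ix› hi : i ∈ d.ix ×ˢ d.ix)
  have h2 := d.ov1 q (t.image Prod.fst) (by
      intro c hc
      obtain ⟨i, hi, rfl⟩ := Finset.mem_image.1 hc
      exact (hsub i hi).1) (by
    intro c hc
    obtain ⟨i, hi, rfl⟩ := Finset.mem_image.1 hc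
    exact (h i hi).1)
  have h2' := d.ov1 q (t.image Prod.snd) (by
      intro c hc
      obtain ⟨i, hi, rfl⟩ := Finset.mem_image.1 hc
      exact (hsub i hi).2) (by
    intro c hc
    obtain ⟨i, hi, rfl⟩ := Finset.mem_image.1 hc
    exact (h i hi).2)
  have h3 := Finset.card_le_card h1
  rw [Finset.card_product] at h3
  calc _ ≤ _ := h3
    _ ≤ 192 * 192 := Nat.mul_le_mul h2 h2'
    _ = _ := by norm_num

/-- normalization -/
def bn : ℝ := 1 / (d.κ * 1105)
lemma bn0 : 0 < d.bn := by have := d.κ0; unfold bn; positivity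
lemma bn_le : d.bn * d.K ≤ d.K / d.Λ := by
  have h0 := d.κ0
  have h1 := d.κΛ
  have h2 := d.Λ0
  have h3 := d.K0
  rw [bn, one_div, inv_mul_eq_div]
  gcongr
  linarith
lemma bn_norm : ‖(d.bn : ℂ)‖ = d.bn := by rw [Complex.norm_real, Real.norm_of_nonneg d.bn0.le]

def Wo (i : d.Ix) (l : Fin 3) : Sm := ((d.aI i : ℂ) * d.bI i l) • d.ζ i.1
def Wc (i : d.Ix) (l : Fin 3) : Sm := ((d.aI i : ℂ) * ((d.bn : ℂ) * d.bI i (l + 2))) • dx (l + 1) (d.ζ i.1) -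
  ((d.aI i : ℂ) * ((d.bn : ℂ) * d.bI i (l + 1))) • dx (l + 2) (d.ζ i.1)
def W (i : d.Ix) (l : Fin 3) : Sm := d.Wo i l + d.Wc i l

def wo (l : Fin 3) : Sm := ∑ i ∈ d.ix, d.Wo i l * d.eI i
def wc (l : Fin 3) : Sm := ∑ i ∈ d.ix, d.Wc i l * d.eI i
def w (l : Fin 3) : Sm := ∑ i ∈ d.ix, d.W i l * d.eI i

lemma w_eq (l : Fin 3) : d.w l = d.wo l + d.wc l := by
  rw [w, wo, wc, ← Finset.sum_add_distrib]
  refine Finset.sum_congr rfl fun i _ => ?_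
  rw [W, add_mul]

lemma eI_Wv (i : d.Ix) : Wv d.v d.κ (d.kI i) (d.θ i.1 (d.kI i)) (d.eI i) := d.ew_Wv _ _

def Ps (l : Fin 3) : Sm := ∑ i ∈ d.ix, ((d.aI i : ℂ) * ((d.bn : ℂ) * d.bI i l)) • (d.ζ i.1 * d.eI i)

lemma w_curl (l : Fin 3) : d.w l = dx (l + 1) (d.Ps (l + 2)) - dx (l + 2) (d.Ps (l + 1)) := by
  rw [w, Ps, Ps, map_sum, map_sum, ← Finset.sum_sub_distrib]
  refine Finset.sum_congr rfl fun i _ => ?_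
  have hb := beltrami (d.cc i.1) i.2 l
  have hκ : (d.κ : ℂ) ≠ 0 := by exact_mod_cast d.κ0.ne'
  have hbn : (d.bn : ℂ) * d.κ * 1105 = 1 := by
    rw [bn]; push_cast; field_simp
  rw [(dx _).map_smul, (dx _).map_smul, leib, leib, (d.eI_Wv i).hdx, (d.eI_Wv i).hdx, W, Wo, Wc]
  ext q
  simp only [ap_add, ap_sub, ap_mul, ap_smul, kI, bI] at hb ⊢
  linear_combination (-(d.aI i : ℂ) * BB (d.cc i.1) i.2 l * (d.ζ i.1).ap q * (d.eI i).ap q) * hbn -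
    ((d.aI i : ℂ) * d.bn * d.κ * (d.ζ i.1).ap q * (d.eI i).ap q) * hb

lemma w_div : ∑ j, dx j (d.w j) = 0 := by
  simp only [d.w_curl, Fin.sum_univ_three, map_sub]
  rw [show (0:Fin 3) + 1 = 1 from rfl, show (0:Fin 3) + 2 = 2 from rfl, show (1:Fin 3) + 1 = 2 from rfl,
    show (1:Fin 3) + 2 = 0 from rfl, show (2:Fin 3) + 1 = 0 from rfl, show (2:Fin 3) + 2 = 1 from rfl]
  rw [dx_comm 1 0, dx_comm 2 0, dx_comm 2 1]
  abel

lemma w_re (l : Fin 3) : IsRe (d.w l) := by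
  rw [IsRe, w, cj_sum, ← d.sum_opI]
  refine Finset.sum_congr rfl fun i _ => ?_
  rw [cj_mul, eI_op, opI_opI]
  congr 1
  have h1 : (d.opI i).1 = i.1 := rfl
  have hz := d.ζ_re i.1
  rw [W, W, Wo, Wo, Wc, Wc, h1]
  ext q
  have hz' : ∀ j, (starRingEnd ℂ) ((dx j (d.ζ i.1)).ap q) = (dx j (d.ζ i.1)).ap q := fun j => by
    rw [← ap_cj, cj_dx, hz]
  have hz0 : (starRingEnd ℂ) ((d.ζ i.1).ap q) = (d.ζ i.1).ap q := by rw [← ap_cj, hz]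
  simp only [ap_cj, ap_add, ap_sub, ap_smul, map_add, map_sub, map_mul, Complex.conj_ofReal, hz', hz0,
    bI_op, aI_op, Complex.conj_conj]

/-- amplitude of the transport error -/
def V (i : d.Ix) (l : Fin 3) : Sm := DD d.v (d.W i l) + (Complex.I * d.κ) • (d.θ i.1 (d.kI i) * d.W i l) +
  ∑ j, d.W i j * dx j (d.v l)

def Tr (l : Fin 3) : Sm := DD d.v (d.w l) + ∑ j, d.w j * dx j (d.v l)

lemma Tr_eq (l : Fin 3) : d.Tr l = ∑ i ∈ d.ix, d.V i l * d.eI i := by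
  rw [Tr]
  simp only [w, map_sum, Finset.sum_mul]
  rw [Finset.sum_comm, ← Finset.sum_add_distrib]
  refine Finset.sum_congr rfl fun i _ => ?_
  rw [V, leib, (d.eI_Wv i).hD]
  ext q
  simp only [ap_add, ap_mul, ap_smul, ap_sum, add_mul, Finset.sum_mul]
  congr 1
  · ring
  · refine Finset.sum_congr rfl fun j _ => ?_
    ring

lemma Wo_supp (i l) : Supp (d.U i.1) (d.Wo i l) := (d.ζ_supp _).smul _
lemma Wc_supp (i l) : Supp (d.U i.1) (d.Wc i l) :=
  (((d.ζ_supp _).dx (d.U_closed _) _).smul _).sub (((d.ζ_supp _).dx (d.U_closed _) _).smul _)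
lemma W_supp (i l) : Supp (d.U i.1) (d.W i l) := (d.Wo_supp i l).add (d.Wc_supp i l)
lemma V_supp (i l) : Supp (d.U i.1) (d.V i l) :=
  (((d.W_supp i l).DD (d.U_closed _) _).add ((((d.W_supp i l).mul_left _)).smul _)).add
    (Supp.sum _ fun j _ => (d.W_supp i j).mul_right _)

end

lemma W_GG (N : ℕ) : ∃ C : ℝ, 0 ≤ C ∧ ∀ (d : Dat N) (i : d.Ix) (l : Fin 3),
    GG d.v (d.U i.1) (N + 2) (C * √d.δ) d.K d.ν (d.Wo i l) ∧
    GG d.v (d.U i.1) (N + 2) (C * (√d.δ * (d.K / d.Λ))) d.K d.ν (d.Wc i l) ∧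
    GG d.v (d.U i.1) (N + 2) (C * √d.δ) d.K d.ν (d.W i l) ∧
    GG d.v (d.U i.1) (N + 1) (C * √d.δ * d.ν) d.K d.ν (DD d.v (d.W i l)) := by
  obtain ⟨C, hC, h⟩ := ζ_GG N
  refine ⟨9 * C, by positivity, fun d i l => ?_⟩
  obtain ⟨h1, h2, h3, h4⟩ := h d i.1
  have hK := d.K0.le
  have hν := d.ν0.le
  have hs := Real.sqrt_nonneg d.δ
  have hb := d.bn_le
  have hb0 := d.bn0.le
  have hKΛ : (d.K:ℝ) / d.Λ ≤ 1 := (div_le_one d.Λ0).2 d.KΛ'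
  have hKΛ0 : 0 ≤ (d.K:ℝ) / d.Λ := div_nonneg hK d.Λ0.le
  have ha := d.aI_le' i
  have c1 : ∀ l, ‖(d.aI i : ℂ) * d.bI i l‖ ≤ 3 * √d.δ := fun l => by
    rw [norm_mul]
    calc _ ≤ 3 * √d.δ * 1 := mul_le_mul ha (d.bI_le i l) (norm_nonneg _) (by positivity)
      _ = _ := mul_one _
  have c2 : ∀ l, ‖(d.aI i : ℂ) * ((d.bn : ℂ) * d.bI i l)‖ ≤ 3 * √d.δ * d.bn := fun l => by
    rw [norm_mul, norm_mul, d.bn_norm]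
    refine mul_le_mul ha ?_ (by positivity) (by positivity)
    have := d.bI_le i l
    nlinarith
  have o1 : ∀ l, GG d.v (d.U i.1) (N + 2) (3 * √d.δ * C) d.K d.ν (d.Wo i l) := fun l =>
    (h1.smul _).mono (mul_le_mul_of_nonneg_right (c1 l) hC) hK hν
  have hcc : ∀ A : ℝ, 0 ≤ A → 3 * √d.δ * d.bn * (C * d.K * A) ≤ 3 * C * (√d.δ * (d.K / d.Λ)) * A := by
    intro A hA
    calc _ = 3 * C * √d.δ * A * (d.bn * d.K) := by ring
      _ ≤ 3 * C * √d.δ * A * (d.K / d.Λ) := by gcongr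
      _ = _ := by ring
  have o2 : ∀ l, GG d.v (d.U i.1) (N + 2) (6 * C * (√d.δ * (d.K / d.Λ))) d.K d.ν (d.Wc i l) := fun l => by
    refine (((h3 (l + 1)).smul _).sub ((h3 (l + 2)).smul _)).mono ?_ hK hν
    have e1 := mul_le_mul_of_nonneg_right (c2 (l + 2)) (by positivity : 0 ≤ C * d.K)
    have e2 := mul_le_mul_of_nonneg_right (c2 (l + 1)) (by positivity : 0 ≤ C * d.K)
    have e3 := hcc 1 zero_le_one
    rw [mul_one, mul_one] at e3
    linarith
  have hss : √d.δ * (d.K / d.Λ) ≤ √d.δ := by nlinarith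
  have hss0 : 0 ≤ √d.δ * (d.K / d.Λ) := by positivity
  refine ⟨(o1 l).mono (by nlinarith) hK hν, (o2 l).mono (by nlinarith) hK hν,
    ((o1 l).add (o2 l)).mono (by nlinarith) hK hν, ?_⟩
  rw [W, map_add, Wo, Wc, map_sub, (DD _).map_smul, (DD _).map_smul, (DD _).map_smul]
  refine ((h2.smul _).add (((h4 (l + 1)).smul _).sub ((h4 (l + 2)).smul _))).mono ?_ hK hν
  have e0 := mul_le_mul_of_nonneg_right (c1 l) (by positivity : 0 ≤ C * d.ν)
  have e1 := mul_le_mul_of_nonneg_right (c2 (l + 2)) (by positivity : 0 ≤ C * d.K * d.ν)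
  have e2 := mul_le_mul_of_nonneg_right (c2 (l + 1)) (by positivity : 0 ≤ C * d.K * d.ν)
  have e3 := hcc d.ν hν
  have e4 : 3 * C * (√d.δ * (d.K / d.Λ)) * d.ν ≤ 3 * C * √d.δ * d.ν := by gcongr
  linarith

lemma θ_bd {N : ℕ} (d : Dat N) (c : d.Cell) (k : Fin 3 → ℤ) {m : ℝ} (hk : ∀ j, |(k j : ℝ)| ≤ m) (hm : 0 ≤ m) :
    Bd (d.U c) (N + 2) (6 * m * d.ν / d.Λ) d.K (d.θ c k) ∧
    GG d.v (d.U c) (N + 1) (6 * m * d.ν / d.Λ) d.K d.ν (d.θ c k) := by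
  have hK := d.K0
  have hν := d.ν0.le
  have hL := d.L0.le
  have hΛ := d.Λ0
  have h0 : d.L / d.K ≤ d.ν / d.Λ := by
    rw [div_le_div_iff₀ hK hΛ]; linarith [d.ΛL]
  have key : ∀ j, ‖(k j : ℂ)‖ * (2 * d.L / d.K) ≤ 2 * m * d.ν / d.Λ := fun j => by
    rw [Complex.norm_intCast]
    calc _ ≤ m * (2 * d.L / d.K) := by have := hk j; gcongr
      _ = 2 * m * (d.L / d.K) := by ring
      _ ≤ 2 * m * (d.ν / d.Λ) := by gcongr
      _ = _ := by ring
  constructor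
  · refine (Bd.sum3 hK.le fun j => ((d.u_Bd c j).smul (k j : ℂ)).mono (key j) hK.le).mono (le_of_eq ?_) hK.le
    ring
  · refine (GG.sum3 hK.le fun j => ((d.u_GG c j).smul (k j : ℂ)).mono (key j) hK.le hν).mono (le_of_eq ?_) hK.le hν
    ring

lemma kI_le {N : ℕ} (d : Dat N) (i : d.Ix) (j : Fin 3) : |(d.kI i j : ℝ)| ≤ 1105 := by
  have := kk_le (d.cc i.1) i.2 j
  exact_mod_cast this

lemma eI_GG (N : ℕ) : ∃ C : ℝ, 0 ≤ C ∧ ∀ (d : Dat N) (i : d.Ix),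
    GG d.v (d.U i.1) (N + 2) C d.Λ d.ν (d.eI i) := by
  refine ⟨7735 ^ (N + 2) * (1 + 2 ^ (N + 2) * 50000), by positivity, fun d i => ?_⟩
  have hκ := d.κ0
  refine (d.eI_Wv i).GG (by norm_num) d.Λ0.le hκ (by norm_num) d.ν0.le (fun j => ?_) ?_
  · rw [abs_mul, abs_of_pos hκ]
    nlinarith [d.kI_le i j, d.κ7, abs_nonneg (d.kI i j : ℝ), d.Λ0]
  · have h := (d.θ_bd i.1 (d.kI i) (d.kI_le i) (by norm_num)).1
    have hΛ := d.Λ0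
    have hν := d.ν0
    refine (h.mono ?_ d.K0.le).mono_μ (by positivity) d.K0.le d.KΛ'
    rw [div_le_div_iff₀ hΛ hκ]
    have := d.κ7
    nlinarith [mul_pos hν hΛ, mul_le_mul_of_nonneg_left this hν.le]

lemma V_GG (N : ℕ) : ∃ C : ℝ, 0 ≤ C ∧ ∀ (d : Dat N) (i : d.Ix) (l : Fin 3),
    GG d.v (d.U i.1) N (C * (√d.δ * d.ν)) d.K d.ν (d.V i l) ∧
    Bd (d.U i.1) (N + 1) (C * (√d.δ * d.ν)) d.K (d.V i l) := by
  obtain ⟨C, hC, h⟩ := W_GG N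
  refine ⟨C + 50000 * (2 ^ (N + 2) * C) + 3 * (2 ^ (N + 2) * (C * (1 + 3 * 2 ^ N))), by positivity, fun d i l => ?_⟩
  have hK := d.K0.le
  have hν := d.ν0.le
  have hs := Real.sqrt_nonneg d.δ
  have hL := d.L0.le
  have hκ := d.κ0
  have hΛ := d.Λ0
  have hLν := d.LLν
  have hθ := d.θ_bd i.1 (d.kI i) (d.kI_le i) (by norm_num)
  have hn : ‖Complex.I * (d.κ:ℂ)‖ = d.κ := by
    rw [norm_mul, Complex.norm_I, one_mul, Complex.norm_real, Real.norm_of_nonneg hκ.le]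
  have hκν : d.κ * (6 * 1105 * d.ν / d.Λ) ≤ 50000 * d.ν := by
    rw [mul_div_assoc', div_le_iff₀ hΛ]
    nlinarith [mul_le_mul_of_nonneg_right d.κ7 hν]
  have a1 : d.κ * (2 ^ (N + 1) * (6 * 1105 * d.ν / d.Λ * (C * √d.δ))) ≤ 50000 * (2 ^ (N + 1) * C) * (√d.δ * d.ν) := by
    calc _ = d.κ * (6 * 1105 * d.ν / d.Λ) * (2 ^ (N + 1) * (C * √d.δ)) := by ring
      _ ≤ 50000 * d.ν * (2 ^ (N + 1) * (C * √d.δ)) := by gcongr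
      _ = _ := by ring
  have h21 : (2:ℝ) ^ (N + 2) = 2 * 2 ^ (N + 1) := by ring
  have h1N : (1:ℝ) ≤ 1 + 3 * 2 ^ N := by have : (0:ℝ) < 2 ^ N := by positivity
                                         linarith
  constructor
  · refine (((h d i l).2.2.2.of_le (by omega)).add ((GG.mul hK hν (by positivity) (by positivity)
      (hθ.2.of_le (by omega)) ((h d i l).2.2.1.of_le (by omega))).smul _) |>.add
      (GG.sum3 hK fun j => GG.mul hK hν (by positivity) (by positivity) ((h d i j).2.2.1.of_le (by omega))
        ((d.dv_GG l j).mono_U (Set.subset_univ _)))).mono ?_ hK hν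
    rw [hn]
    have a2 : 3 * (2 ^ (N + 1) * (C * √d.δ * ((1 + 3 * 2 ^ N) * d.L))) ≤
        3 * (2 ^ (N + 1) * (C * (1 + 3 * 2 ^ N))) * (√d.δ * d.ν) := by
      calc _ ≤ 3 * (2 ^ (N + 1) * (C * √d.δ * ((1 + 3 * 2 ^ N) * d.ν))) := by gcongr
        _ = _ := by ring
    have a3 : 0 ≤ 50000 * (2 ^ (N + 1) * C) * (√d.δ * d.ν) := by positivity
    have a4 : 0 ≤ 3 * (2 ^ (N + 1) * (C * (1 + 3 * 2 ^ N))) * (√d.δ * d.ν) := by positivity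
    rw [h21]
    linarith
  · refine ((((h d i l).2.2.2.1).add ((Bd.mul (hθ.1.of_le (by omega)) ((h d i l).2.2.1.1.of_le (by omega))).smul _)).add
      (Bd.sum3 hK fun j => Bd.mul ((h d i j).2.2.1.1.of_le (by omega))
        (((d.hdv l j).mono_U (Set.subset_univ _)).mono_μ hL d.lam0 d.lamK))).mono ?_ hK
    rw [hn]
    have a2 : 3 * (2 ^ (N + 1) * (C * √d.δ * d.L)) ≤
        3 * (2 ^ (N + 1) * (C * (1 + 3 * 2 ^ N))) * (√d.δ * d.ν) := by
      calc _ ≤ 3 * (2 ^ (N + 1) * (C * √d.δ * ((1 + 3 * 2 ^ N) * d.ν))) := by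
            gcongr
            nlinarith
        _ = _ := by ring
    have a3 : 0 ≤ 50000 * (2 ^ (N + 1) * C) * (√d.δ * d.ν) := by positivity
    have a4 : 0 ≤ 3 * (2 ^ (N + 1) * (C * (1 + 3 * 2 ^ N))) * (√d.δ * d.ν) := by positivity
    rw [h21]
    linarith

end Dat
end Sm

end

/-! ### Part 14 -/

section

namespace Sm
namespace Dat

lemma osc (n : ℕ) : ∃ C : ℝ, 0 ≤ C ∧ ∀ (d : Dat (n + 1)) (ι : Type) (s : Finset ι) (U : ι → Set Pt) (M : ℕ),
    (∀ i ∈ s, IsClosed (U i)) → (∀ q, ∀ t ⊆ s, (∀ i ∈ t, q ∈ U i) → t.card ≤ M) →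
    ∀ (k : ι → Fin 3 → ℤ) (θ e : ι → Sm) (V : ι → Fin 3 → Sm) (A E : ℝ), 0 ≤ A → 0 ≤ E →
    (∀ i ∈ s, k i ≠ 0) → (∀ i ∈ s, Wv d.v d.κ (k i) (θ i) (e i)) →
    (∀ i ∈ s, GG d.v (U i) 1 E d.Λ d.ν (e i)) →
    (∀ i ∈ s, ∀ l, GG d.v (U i) (n + 1) A d.K d.ν (V i l)) → (∀ i ∈ s, ∀ l, Supp (U i) (V i l)) →
    ∃ (Q : Fin 3 → Fin 3 → Sm) (Z : Fin 3 → Sm), (∀ j l, Q j l = Q l j) ∧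
      (∀ j l, GG d.v Set.univ 1 (C * (M * E * A) / d.Λ) d.Λ d.ν (Q j l)) ∧
      (∀ l, GG d.v Set.univ 1 (C * (M * E * A) * (d.K / d.Λ) ^ n) d.Λ d.ν (Z l)) ∧
      (∀ l, ∑ i ∈ s, V i l * e i = ∑ j, dx j (Q j l) + Z l) ∧
      ∀ S : Set Pt, (∀ i ∈ s, U i ⊆ S) → (∀ j l, Supp S (Q j l)) ∧ ∀ l, Supp S (Z l) := by
  obtain ⟨C, hC, h⟩ := parametrix 1 n
  refine ⟨2 ^ 2 * C, by positivity, fun d ι s U M hU hM k θ e V A E hA hE hk hw he hV hs => ?_⟩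
  have hK := d.K0.le
  have hν := d.ν0.le
  have hκ := d.κ0
  have hΛ := d.Λ0
  have hκΛ := d.κΛ
  have hKΛ := d.KΛ'
  have key : ∀ i, ∃ (Q : Fin 3 → Fin 3 → Sm) (V' : Fin 3 → Sm), i ∈ s → (∀ j l, Q j l = Q l j) ∧
      (∀ j l, GG d.v (U i) 1 (C * A / d.κ) d.K d.ν (Q j l)) ∧ (∀ j l, Supp (U i) (Q j l)) ∧
      (∀ l, GG d.v (U i) 1 (C * A * (d.K / d.κ) ^ n) d.K d.ν (V' l)) ∧ (∀ l, Supp (U i) (V' l)) ∧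
      ∀ l, V i l * e i = ∑ j, dx j (Q j l * e i) + V' l * e i := by
    intro i
    by_cases hi : i ∈ s
    · obtain ⟨Q, V', hh⟩ := h d.v (U i) d.L d.κ d.K d.ν hκ hK (hKΛ.trans hκΛ) hν d.LLν (hU i hi)
        (fun a b => (((d.hdv a b).of_le (by omega)).mono_U (Set.subset_univ _)).mono_μ d.L0.le d.lam0 d.lamK)
        (k i) (θ i) (e i) (hk i hi) (hw i hi) (V i) A hA (hV i hi) (hs i hi)
      exact ⟨Q, V', fun _ => hh⟩
    · exact ⟨0, 0, fun h => absurd h hi⟩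
  choose Q V' hQV using key
  refine ⟨fun j l => ∑ i ∈ s, Q i j l * e i, fun l => ∑ i ∈ s, V' i l * e i, fun j l => ?_, fun j l => ?_,
    fun l => ?_, fun l => ?_, fun S hS => ⟨fun j l => ?_, fun l => ?_⟩⟩
  · exact Finset.sum_congr rfl fun i hi => by rw [(hQV i hi).1 j l]
  · refine (GG.sum_overlap (A := 2 ^ 2 * (C * A / d.κ * E)) s U hU _ hM (by positivity) hΛ.le hν
      (fun i hi => ((hQV i hi).2.2.1 j l).mul_right _) fun i hi => GG.mul hΛ.le hν (by positivity) hE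
        (((hQV i hi).2.1 j l).mono_μ (by positivity) hK hν hKΛ) (he i hi)).mono ?_ hΛ.le hν
    calc (M:ℝ) * (2 ^ 2 * (C * A / d.κ * E)) ≤ M * (2 ^ 2 * (C * A / d.Λ * E)) := by gcongr
      _ = _ := by ring
  · refine (GG.sum_overlap (A := 2 ^ 2 * (C * A * (d.K / d.κ) ^ n * E)) s U hU _ hM (by positivity) hΛ.le hν
      (fun i hi => ((hQV i hi).2.2.2.2.1 l).mul_right _) fun i hi => GG.mul hΛ.le hν (by positivity) hE
        (((hQV i hi).2.2.2.1 l).mono_μ (by positivity) hK hν hKΛ) (he i hi)).mono ?_ hΛ.le hν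
    calc (M:ℝ) * (2 ^ 2 * (C * A * (d.K / d.κ) ^ n * E)) ≤ M * (2 ^ 2 * (C * A * (d.K / d.Λ) ^ n * E)) := by gcongr
      _ = _ := by ring
  · simp only [map_sum]
    rw [Finset.sum_comm, ← Finset.sum_add_distrib]
    exact Finset.sum_congr rfl fun i hi => (hQV i hi).2.2.2.2.2 l
  · exact Supp.sum _ fun i hi => (((hQV i hi).2.2.1 j l).mul_right _).mono (hS i hi)
  · exact Supp.sum _ fun i hi => (((hQV i hi).2.2.2.2.1 l).mul_right _).mono (hS i hi)

def TS {N : ℕ} (d : Dat N) : Set Pt := {q | |q.1| ≤ d.T + 4 / d.ν}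
lemma TS_closed {N : ℕ} (d : Dat N) : IsClosed d.TS :=
  isClosed_le (by fun_prop) continuous_const

lemma U_TS {N : ℕ} (d : Dat N) {i : d.Ix} (hi : i ∈ d.ix) : d.U i.1 ⊆ d.TS := fun _ hq =>
  d.U_time (d.mem_ix hi) hq

lemma wo_supp {N : ℕ} (d : Dat N) (l) : Supp d.TS (d.wo l) :=
  Supp.sum _ fun i hi => ((d.Wo_supp i l).mul_right _).mono (d.U_TS hi)
lemma wc_supp {N : ℕ} (d : Dat N) (l) : Supp d.TS (d.wc l) :=
  Supp.sum _ fun i hi => ((d.Wc_supp i l).mul_right _).mono (d.U_TS hi)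
lemma w_supp {N : ℕ} (d : Dat N) (l) : Supp d.TS (d.w l) := by
  rw [w_eq]; exact (d.wo_supp l).add (d.wc_supp l)

lemma w_GG (N : ℕ) : ∃ C : ℝ, 0 ≤ C ∧ ∀ (d : Dat N) (l : Fin 3),
    GG d.v Set.univ (N + 2) (C * √d.δ) d.Λ d.ν (d.wo l) ∧
    GG d.v Set.univ (N + 2) (C * (√d.δ * (d.K / d.Λ))) d.Λ d.ν (d.wc l) ∧
    GG d.v Set.univ (N + 2) (C * √d.δ) d.Λ d.ν (d.w l) ∧
    Bd Set.univ (N + 1) (C * (√d.δ * d.ν)) d.Λ (d.Tr l) := by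
  obtain ⟨C1, hC1, h1⟩ := W_GG N
  obtain ⟨C2, hC2, h2⟩ := eI_GG N
  obtain ⟨C3, hC3, h3⟩ := V_GG N
  refine ⟨192 * (2 ^ (N + 3) * ((C1 + C3) * C2)), by positivity, fun d l => ?_⟩
  have hK := d.K0.le
  have hν := d.ν0.le
  have hΛ := d.Λ0.le
  have hKΛ := d.KΛ'
  have hs := Real.sqrt_nonneg d.δ
  have gen : ∀ (F : d.Ix → Sm) (A : ℝ), 0 ≤ A → (∀ i, GG d.v (d.U i.1) (N + 2) (C1 * A) d.K d.ν (F i)) →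
      (∀ i, Supp (d.U i.1) (F i)) →
      GG d.v Set.univ (N + 2) (192 * (2 ^ (N + 3) * ((C1 + C3) * C2)) * A) d.Λ d.ν (∑ i ∈ d.ix, F i * d.eI i) := by
    intro F A hA hF hS
    refine (GG.sum_overlap (A := 2 ^ (N + 3) * (C1 * A * C2)) d.ix (fun i => d.U i.1) (fun i _ => d.U_closed _)
      _ d.ov1 (by positivity) hΛ hν (fun i _ => (hS i).mul_right _) fun i _ => GG.mul hΛ hν (by positivity) hC2
        ((hF i).mono_μ (by positivity) hK hν hKΛ) (h2 d i)).mono ?_ hΛ hν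
    push_cast
    nlinarith [mul_nonneg (mul_nonneg (pow_pos (two_pos : (0:ℝ) < 2) (N + 3)).le (mul_nonneg hC3 hC2)) hA]
  refine ⟨gen _ _ (by positivity) (fun i => (h1 d i l).1) fun i => d.Wo_supp i l,
    gen _ _ (by positivity) (fun i => (h1 d i l).2.1) fun i => d.Wc_supp i l,
    gen _ _ (by positivity) (fun i => (h1 d i l).2.2.1) fun i => d.W_supp i l, ?_⟩
  rw [Tr_eq]
  refine (Bd.sum_overlap (A := 2 ^ (N + 1) * (C3 * (√d.δ * d.ν) * C2)) d.ix (fun i => d.U i.1) (fun i _ => d.U_closed _)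
    _ d.ov1 (by positivity) hΛ (fun i _ => (d.V_supp i l).mul_right _) fun i _ => Bd.mul
      ((h3 d i l).2.mono_μ (by positivity) hK hKΛ) ((h2 d i).1.of_le (by omega))).mono ?_ hΛ
  push_cast
  have e1 : 0 ≤ 2 ^ (N + 1) * (C1 * C2) * (√d.δ * d.ν) := by positivity
  have e2 : 0 ≤ 2 ^ (N + 1) * (C3 * C2) * (√d.δ * d.ν) := by positivity
  have e3 : (2:ℝ) ^ (N + 3) = 4 * 2 ^ (N + 1) := by ring
  rw [e3]
  nlinarith

def IsDiv (f : Sm) : Prop := ∃ g : Fin 3 → Sm, f = ∑ j, dx j (g j)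
lemma IsDiv.add {f g : Sm} (hf : IsDiv f) (hg : IsDiv g) : IsDiv (f + g) := by
  obtain ⟨a, rfl⟩ := hf
  obtain ⟨b, rfl⟩ := hg
  exact ⟨fun j => a j + b j, by simp only [map_add, Finset.sum_add_distrib]⟩
lemma IsDiv.neg {f : Sm} (hf : IsDiv f) : IsDiv (-f) := by
  obtain ⟨a, rfl⟩ := hf
  exact ⟨fun j => - a j, by simp only [map_neg, Finset.sum_neg_distrib]⟩
lemma IsDiv.sub {f g : Sm} (hf : IsDiv f) (hg : IsDiv g) : IsDiv (f - g) := by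
  rw [sub_eq_add_neg]; exact hf.add hg.neg
lemma IsDiv.dx (l : Fin 3) (f : Sm) : IsDiv (Sm.dx l f) := by
  refine ⟨fun j => if j = l then f else 0, ?_⟩
  rw [Finset.sum_eq_single l]
  · simp
  · intro b _ hb; simp [hb]
  · simp
lemma IsDiv.div (g : Fin 3 → Sm) : IsDiv (∑ j, Sm.dx j (g j)) := ⟨g, rfl⟩

lemma Tr_div {N : ℕ} (d : Dat N) (l : Fin 3) : IsDiv (d.Tr l) := by
  have h : d.Tr l = (dx (l + 1) (dt (d.Ps (l + 2))) - dx (l + 2) (dt (d.Ps (l + 1)))) +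
      ∑ j, dx j (d.v j * d.w l + d.w j * d.v l) := by
    rw [Tr, DD_apply, ← dt_dx, ← dt_dx, ← map_sub, ← w_curl]
    have h1 := d.hdiv
    have h2 := d.w_div
    simp only [map_add, leib, Finset.sum_add_distrib, ← Finset.sum_mul, h1, h2]
    ring
  rw [h]
  exact ((IsDiv.dx _ _).sub (IsDiv.dx _ _)).add (IsDiv.div _)

end Dat
end Sm

end

/-! ### Part 15 -/

section

namespace Sm
namespace Dat

section
variable {N : ℕ} (d : Dat N)

def UP (p : d.Ix × d.Ix) : Set Pt := d.U p.1.1 ∩ d.U p.2.1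
def Zp (p : d.Ix × d.Ix) : Sm := d.ζ p.1.1 * d.ζ p.2.1
def eP (p : d.Ix × d.Ix) : Sm := d.eI p.1 * d.eI p.2
def cP (p : d.Ix × d.Ix) : ℂ := (d.aI p.1 : ℂ) * d.aI p.2
def bP (p : d.Ix × d.Ix) : ℂ := ∑ j, d.bI p.1 j * d.bI p.2 j
def kP (p : d.Ix × d.Ix) : Fin 3 → ℤ := d.kI p.1 + d.kI p.2
def θP (p : d.Ix × d.Ix) : Sm := d.θ p.1.1 (d.kI p.1) + d.θ p.2.1 (d.kI p.2)
def gP (p : d.Ix × d.Ix) (l : Fin 3) : Sm := ∑ j, dx j (d.Wo p.1 j * d.Wo p.2 l * d.eP p)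
def VP (p : d.Ix × d.Ix) (l : Fin 3) : Sm := ∑ j, (d.cP p / 2 * (d.bI p.1 j * d.bI p.2 l + d.bI p.2 j * d.bI p.1 l)) • dx j (d.Zp p)
  - (d.cP p / 2 * d.bP p) • dx l (d.Zp p)

lemma eP_Wv (p : d.Ix × d.Ix) : Wv d.v d.κ (d.kP p) (d.θP p) (d.eP p) := (d.eI_Wv p.1).mul (d.eI_Wv p.2)

lemma gP_pair (p : d.Ix × d.Ix) (l : Fin 3) : d.gP p l + d.gP p.swap l =
    (2:ℂ) • (d.VP p l * d.eP p) + dx l ((d.cP p * d.bP p) • (d.Zp p * d.eP p)) := by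
  have e1 : ∀ j, d.Wo p.1 j * d.Wo p.2 l * d.eP p = (d.cP p * (d.bI p.1 j * d.bI p.2 l)) • (d.Zp p * d.eP p) := by
    intro j
    ext q
    simp only [Wo, cP, Zp, ap_mul, ap_smul]
    ring
  have e2 : ∀ j, d.Wo p.2 j * d.Wo p.1 l * d.eP p.swap = (d.cP p * (d.bI p.2 j * d.bI p.1 l)) • (d.Zp p * d.eP p) := by
    intro j
    ext q
    simp only [Wo, cP, Zp, eP, Prod.fst_swap, Prod.snd_swap, ap_mul, ap_smul]
    ring
  have hd1 := BB_div (d.cc p.1.1) p.1.2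
  have hd2 := BB_div (d.cc p.2.1) p.2.2
  have hp := pair_id (k := fun j => (kk (d.cc p.1.1) p.1.2 j : ℂ)) (k' := fun j => (kk (d.cc p.2.1) p.2.2 j : ℂ))
    (fun l => beltrami (d.cc p.1.1) p.1.2 l) (fun l => beltrami (d.cc p.2.1) p.2.2 l) l
  simp only [gP, Prod.fst_swap, Prod.snd_swap, e1, e2, VP]
  simp only [(dx _).map_smul, leib, (d.eP_Wv p).hdx]
  ext q
  simp only [ap_add, ap_sub, ap_mul, ap_smul, kP, kI, bI, bP, Pi.add_apply, Int.cast_add,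
    Fin.sum_univ_three] at hd1 hd2 hp ⊢
  generalize (d.Zp p).ap q = Z
  generalize (d.eP p).ap q = e
  linear_combination (Complex.I * d.κ * d.cP p * Z * e) * hp +
    (Complex.I * d.κ * d.cP p * Z * e * BB (d.cc p.2.1) p.2.2 l) * hd1 +
    (Complex.I * d.κ * d.cP p * Z * e * BB (d.cc p.1.1) p.1.2 l) * hd2

open Classical in
def H : Finset (d.Ix × d.Ix) := (d.ix ×ˢ d.ix).filter fun p => d.kP p ≠ 0

lemma mem_H {p : d.Ix × d.Ix} : p ∈ d.H ↔ (p.1 ∈ d.ix ∧ p.2 ∈ d.ix) ∧ d.kP p ≠ 0 := by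
  rw [H, Finset.mem_filter, Finset.mem_product]

lemma H_swap (F : d.Ix × d.Ix → Sm) : ∑ p ∈ d.H, F p.swap = ∑ p ∈ d.H, F p := by
  have hs : ∀ p ∈ d.H, p.swap ∈ d.H := fun p hp => by
    rw [mem_H] at hp ⊢
    exact ⟨⟨hp.1.2, hp.1.1⟩, by simpa only [kP, Prod.fst_swap, Prod.snd_swap, add_comm] using hp.2⟩
  exact Finset.sum_bij' (fun i _ => i.swap) (fun i _ => i.swap) hs hs (fun i _ => i.swap_swap)
    (fun i _ => i.swap_swap) (fun i _ => rfl)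

def PiH : Sm := ∑ p ∈ d.H, (d.cP p / 2 * d.bP p) • (d.Zp p * d.eP p)

lemma sum_gP (l : Fin 3) : ∑ p ∈ d.H, d.gP p l = ∑ p ∈ d.H, d.VP p l * d.eP p + dx l d.PiH := by
  have h1 : (2:ℂ) • ∑ p ∈ d.H, d.gP p l = ∑ p ∈ d.H, (d.gP p l + d.gP p.swap l) := by
    rw [Finset.sum_add_distrib, d.H_swap (fun p => d.gP p l), two_smul]
  have h2 : (2:ℂ) • ∑ p ∈ d.H, d.gP p l = (2:ℂ) • (∑ p ∈ d.H, d.VP p l * d.eP p + dx l d.PiH) := by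
    rw [h1, smul_add, PiH, map_sum, Finset.smul_sum, Finset.smul_sum, ← Finset.sum_add_distrib]
    refine Finset.sum_congr rfl fun p _ => ?_
    rw [gP_pair, ← (dx l).map_smul, smul_smul,
      show (2:ℂ) * (d.cP p / 2 * d.bP p) = d.cP p * d.bP p by ring]
  exact smul_right_injective _ (two_ne_zero : (2:ℂ) ≠ 0) h2

lemma low_term (i i' : d.Ix) (hk : d.kI i + d.kI i' = 0) (hne : i' ≠ d.opI i) : d.ζ i.1 * d.ζ i'.1 = 0 := by
  obtain ⟨hc, hf⟩ := kk_add hk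
  have hc' := d.cc_eq hc
  have hne' : i.1 ≠ i'.1 := fun h => hne (Prod.ext h.symm hf)
  ext q
  rw [ap_mul, ap_zero]
  by_cases h1 : q ∈ d.U i.1
  · by_cases h2 : q ∈ d.U i'.1
    · exact absurd (d.disjoint_col h1 h2 hc') hne'
    · rw [d.ζ_supp _ q h2, mul_zero]
  · rw [d.ζ_supp _ q h1, zero_mul]

open Classical in
lemma wo_wo (j l : Fin 3) : d.wo j * d.wo l = ∑ p ∈ d.H, d.Wo p.1 j * d.Wo p.2 l * d.eP p +
    ∑ c ∈ d.cells, (((if j = l then 32 * d.δ else 0 : ℝ) : ℂ) - d.Rc c j l) • (d.ζ c * d.ζ c) := by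
  have h1 : d.wo j * d.wo l = ∑ p ∈ d.ix ×ˢ d.ix, d.Wo p.1 j * d.Wo p.2 l * d.eP p := by
    rw [wo, wo, Finset.sum_mul_sum, Finset.sum_product]
    refine Finset.sum_congr rfl fun i _ => Finset.sum_congr rfl fun i' _ => ?_
    rw [eP]; ring
  rw [h1, ← Finset.sum_filter_add_sum_filter_not _ (fun p => d.kP p ≠ 0)]
  congr 1
  rw [Finset.sum_filter, Finset.sum_product, ix, Finset.sum_product]
  refine Finset.sum_congr rfl fun c hc => ?_
  rw [← d.aI_sum, Finset.sum_smul]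
  refine Finset.sum_congr rfl fun f _ => ?_
  change ∑ i' ∈ d.ix, _ = _
  have hmem : (c, f) ∈ d.ix := Finset.mem_product.2 ⟨hc, Finset.mem_univ _⟩
  rw [Finset.sum_eq_single (d.opI (c, f))]
  · have hk0 : d.kP ((c, f), d.opI (c, f)) = 0 := by
      rw [kP]; change d.kI _ + d.kI _ = 0
      rw [kI_op, add_neg_cancel]
    rw [if_pos (not_not.2 hk0)]
    have he : d.eP ((c, f), d.opI (c, f)) = 1 := by
      change d.ew c _ * d.ew c _ = 1
      rw [kI_op, ew_mul_neg]
    rw [he, mul_one]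
    change d.Wo (c, f) j * d.Wo (d.opI (c, f)) l = _
    rw [Wo, Wo, aI_op]
    ext q
    simp only [ap_mul, ap_smul]
    change _ * (d.ζ c).ap q * (_ * d.bI (c, op f) l * (d.ζ c).ap q) = _
    ring
  · intro i' _ hne
    split_ifs with h
    · rfl
    · have h0 := d.low_term (c, f) i' (not_not.1 h) hne
      have : d.Wo (c, f) j * d.Wo i' l = 0 := by
        rw [Wo, Wo, smul_mul_smul_comm, h0, smul_zero]
      change d.Wo (c, f) j * d.Wo i' l * _ = 0
      rw [this, zero_mul]
  · intro h
    exact absurd (d.opI_mem hmem) h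

def Pr : Sm := d.PiH + (((32 * d.δ : ℝ)) : ℂ) • d.G

lemma div_wo (l : Fin 3) : ∑ j, dx j (d.wo j * d.wo l) = ∑ p ∈ d.H, d.VP p l * d.eP p + dx l d.Pr +
    ∑ j, dx j (d.E j l - d.R j l) := by
  have h1 : ∑ j, dx j (∑ p ∈ d.H, d.Wo p.1 j * d.Wo p.2 l * d.eP p) = ∑ p ∈ d.H, d.gP p l := by
    simp only [map_sum, gP]
    rw [Finset.sum_comm]
  have h2 : ∀ j, ∑ c ∈ d.cells, (((if j = l then 32 * d.δ else 0 : ℝ) : ℂ) - d.Rc c j l) • (d.ζ c * d.ζ c) =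
      (if j = l then (((32 * d.δ : ℝ)) : ℂ) • d.G else 0) + (d.E j l - d.R j l) := by
    intro j
    rw [E, G]
    split_ifs
    · simp only [sub_smul, Finset.sum_sub_distrib, Finset.smul_sum]
      abel
    · simp only [Complex.ofReal_zero, zero_sub, neg_smul, Finset.sum_neg_distrib]
      abel
  simp only [wo_wo, map_add, Finset.sum_add_distrib, h1, h2, sum_gP, Pr]
  have h3 : ∑ j, dx j (if j = l then (((32 * d.δ : ℝ)) : ℂ) • d.G else 0) = dx l ((((32 * d.δ : ℝ)) : ℂ) • d.G) := by
    rw [Finset.sum_eq_single l]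
    · simp
    · intro b _ hb; simp [hb]
    · simp
  rw [h3]
  abel

lemma Zp_supp (p) : Supp (d.UP p) (d.Zp p) := fun q hq => by
  by_cases h : q ∈ d.U p.1.1
  · exact (d.ζ_supp p.2.1).mul_left _ q fun h' => hq ⟨h, h'⟩
  · exact (d.ζ_supp p.1.1).mul_right _ q h
lemma UP_closed (p) : IsClosed (d.UP p) := (d.U_closed _).inter (d.U_closed _)
lemma VP_supp (p l) : Supp (d.UP p) (d.VP p l) :=
  (Supp.sum _ fun j _ => ((d.Zp_supp p).dx (d.UP_closed p) j).smul _).sub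
    (((d.Zp_supp p).dx (d.UP_closed p) l).smul _)
lemma UP_TS {p} (hp : p ∈ d.H) : d.UP p ⊆ d.TS := fun _ hq => d.U_TS (d.mem_H.1 hp).1.1 hq.1
lemma ovH (q : Pt) (t : Finset (d.Ix × d.Ix)) (ht : t ⊆ d.H)
    (h : ∀ i ∈ t, q ∈ d.UP i) : t.card ≤ 36864 :=
  d.ov2 q t (ht.trans (Finset.filter_subset _ _)) h
lemma cP_le (p) : ‖d.cP p‖ ≤ 9 * d.δ := by
  rw [cP, norm_mul]
  calc _ ≤ 3 * √d.δ * (3 * √d.δ) := mul_le_mul (d.aI_le' _) (d.aI_le' _) (norm_nonneg _) (by positivity)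
    _ = 9 * (√d.δ * √d.δ) := by ring
    _ = _ := by rw [Real.mul_self_sqrt d.δ0.le]
lemma bb_le (i i' j l) : ‖d.bI i j * d.bI i' l‖ ≤ 1 := by
  rw [norm_mul]; exact mul_le_one₀ (d.bI_le _ _) (norm_nonneg _) (d.bI_le _ _)
lemma bP_le (p) : ‖d.bP p‖ ≤ 3 := by
  rw [bP]
  calc _ ≤ ∑ j : Fin 3, (1:ℝ) := norm_sum_le_of_le _ fun j _ => d.bb_le _ _ _ _
    _ = 3 := by simp
lemma Pr_supp : Supp d.TS d.Pr :=
  (Supp.sum _ fun p hp => (((d.Zp_supp p).mul_right _).mono (d.UP_TS hp)).smul _).add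
    ((Supp.sum _ fun c hc => ((d.ζ_supp c).mul_right _).mono fun _ hq => d.U_time hc hq).smul _)

end

lemma P_GG (N : ℕ) : ∃ C : ℝ, 0 ≤ C ∧ ∀ (d : Dat N),
    (∀ p, GG d.v (d.UP p) (N + 2) C d.Λ d.ν (d.eP p)) ∧
    (∀ p l, GG d.v (d.UP p) (N + 2) (C * (d.δ * d.K)) d.K d.ν (d.VP p l)) ∧
    GG d.v Set.univ (N + 2) (C * d.δ) d.Λ d.ν d.Pr := by
  obtain ⟨C1, hC1, h1⟩ := ζ_GG N
  obtain ⟨C2, hC2, h2⟩ := eI_GG N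
  set D : ℝ := 2 ^ (N + 3) with hD
  have hD0 : 0 ≤ D := by positivity
  refine ⟨D * (C2 * C2) + 41 * (2 * (D * (C1 * C1))) +
    (36864 * (27 * (D * (D * (C1 * C1) * (D * (C2 * C2))))) + 512 * (D * (C1 * C1))),
    by positivity, fun d => ?_⟩
  have hK := d.K0.le
  have hν := d.ν0.le
  have hΛ := d.Λ0.le
  have hδ := d.δ0.le
  have hKΛ := d.KΛ'
  have he : ∀ p, GG d.v (d.UP p) (N + 2) (D * (C2 * C2)) d.Λ d.ν (d.eP p) := fun p =>
    GG.mul hΛ hν hC2 hC2 ((h2 d p.1).mono_U Set.inter_subset_left) ((h2 d p.2).mono_U Set.inter_subset_right)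
  have z1 : ∀ p : d.Ix × d.Ix, GG d.v (d.UP p) (N + 2) (D * (C1 * C1)) d.K d.ν (d.Zp p) := fun p =>
    GG.mul hK hν hC1 hC1 ((h1 d p.1.1).1.mono_U Set.inter_subset_left) ((h1 d p.2.1).1.mono_U Set.inter_subset_right)
  have z2 : ∀ (p : d.Ix × d.Ix) j, GG d.v (d.UP p) (N + 2) (2 * (D * (C1 * C1)) * d.K) d.K d.ν (dx j (d.Zp p)) := fun p j => by
    rw [Zp, leib]
    refine ((GG.mul hK hν (by positivity) hC1 (((h1 d p.1.1).2.2.1 j).mono_U Set.inter_subset_left)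
      ((h1 d p.2.1).1.mono_U Set.inter_subset_right)).add (GG.mul hK hν hC1 (by positivity)
      ((h1 d p.1.1).1.mono_U Set.inter_subset_left) (((h1 d p.2.1).2.2.1 j).mono_U Set.inter_subset_right))).mono
      (le_of_eq ?_) hK hν
    rw [hD]; ring
  have hc2 : ∀ p, ‖d.cP p / 2‖ ≤ 9 / 2 * d.δ := fun p => by
    rw [norm_div]; have := d.cP_le p
    norm_num
    linarith
  refine ⟨fun p => (he p).mono ?_ hΛ hν, fun p l => ?_, ?_⟩
  · have : 0 ≤ 41 * (2 * (D * (C1 * C1))) +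
      (36864 * (27 * (D * (D * (C1 * C1) * (D * (C2 * C2))))) + 512 * (D * (C1 * C1))) := by positivity
    linarith
  · have c1 : ∀ j, ‖d.cP p / 2 * (d.bI p.1 j * d.bI p.2 l + d.bI p.2 j * d.bI p.1 l)‖ ≤ 9 * d.δ := fun j => by
      rw [norm_mul]
      have := norm_add_le (d.bI p.1 j * d.bI p.2 l) (d.bI p.2 j * d.bI p.1 l)
      have a1 := d.bb_le p.1 p.2 j l
      have a2 := d.bb_le p.2 p.1 j l
      calc _ ≤ 9 / 2 * d.δ * 2 := mul_le_mul (hc2 p) (by linarith) (norm_nonneg _) (by positivity)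
        _ = _ := by ring
    have c2 : ‖d.cP p / 2 * d.bP p‖ ≤ 27 / 2 * d.δ := by
      rw [norm_mul]
      calc _ ≤ 9 / 2 * d.δ * 3 := mul_le_mul (hc2 p) (d.bP_le p) (norm_nonneg _) (by positivity)
        _ = _ := by ring
    have hx : 0 ≤ 2 * (D * (C1 * C1)) * d.K := by positivity
    refine ((GG.sum3 hK fun j => ((z2 p j).smul _).mono (mul_le_mul_of_nonneg_right (c1 j) hx) hK hν).sub
      (((z2 p l).smul _).mono (mul_le_mul_of_nonneg_right c2 hx) hK hν)).mono ?_ hK hν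
    have y1 : 0 ≤ (D * (C2 * C2) + 
      (36864 * (27 * (D * (D * (C1 * C1) * (D * (C2 * C2))))) + 512 * (D * (C1 * C1)))) * (d.δ * d.K) := by positivity
    have y2 : 0 ≤ (2 * (D * (C1 * C1))) * (d.δ * d.K) := by positivity
    linarith
  · have o1 : GG d.v Set.univ (N + 2) (36864 * (27 * d.δ * (D * (D * (C1 * C1) * (D * (C2 * C2)))))) d.Λ d.ν d.PiH := by
      have := GG.sum_overlap (v := d.v) (n := N + 2) (A := 27 * d.δ * (D * (D * (C1 * C1) * (D * (C2 * C2))))) (μ := d.Λ) (ν := d.ν) d.H d.UP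
        (fun p _ => d.UP_closed p) (fun p => (d.cP p / 2 * d.bP p) • (d.Zp p * d.eP p)) d.ovH (by positivity) hΛ hν
        (fun p _ => ((d.Zp_supp p).mul_right _).smul _) (fun p _ => ?_)
      · exact_mod_cast this
      · refine ((GG.mul hΛ hν (by positivity) (by positivity) ((z1 p).mono_μ (by positivity) hK hν hKΛ) (he p)).smul _).mono ?_ hΛ hν
        refine mul_le_mul_of_nonneg_right ?_ (by positivity)
        rw [norm_mul]
        calc _ ≤ 9 / 2 * d.δ * 3 := mul_le_mul (hc2 p) (d.bP_le p) (norm_nonneg _) (by positivity)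
          _ ≤ _ := by linarith
    have o2 : GG d.v Set.univ (N + 2) (16 * (D * (C1 * C1))) d.Λ d.ν d.G := by
      have := GG.sum_overlap (v := d.v) (n := N + 2) (A := D * (C1 * C1)) (μ := d.Λ) (ν := d.ν) d.cells d.U
        (fun p _ => d.U_closed p) (fun c => d.ζ c * d.ζ c) d.overlap' (by positivity) hΛ hν
        (fun c _ => ((d.ζ_supp c).mul_right _)) (fun c _ => (GG.mul hK hν hC1 hC1 (h1 d c).1 (h1 d c).1).mono_μ
          (by positivity) hK hν hKΛ)
      exact_mod_cast this
    refine (o1.add (o2.smul _)).mono ?_ hΛ hν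
    rw [Complex.norm_real, Real.norm_of_nonneg (by positivity)]
    have y1 : 0 ≤ (D * (C2 * C2) + 41 * (2 * (D * (C1 * C1)))) * d.δ := by positivity
    linarith

end Dat
end Sm

end

/-! ### Part 16 -/

section

namespace Sm

/-- real part -/
def rp (f : Sm) : Sm := (1 / 2 : ℂ) • (f + cj f)
lemma rp_re (f : Sm) : IsRe (rp f) := by
  rw [IsRe, rp, cj_smul, cj_add, cj_cj, add_comm]
  congr 1
  simp [show (starRingEnd ℂ) (2:ℂ) = 2 from Complex.conj_ofNat 2]
lemma rp_of_re {f : Sm} (h : IsRe f) : rp f = f := by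
  rw [rp, h, ← two_smul ℂ, smul_smul]; norm_num
lemma rp_add (f g : Sm) : rp (f + g) = rp f + rp g := by
  simp only [rp, cj_add, smul_add]; abel
lemma rp_sum {ι : Type*} (s : Finset ι) (f : ι → Sm) : rp (∑ i ∈ s, f i) = ∑ i ∈ s, rp (f i) := by
  simp only [rp, cj_sum, ← Finset.sum_add_distrib, Finset.smul_sum]
lemma rp_dx (j : Fin 3) (f : Sm) : rp (dx j f) = dx j (rp f) := by
  rw [rp, rp, (dx j).map_smul, map_add, cj_dx]
lemma rp_dt (f : Sm) : rp (dt f) = dt (rp f) := by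
  rw [rp, rp, dt.map_smul, map_add, cj_dt]
lemma rp_re_mul {f : Sm} (h : IsRe f) (g : Sm) : rp (f * g) = f * rp g := by
  rw [rp, rp, cj_mul, h, mul_smul_comm, mul_add]
lemma rp_neg (f : Sm) : rp (-f) = -rp f := by
  have h : cj (-f) = - cj f := by ext; simp
  rw [rp, rp, h, ← neg_add, smul_neg]
lemma rp_DD {v : Fin 3 → Sm} (hv : ∀ i, IsRe (v i)) (f : Sm) : rp (DD v f) = DD v (rp f) := by
  rw [DD_apply, DD_apply, rp_add, rp_dt, rp_sum]
  simp only [rp_re_mul (hv _), rp_dx]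
lemma rp_le {f : Sm} {A : ℝ} {q : Pt} (h : ‖f.ap q‖ ≤ A) : ‖(rp f).ap q‖ ≤ A := by
  rw [rp, ap_smul, ap_add, ap_cj, norm_mul]
  have h1 := norm_add_le (f.ap q) ((starRingEnd ℂ) (f.ap q))
  rw [RCLike.norm_conj] at h1
  norm_num
  linarith
lemma rp_supp {f : Sm} {U : Set Pt} (h : Supp U f) : Supp U (rp f) := fun q hq => by
  rw [rp, ap_smul, ap_add, ap_cj, h q hq]; simp
lemma IsRe.add {f g : Sm} (hf : IsRe f) (hg : IsRe g) : IsRe (f + g) := by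
  rw [IsRe, cj_add, hf, hg]
lemma IsRe.neg {f : Sm} (hf : IsRe f) : IsRe (-f) := by
  have h : cj (-f) = - cj f := by ext; simp
  rw [IsRe, h, hf]
lemma IsRe.mul {f g : Sm} (hf : IsRe f) (hg : IsRe g) : IsRe (f * g) := by
  rw [IsRe, cj_mul, hf, hg]
lemma IsRe.sum {ι : Type*} {s : Finset ι} {f : ι → Sm} (hf : ∀ i ∈ s, IsRe (f i)) : IsRe (∑ i ∈ s, f i) := by
  rw [IsRe, cj_sum]; exact Finset.sum_congr rfl hf
lemma IsRe.dx {f : Sm} (hf : IsRe f) (j) : IsRe (Sm.dx j f) := by rw [IsRe, cj_dx, hf]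
lemma IsRe.dt {f : Sm} (hf : IsRe f) : IsRe (Sm.dt f) := by rw [IsRe, cj_dt, hf]
lemma IsRe.DD {v : Fin 3 → Sm} (hv : ∀ i, IsRe (v i)) {f : Sm} (hf : IsRe f) : IsRe (Sm.DD v f) := by
  rw [DD_apply]
  exact hf.dt.add (IsRe.sum fun j _ => (hv j).mul (hf.dx j))

namespace Dat

def RB {N : ℕ} (d : Dat N) (A : ℝ) (f : Sm) : Prop := (∀ q, ‖f.ap q‖ ≤ A) ∧ (∀ k q, ‖(dx k f).ap q‖ ≤ A * d.Λ) ∧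
  ∀ q, ‖(DD d.v f).ap q‖ ≤ A * d.ν

section
variable {N : ℕ} {d : Dat N} {A B : ℝ} {f g : Sm}
lemma RB.mono (h : d.RB A f) (hAB : A ≤ B) : d.RB B f :=
  ⟨fun q => (h.1 q).trans hAB, fun k q => (h.2.1 k q).trans (mul_le_mul_of_nonneg_right hAB d.Λ0.le),
    fun q => (h.2.2 q).trans (mul_le_mul_of_nonneg_right hAB d.ν0.le)⟩
lemma RB.add (h : d.RB A f) (h' : d.RB B g) : d.RB (A + B) (f + g) := by
  refine ⟨fun q => ?_, fun k q => ?_, fun q => ?_⟩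
  · rw [ap_add]; exact norm_add_le_of_le (h.1 q) (h'.1 q)
  · rw [map_add, ap_add, add_mul]; exact norm_add_le_of_le (h.2.1 k q) (h'.2.1 k q)
  · rw [map_add, ap_add, add_mul]; exact norm_add_le_of_le (h.2.2 q) (h'.2.2 q)
lemma RB.rp (h : d.RB A f) : d.RB A (rp f) := by
  refine ⟨fun q => rp_le (h.1 q), fun k q => ?_, fun q => ?_⟩
  · rw [← rp_dx]; exact rp_le (h.2.1 k q)
  · rw [← rp_DD d.hvr]; exact rp_le (h.2.2 q)
lemma RB.of_GG (h : GG d.v Set.univ 1 A d.Λ d.ν f) : d.RB A f :=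
  ⟨fun q => h.1.le (Set.mem_univ q), fun k q => (h.1.dx k).le (Set.mem_univ q), fun q => h.2.le (Set.mem_univ q)⟩
lemma RB.dt (h : d.RB A f) (hA : 0 ≤ A) (q : Pt) : ‖(dt f).ap q‖ ≤ 4 * A * d.Λ := by
  have h1 : (Sm.dt f).ap q = (DD d.v f).ap q - ∑ j, (d.v j).ap q * (dx j f).ap q := by
    rw [DD_apply, ap_add, ap_sum]; simp
  have h2 : ‖∑ j, (d.v j).ap q * (dx j f).ap q‖ ≤ ∑ j : Fin 3, A * d.Λ := norm_sum_le_of_le _ fun j _ => by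
    rw [norm_mul]
    calc _ ≤ 1 * (A * d.Λ) := mul_le_mul (d.hv1 j q) (h.2.1 j q) (norm_nonneg _) zero_le_one
      _ = _ := one_mul _
  simp only [Finset.sum_const, Finset.card_univ, Fintype.card_fin, nsmul_eq_mul] at h2
  have h3 := h.2.2 q
  have h4 := norm_sub_le ((DD d.v f).ap q) (∑ j, (d.v j).ap q * (dx j f).ap q)
  have h5 := mul_le_mul_of_nonneg_left d.νΛ hA
  rw [h1]
  push_cast at h2
  linarith

lemma RB.adiv {Z : Fin 3 → Sm} (h : ∀ l, d.RB A (Z l)) (j l) : d.RB (14 * A * d.Λ) (adiv Z j l) := by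
  have hA : 0 ≤ A := (norm_nonneg _).trans ((h 0).1 0)
  have hΛ := d.Λ1
  have hν := d.ν1
  have k1 : ∀ q, ‖(Sm.adiv Z j l).ap q‖ ≤ 2 * A := fun q =>
    TB.adiv (t := q.1) (A := A) (fun l x => (h l).1 (q.1, x)) j l q.2
  have k2 : ∀ k q, ‖(dx k (Sm.adiv Z j l)).ap q‖ ≤ 2 * (A * d.Λ) := fun k q => by
    have e : dx k (Sm.adiv Z j l) = Sm.adiv (fun l => dx k (Z l)) j l := adiv_pdir _ _ _ _
    rw [e]
    exact TB.adiv (t := q.1) (A := A * d.Λ) (fun l x => (h l).2.1 k (q.1, x)) j l q.2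
  have k3 : ∀ q, ‖(Sm.dt (Sm.adiv Z j l)).ap q‖ ≤ 2 * (4 * A * d.Λ) := fun q => by
    have e : Sm.dt (Sm.adiv Z j l) = Sm.adiv (fun l => Sm.dt (Z l)) j l := adiv_pdir _ _ _ _
    rw [e]
    exact TB.adiv (t := q.1) (A := 4 * A * d.Λ) (fun l x => (h l).dt hA (q.1, x)) j l q.2
  have hAΛ : A ≤ A * d.Λ := le_mul_of_one_le_right hA hΛ
  refine ⟨fun q => (k1 q).trans (by linarith), fun k q => (k2 k q).trans ?_, fun q => ?_⟩
  · have := mul_le_mul_of_nonneg_left hΛ (mul_nonneg hA (by linarith : (0:ℝ) ≤ d.Λ))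
    nlinarith
  · rw [DD_apply, ap_add, ap_sum]
    have h2 : ‖∑ j', (d.v j' * dx j' (Sm.adiv Z j l)).ap q‖ ≤ ∑ j : Fin 3, 2 * (A * d.Λ) := norm_sum_le_of_le _ fun j' _ => by
      rw [ap_mul, norm_mul]
      calc _ ≤ 1 * (2 * (A * d.Λ)) := mul_le_mul (d.hv1 j' q) (k2 j' q) (norm_nonneg _) zero_le_one
        _ = _ := one_mul _
    simp only [Finset.sum_const, Finset.card_univ, Fintype.card_fin, nsmul_eq_mul] at h2
    push_cast at h2
    have h3 := norm_add_le_of_le (k3 q) h2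
    have := mul_le_mul_of_nonneg_left hν (mul_nonneg hA (by linarith : (0:ℝ) ≤ d.Λ))
    linarith
end

lemma E_symm {N : ℕ} (d : Dat N) (i j) : d.E i j = d.E j i := by
  have h : ∀ c, d.Rc c i j = d.Rc c j i := fun c => by simp only [Rc, d.hsym i j]
  simp only [E, d.hsym i j, h]

/-- size of the new stress -/
def er {n : ℕ} (d : Dat (n + 1)) : ℝ := d.δ * (d.L / d.ν + d.lam / d.K) + d.δ * (d.K / d.Λ) + √d.δ * d.ν / d.Λ +
  (d.K / d.Λ) ^ n * d.Λ ^ 2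

def S2 {N : ℕ} (d : Dat N) (j l : Fin 3) : Sm := d.wc j * d.w l + d.wo j * d.wc l

lemma S2_eq {N : ℕ} (d : Dat N) (j l : Fin 3) : d.S2 j l = d.w j * d.w l - d.wo j * d.wo l := by
  rw [S2, w_eq, w_eq]; ring

/-- algebra of the new equation -/
lemma new_eq {n : ℕ} (d : Dat (n + 1)) {Q1 Q2 : Fin 3 → Fin 3 → Sm} {Z1 Z2 : Fin 3 → Sm}
    (h1 : ∀ l, ∑ i ∈ d.ix, d.V i l * d.eI i = ∑ j, dx j (Q1 j l) + Z1 l)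
    (h2 : ∀ l, ∑ p ∈ d.H, d.VP p l * d.eP p = ∑ j, dx j (Q2 j l) + Z2 l) (l : Fin 3) :
    DD (fun i => d.v i + d.w i) (d.v l + d.w l) + dx l (d.p - d.Pr) =
      ∑ j, dx j (d.E j l + d.S2 j l + Q1 j l + Q2 j l + adiv (fun l => Z1 l + Z2 l) j l) ∧
    DD (fun i => d.v i + d.w i) (d.v l + d.w l) - DD d.v (d.v l) = d.Tr l + ∑ j, d.w j * dx j (d.w l) := by
  have hw := d.w_div
  have hx : DD (fun i => d.v i + d.w i) (d.v l + d.w l) = DD d.v (d.v l) + d.Tr l + ∑ j, d.w j * dx j (d.w l) := by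
    rw [Tr]
    simp only [DD_apply, map_add, add_mul, mul_add, Finset.sum_add_distrib]
    abel
  have hww : ∑ j, dx j (d.w j * d.w l) = ∑ j, d.w j * dx j (d.w l) := by
    simp only [leib, Finset.sum_add_distrib, ← Finset.sum_mul, hw, zero_mul, zero_add]
  have hS : ∑ j, dx j (d.S2 j l) = ∑ j, d.w j * dx j (d.w l) - ∑ j, dx j (d.wo j * d.wo l) := by
    simp only [S2_eq, map_sub, Finset.sum_sub_distrib, hww]
  have hdwo := d.div_wo l
  have had := adiv_div (fun l => Z1 l + Z2 l) (fun l => ?_) l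
  · refine ⟨?_, by rw [hx]; abel⟩
    have e := d.heq l
    have eT := d.Tr_eq l
    rw [h1] at eT
    rw [h2] at hdwo
    have hp : dx l (d.p - d.Pr) = dx l d.p - dx l d.Pr := map_sub _ _ _
    have hE : ∑ j, dx j (d.E j l - d.R j l) = ∑ j, dx j (d.E j l) - ∑ j, dx j (d.R j l) := by
      simp only [map_sub, Finset.sum_sub_distrib]
    rw [hx, hp]
    simp only [map_add, Finset.sum_add_distrib] at had ⊢
    rw [had, hS, hdwo, hE, eT, ← e]
    abel
  · have hZ : IsDiv (Z1 l + Z2 l) := by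
      have : Z1 l + Z2 l = (d.Tr l - ∑ j, dx j (Q1 j l)) + ((∑ p ∈ d.H, d.gP p l - dx l d.PiH) - ∑ j, dx j (Q2 j l)) := by
        rw [Tr_eq, h1, sum_gP, h2]; abel
      rw [this]
      refine ((d.Tr_div l).sub (IsDiv.div _)).add (((?_ : IsDiv _).sub (IsDiv.dx _ _)).sub (IsDiv.div _))
      refine ⟨fun j => ∑ p ∈ d.H, d.Wo p.1 j * d.Wo p.2 l * d.eP p, ?_⟩
      simp only [map_sum, gP]
      rw [Finset.sum_comm]
    obtain ⟨g, hg⟩ := hZ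
    change PP (l + 2) (PP (l + 1) (PP l (Z1 l + Z2 l))) = 0
    rw [hg]
    exact PPP_div l g

end Dat
end Sm

end

/-! ### Part 17 -/

section

namespace Sm
namespace Dat

/-- Output of one step. -/
structure Out {n : ℕ} (d : Dat (n + 1)) (M : ℝ) where
  w : Fin 3 → Sm
  R : Fin 3 → Fin 3 → Sm
  π : Sm
  hw : ∀ i, IsRe (w i)
  hRr : ∀ i j, IsRe (R i j)
  hπ : IsRe π
  hdiv : ∑ j, dx j (w j) = 0
  hsym : ∀ i j, R i j = R j i
  heq : ∀ l, DD (fun i => d.v i + w i) (d.v l + w l) + dx l (d.p + π) = ∑ j, dx j (R j l)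
  w0 : ∀ i q, ‖(w i).ap q‖ ≤ M * √d.δ
  w1 : ∀ i j, Bd Set.univ (n + 2) (M * (√d.δ * d.Λ)) d.Λ (dx j (w i))
  wt : ∀ i q, ‖(dt (w i)).ap q‖ ≤ M * (√d.δ * d.Λ)
  Dw : ∀ i j, Bd Set.univ (n + 1) (M * (√d.δ * d.ν * d.Λ + d.δ * d.Λ ^ 2)) d.Λ
    (dx j (DD (fun i => d.v i + w i) (d.v i + w i) - DD d.v (d.v i)))
  R0 : ∀ i j q, ‖(R i j).ap q‖ ≤ M * d.er
  R1 : ∀ i j k q, ‖(dx k (R i j)).ap q‖ ≤ M * d.er * d.Λ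
  DR : ∀ i j q, ‖(DD (fun i => d.v i + w i) (R i j)).ap q‖ ≤ M * d.er * (d.ν + √d.δ * d.Λ)
  π0 : ∀ q, ‖π.ap q‖ ≤ M * d.δ
  π1 : ∀ j q, ‖(dx j π).ap q‖ ≤ M * (d.δ * d.Λ)
  πt : ∀ q, ‖(dt π).ap q‖ ≤ M * (d.δ * d.Λ)
  wsupp : ∀ i q, d.T + 4 / d.ν < |q.1| → (w i).ap q = 0
  Rsupp : ∀ i j q, d.T + 4 / d.ν < |q.1| → (R i j).ap q = 0
  πsupp : ∀ q, d.T + 4 / d.ν < |q.1| → π.ap q = 0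

lemma E_RB (n : ℕ) : ∃ C : ℝ, 0 ≤ C ∧ ∀ (d : Dat (n + 1)) (i j : Fin 3), d.RB (C * d.er) (d.E i j) := by
  obtain ⟨C, hC, h⟩ := E_bd (n + 1)
  refine ⟨C, hC, fun d i j => ?_⟩
  have hK := d.K0
  have hν := d.ν0
  have hΛ := d.Λ0
  have hδ := d.δ0
  have hl := d.lam0
  have hL := d.L0
  have a1 : 0 ≤ d.δ * (d.L / d.ν + d.lam / d.K) := by positivity
  have a2 : 0 ≤ d.δ * (d.K / d.Λ) := by positivity
  have a3 : 0 ≤ √d.δ * d.ν / d.Λ := by positivity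
  have a4 : 0 ≤ ((d.K:ℝ) / d.Λ) ^ n * d.Λ ^ 2 := by positivity
  have e1 : d.δ * (d.L / d.ν + d.lam / d.K) ≤ d.er := by unfold er; linarith
  have e2 : d.δ * (d.K / d.Λ) ≤ d.er := by unfold er; linarith
  refine ⟨fun q => (h d i j q).1.trans (by gcongr), fun k q => ((h d i j q).2.1 k).trans ?_,
    fun q => (h d i j q).2.2.trans (by gcongr)⟩
  rw [mul_assoc]
  refine mul_le_mul_of_nonneg_left ?_ hC
  calc d.δ * d.K = d.δ * (d.K / d.Λ) * d.Λ := by field_simp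
    _ ≤ _ := by gcongr

lemma S2_RB (n : ℕ) : ∃ C : ℝ, 0 ≤ C ∧ ∀ (d : Dat (n + 1)) (i j : Fin 3), d.RB (C * d.er) (d.S2 i j) := by
  obtain ⟨C, hC, h⟩ := w_GG (n + 1)
  refine ⟨8 * (C * C), by positivity, fun d i j => ?_⟩
  have hK := d.K0
  have hν := d.ν0
  have hΛ := d.Λ0
  have hδ := d.δ0
  have hl := d.lam0
  have hL := d.L0
  have a1 : 0 ≤ d.δ * (d.L / d.ν + d.lam / d.K) := by positivity
  have a3 : 0 ≤ √d.δ * d.ν / d.Λ := by positivity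
  have a4 : 0 ≤ ((d.K:ℝ) / d.Λ) ^ n * d.Λ ^ 2 := by positivity
  have e2 : d.δ * (d.K / d.Λ) ≤ d.er := by unfold er; linarith
  refine RB.of_GG (((GG.mul hΛ.le hν.le (by positivity) (by positivity) ((h d i).2.1.of_le (by omega))
    ((h d j).2.2.1.of_le (by omega))).add (GG.mul hΛ.le hν.le (by positivity) (by positivity) ((h d i).1.of_le (by omega))
    ((h d j).2.1.of_le (by omega)))).mono ?_ hΛ.le hν.le)
  calc _ = 8 * (C * C) * ((√d.δ * √d.δ) * (d.K / d.Λ)) := by ring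
    _ = 8 * (C * C) * (d.δ * (d.K / d.Λ)) := by rw [Real.mul_self_sqrt hδ.le]
    _ ≤ _ := by gcongr

theorem step (n : ℕ) : ∃ M : ℝ, 1 ≤ M ∧ ∀ d : Dat (n + 1), Nonempty (Out d M) := by
  obtain ⟨Co, hCo, ho⟩ := osc n
  obtain ⟨Cw, hCw, hw⟩ := w_GG (n + 1)
  obtain ⟨Cp, hCp, hp⟩ := P_GG (n + 1)
  obtain ⟨Cv, hCv, hv⟩ := V_GG (n + 1)
  obtain ⟨Ci, hCi, hi⟩ := eI_GG (n + 1)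
  obtain ⟨Ce, hCe, hE⟩ := E_RB n
  obtain ⟨Cs, hCs, hS⟩ := S2_RB n
  set B1 : ℝ := Co * (192 * Ci * Cv) with hB1
  set B2 : ℝ := Co * (36864 * Cp * Cp) with hB2
  have hB10 : 0 ≤ B1 := by positivity
  have hB20 : 0 ≤ B2 := by positivity
  set Cr : ℝ := Ce + Cs + B1 + B2 + 14 * (B1 + B2) with hCr
  have hCr0 : 0 ≤ Cr := by positivity
  set M : ℝ := 1 + 4 * Cw + (Cw + 3 * (2 ^ (n + 2) * (Cw * Cw))) + Cr * (1 + 3 * Cw) + 4 * Cp with hM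
  have m1 : 4 * Cw ≤ M := by
    have : 0 ≤ (Cw + 3 * (2 ^ (n + 2) * (Cw * Cw))) + Cr * (1 + 3 * Cw) + 4 * Cp := by positivity
    linarith
  have m2 : Cw + 3 * (2 ^ (n + 2) * (Cw * Cw)) ≤ M := by
    have : 0 ≤ 4 * Cw + Cr * (1 + 3 * Cw) + 4 * Cp := by positivity
    linarith
  have m3 : Cr * (1 + 3 * Cw) ≤ M := by
    have : 0 ≤ 4 * Cw + (Cw + 3 * (2 ^ (n + 2) * (Cw * Cw))) + 4 * Cp := by positivity
    linarith
  have m4 : 4 * Cp ≤ M := by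
    have : 0 ≤ 4 * Cw + (Cw + 3 * (2 ^ (n + 2) * (Cw * Cw))) + Cr * (1 + 3 * Cw) := by positivity
    linarith
  have m0 : 1 ≤ M := by
    have : 0 ≤ 4 * Cw + (Cw + 3 * (2 ^ (n + 2) * (Cw * Cw))) + Cr * (1 + 3 * Cw) + 4 * Cp := by positivity
    linarith
  have m5 : Cr ≤ M := by nlinarith [mul_nonneg hCr0 hCw]
  clear_value M Cr
  refine ⟨M, m0, fun d => ?_⟩
  have hK := d.K0
  have hν := d.ν0
  have hΛ := d.Λ0
  have hδ := d.δ0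
  have hl := d.lam0
  have hL := d.L0
  have hKΛ := d.KΛ'
  have hss := Real.mul_self_sqrt hδ.le
  have hs1 : √d.δ ≤ 1 := Real.sqrt_le_one.2 d.δ1
  have a1 : 0 ≤ d.δ * (d.L / d.ν + d.lam / d.K) := by positivity
  have a2 : 0 ≤ d.δ * (d.K / d.Λ) := by positivity
  have a3 : 0 ≤ √d.δ * d.ν / d.Λ := by positivity
  have a4 : 0 ≤ ((d.K:ℝ) / d.Λ) ^ n * d.Λ ^ 2 := by positivity
  have e2 : d.δ * (d.K / d.Λ) ≤ d.er := by unfold er; linarith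
  have e3 : √d.δ * d.ν / d.Λ ≤ d.er := by unfold er; linarith
  have e4 : ((d.K:ℝ) / d.Λ) ^ n * d.Λ ^ 2 ≤ d.er := by unfold er; linarith
  have er0 : 0 ≤ d.er := a3.trans e3
  obtain ⟨Q1, Z1, q1s, q1, z1, eq1, s1⟩ := ho d d.Ix d.ix (fun i => d.U i.1) 192 (fun i _ => d.U_closed _) d.ov1
    d.kI (fun i => d.θ i.1 (d.kI i)) d.eI d.V (Cv * (√d.δ * d.ν)) Ci (by positivity) hCi (fun i _ => d.kI_ne i)
    (fun i _ => d.eI_Wv i) (fun i _ => (hi d i).of_le (by omega)) (fun i _ l => (hv d i l).1) (fun i _ l => d.V_supp i l)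
  obtain ⟨Q2, Z2, q2s, q2, z2, eq2, s2⟩ := ho d (d.Ix × d.Ix) d.H d.UP 36864 (fun i _ => d.UP_closed _) d.ovH
    d.kP d.θP d.eP d.VP (Cp * (d.δ * d.K)) Cp (by positivity) hCp (fun i h => (d.mem_H.1 h).2)
    (fun i _ => d.eP_Wv i) (fun i _ => ((hp d).1 i).of_le (by omega)) (fun i _ l => ((hp d).2.1 i l).of_le (by omega))
    (fun i _ l => d.VP_supp i l)
  obtain ⟨s1Q, s1Z⟩ := s1 d.TS fun i hi => d.U_TS hi
  obtain ⟨s2Q, s2Z⟩ := s2 d.TS fun i hi => d.UP_TS hi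
  have hnew := d.new_eq eq1 eq2
  set R0 : Fin 3 → Fin 3 → Sm := fun j l => d.E j l + d.S2 j l + Q1 j l + Q2 j l + adiv (fun l => Z1 l + Z2 l) j l with hR0
  have r1 : ∀ j l, d.RB (B1 * d.er) (Q1 j l) := fun j l => (RB.of_GG (q1 j l)).mono (by
    calc _ = B1 * (√d.δ * d.ν / d.Λ) := by rw [hB1]; push_cast; ring
      _ ≤ _ := by gcongr)
  have r2 : ∀ j l, d.RB (B2 * d.er) (Q2 j l) := fun j l => (RB.of_GG (q2 j l)).mono (by
    calc _ = B2 * (d.δ * (d.K / d.Λ)) := by rw [hB2]; push_cast; ring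
      _ ≤ _ := by gcongr)
  have r3 : ∀ j l, d.RB (14 * (B1 + B2) * d.er) (adiv (fun l => Z1 l + Z2 l) j l) := fun j l => by
    have := fun l => ((RB.of_GG (z1 l)).add (RB.of_GG (z2 l)))
    refine (RB.adiv this j l).mono ?_
    have k1 : √d.δ * d.ν ≤ d.Λ := by
      calc _ ≤ 1 * (d.Λ:ℝ) := mul_le_mul hs1 d.νΛ hν.le zero_le_one
        _ = _ := one_mul _
    have k2 : d.δ * d.K ≤ d.Λ := by
      calc _ ≤ 1 * (d.Λ:ℝ) := mul_le_mul d.δ1 hKΛ hK.le zero_le_one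
        _ = _ := one_mul _
    calc _ = 14 * (B1 * (√d.δ * d.ν) + B2 * (d.δ * d.K)) * ((d.K / d.Λ) ^ n * d.Λ) := by
          rw [hB1, hB2]; push_cast; ring
      _ ≤ 14 * (B1 * d.Λ + B2 * d.Λ) * ((d.K / d.Λ) ^ n * d.Λ) := by gcongr
      _ = 14 * (B1 + B2) * ((d.K / d.Λ) ^ n * d.Λ ^ 2) := by ring
      _ ≤ _ := by gcongr
  have rr : ∀ j l, d.RB (Cr * d.er) (R0 j l) := fun j l =>
    (((((hE d j l).add (hS d j l)).add (r1 j l)).add (r2 j l)).add (r3 j l)).mono (le_of_eq (by rw [hCr]; ring))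
  have hwRB : ∀ l, d.RB (Cw * √d.δ) (d.w l) := fun l => RB.of_GG ((hw d l).2.2.1.of_le (by omega))
  have hPRB : d.RB (Cp * d.δ) d.Pr := RB.of_GG ((hp d).2.2.of_le (by omega))
  have hPRB' := hPRB.rp
  refine ⟨⟨d.w, fun j l => rp (R0 j l), -rp d.Pr, d.w_re, fun i j => rp_re _, (rp_re _).neg, d.w_div, fun i j => ?_,
    fun l => ?_, fun i q => ?_, fun i j => ?_, fun i q => ?_, fun i j => ?_, fun i j q => ?_, fun i j k q => ?_,
    fun i j q => ?_, fun q => ?_, fun j q => ?_, fun q => ?_, fun i q hq => ?_, fun i j q hq => ?_, fun q hq => ?_⟩⟩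
  · have : R0 i j = R0 j i := by
      simp only [hR0, d.E_symm i j, q1s i j, q2s i j, adiv_symm _ i j, S2_eq, mul_comm (d.w i), mul_comm (d.wo i)]
    rw [this]
  · have hv' : ∀ i, IsRe (d.v i + d.w i) := fun i => (d.hvr i).add (d.w_re i)
    have e := congrArg rp (hnew l).1
    rw [rp_add, rp_DD hv', rp_of_re (hv' l), rp_dx, sub_eq_add_neg, rp_add, rp_of_re d.hpr, rp_neg, rp_sum] at e
    simp only [rp_dx] at e
    exact e
  · exact ((hwRB i).1 q).trans (by gcongr; linarith)
  · have h := ((hw d i).2.2.1.1).dx j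
    refine h.mono ?_ hΛ.le
    calc _ = Cw * (√d.δ * d.Λ) := by ring
      _ ≤ _ := by gcongr; linarith
  · refine ((hwRB i).dt (by positivity) q).trans ?_
    calc _ = 4 * Cw * (√d.δ * d.Λ) := by ring
      _ ≤ _ := by gcongr
  · rw [(hnew i).2]
    have h1 : Bd Set.univ (n + 2) (Cw * (√d.δ * d.ν) + 3 * (2 ^ (n + 2) * (Cw * √d.δ * (Cw * √d.δ * d.Λ)))) d.Λ
        (d.Tr i + ∑ j, d.w j * dx j (d.w i)) :=
      (hw d i).2.2.2.add (Bd.sum3 hΛ.le fun k => ((hw d k).2.2.1.1.of_le (by omega)).mul ((hw d i).2.2.1.1.dx k))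
    refine (h1.dx j).mono ?_ hΛ.le
    have k1 : Cw ≤ M := by linarith
    have k2 : 3 * (2 ^ (n + 2) * (Cw * Cw)) ≤ M := by linarith
    calc _ = Cw * (√d.δ * d.ν * d.Λ) + 3 * (2 ^ (n + 2) * (Cw * Cw)) * ((√d.δ * √d.δ) * d.Λ ^ 2) := by ring
      _ = Cw * (√d.δ * d.ν * d.Λ) + 3 * (2 ^ (n + 2) * (Cw * Cw)) * (d.δ * d.Λ ^ 2) := by rw [hss]
      _ ≤ M * (√d.δ * d.ν * d.Λ) + M * (d.δ * d.Λ ^ 2) := by gcongr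
      _ = _ := by ring
  · exact ((rr i j).rp.1 q).trans (by gcongr)
  · exact ((rr i j).rp.2.1 k q).trans (by gcongr)
  · have e : (DD (fun i => d.v i + d.w i) (rp (R0 i j))).ap q = (DD d.v (rp (R0 i j))).ap q +
        ∑ k, (d.w k).ap q * (dx k (rp (R0 i j))).ap q := by
      simp only [DD_apply, ap_add, ap_sum, ap_mul, add_mul, Finset.sum_add_distrib, add_assoc]
    have h2 : ‖∑ k, (d.w k).ap q * (dx k (rp (R0 i j))).ap q‖ ≤ ∑ k : Fin 3, Cw * √d.δ * (Cr * d.er * d.Λ) :=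
      norm_sum_le_of_le _ fun k _ => by
        rw [norm_mul]
        exact mul_le_mul ((hwRB k).1 q) ((rr i j).rp.2.1 k q) (norm_nonneg _) (by positivity)
    simp only [Finset.sum_const, Finset.card_univ, Fintype.card_fin, nsmul_eq_mul] at h2
    push_cast at h2
    change ‖(DD (fun i => d.v i + d.w i) (rp (R0 i j))).ap q‖ ≤ _
    rw [e]
    refine (norm_add_le_of_le ((rr i j).rp.2.2 q) h2).trans ?_
    have y1 : 0 ≤ Cr * (3 * Cw) * d.er * d.ν := by positivity
    have y2 : 0 ≤ Cr * d.er * (√d.δ * d.Λ) := by positivity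
    calc _ ≤ Cr * (1 + 3 * Cw) * d.er * (d.ν + √d.δ * d.Λ) := by linarith
      _ ≤ _ := by gcongr
  · rw [ap_neg, norm_neg]
    exact (hPRB'.1 q).trans (by gcongr; linarith)
  · rw [map_neg, ap_neg, norm_neg]
    refine (hPRB'.2.1 j q).trans ?_
    rw [mul_assoc]; gcongr; linarith
  · rw [map_neg, ap_neg, norm_neg]
    refine (hPRB'.dt (by positivity) q).trans ?_
    calc _ = 4 * Cp * (d.δ * d.Λ) := by ring
      _ ≤ _ := by gcongr
  · exact d.w_supp i q (not_le.2 hq)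
  · have hq' : q ∉ d.TS := not_le.2 hq
    have : (R0 i j).ap q = 0 := by
      have hz : (adiv (fun l => Z1 l + Z2 l) i j).ap q = 0 := by
        have := TB.adiv (t := q.1) (A := 0) (W := fun l => Z1 l + Z2 l) (fun l x => by
          have h' : ((q.1, x) : Pt) ∉ d.TS := hq'
          rw [ap_add, s1Z l _ h', s2Z l _ h']; simp) i j q.2
        rw [mul_zero] at this
        exact norm_le_zero_iff.1 this
      simp only [hR0, ap_add, d.E_time i j hq, S2, ap_mul, d.wc_supp i q hq', d.wc_supp j q hq', s1Q i j q hq', s2Q i j q hq', hz]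
      simp
    change (rp (R0 i j)).ap q = 0
    rw [rp, ap_smul, ap_add, ap_cj, this]; simp
  · rw [ap_neg, rp_supp d.Pr_supp q (not_le.2 hq), neg_zero]

end Dat
end Sm

end

/-! ### Part 18 -/

section

/-- Exponents of the iteration. -/
structure Par where
  β : ℝ
  s : ℝ
  σ : ℝ
  n : ℕ
  β0 : 0 < β
  β1 : β < 1 / 5
  s0 : 0 < s
  s1 : s ≤ 1
  σ0 : 0 < σ
  h1 : 2 * β * (1 + s) + σ < (1 - β) / 2
  h2 : σ * (1 / 2 + s) < s * ((1 - 5 * β) / 2 - 2 * β * s)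
  h3 : 25 ≤ n * s

lemma exists_par {β : ℝ} (h0 : 0 < β) (h1 : β < 1 / 5) : ∃ P : Par, P.β = β := by
  obtain ⟨n, hn⟩ := exists_nat_ge (25 / ((1 - 5 * β) / 4))
  set s : ℝ := (1 - 5 * β) / 4 with hs
  have s0 : 0 < s := by linarith
  have s1 : s ≤ 1 / 4 := by linarith
  have hg : (1 - 5 * β) / 2 - 2 * β * s = s * (2 - 2 * β) := by rw [hs]; ring
  refine ⟨⟨β, s, s * s / 4, n, h0, h1, s0, by linarith, by positivity, ?_, ?_, ?_⟩, rfl⟩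
  · have : s * s ≤ s * (1 / 4) := by gcongr
    nlinarith
  · rw [hg]
    have : 0 < s * s := by positivity
    nlinarith [mul_pos this s0, mul_pos this h0]
  · rwa [div_le_iff₀ s0] at hn

lemma ev_rpow (C : ℝ) {a c : ℝ} (h : a < c) : ∀ᶠ x : ℝ in Filter.atTop, C * x ^ a ≤ x ^ c := by
  have h1 := (tendsto_rpow_atTop (sub_pos.2 h)).eventually_ge_atTop C
  filter_upwards [h1, Filter.eventually_gt_atTop 0] with x hx hx0
  calc C * x ^ a ≤ x ^ (c - a) * x ^ a := by gcongr
    _ = x ^ c := by rw [← Real.rpow_add hx0]; congr 1; ring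

namespace Par
variable (P : Par)
def b : ℝ := 1 + P.s
def eν : ℝ := (1 - P.β) * (1 + P.s / 2)
def eK : ℝ := 1 + P.s * (1 + P.β) / 2
/-- stress exponent -/
def eδ : ℝ := 2 * P.β * P.b + P.σ

structure Num (M x : ℝ) (K Λ : ℕ) : Prop where
  x1 : 1 ≤ x
  xK : x ≤ K
  KΛ : K ≤ Λ
  Lν : 100 * x ^ (1 - P.β) ≤ x ^ P.eν
  νΛ : x ^ P.eν ≤ Λ
  ΛL : Λ * x ^ (1 - P.β) ≤ K * x ^ P.eν
  δ1 : x ^ (-P.eδ) ≤ 1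
  Mδ : M * √(x ^ (-P.eδ)) ≤ (Λ:ℝ) ^ (-P.β) / 2
  ΛΛ : 2 * (Λ:ℝ) ^ (-P.β) ≤ x ^ (-P.β)
  LL : 2 * x ^ (1 - P.β) ≤ (Λ:ℝ) ^ (1 - P.β)
  νL : 2 * x ^ P.eν ≤ (Λ:ℝ) ^ (1 - P.β)
  ν8 : 8 / x ^ P.eν ≤ x ^ (-P.β)
  er : M * (x ^ (-P.eδ) * (x ^ (1 - P.β) / x ^ P.eν + x / K) + x ^ (-P.eδ) * (K / Λ) +
    √(x ^ (-P.eδ)) * x ^ P.eν / Λ + (K / Λ) ^ P.n * Λ ^ 2) ≤ (Λ:ℝ) ^ (-P.eδ)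

lemma eδ_le : P.eδ < 1 / 2 := by
  have := P.h1
  have := P.β0
  unfold eδ b
  linarith
lemma eδ_pos : 0 < P.eδ := by
  have := P.β0
  have := P.s0
  have := P.σ0
  unfold eδ b
  positivity

set_option maxHeartbeats 3200000 in
lemma num {M : ℝ} (hM : 1 ≤ M) : ∀ᶠ x : ℝ in Filter.atTop, ∀ K Λ : ℕ, 2 * x ^ P.eK ≤ K → K ≤ 4 * x ^ P.eK →
    x ^ P.b ≤ Λ → Λ ≤ 2 * x ^ P.b → P.Num M x K Λ := by
  have h1 := P.h1
  have h2 := P.h2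
  have h3 := P.h3
  have β0 := P.β0
  have β1 := P.β1
  have s0 := P.s0
  have s1 := P.s1
  have σ0 := P.σ0
  have dlt := P.eδ_le
  have dpos := P.eδ_pos
  have hbs : 0 < P.β * P.s := by positivity
  have hss : 0 < P.s * P.s := by positivity
  have hbss : 0 < P.β * (P.s * P.s) := by positivity
  have hsσ : 0 < P.s * P.σ := by positivity
  have hbs1 : P.β * P.s < P.s / 5 := by nlinarith
  have hbs2 : P.β * P.s ≤ P.β := by nlinarith
  have e1 := ev_rpow 4 (a := P.eK) (c := P.b) (by unfold eK b; nlinarith)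
  have e2 := ev_rpow 100 (a := 1 - P.β) (c := P.eν) (by unfold eν; nlinarith)
  have e3 := ev_rpow (4 * M) (a := -(P.eδ / 2)) (c := -(P.β * P.b)) (by unfold eδ; linarith)
  have e4 := ev_rpow 2 (a := -(P.β * P.b)) (c := -P.β) (by unfold b; linarith)
  have e5 := ev_rpow 2 (a := 1 - P.β) (c := P.b * (1 - P.β)) (by unfold b; nlinarith)
  have e6 := ev_rpow 2 (a := P.eν) (c := P.b * (1 - P.β)) (by unfold eν b; nlinarith)
  have e7 := ev_rpow 8 (a := -P.eν) (c := -P.β) (by unfold eν; nlinarith)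
  have e8 := ev_rpow (10 * M) (a := -P.eδ + (1 - P.β) - P.eν) (c := -(P.b * P.eδ)) (by unfold eν eδ b at *; nlinarith)
  have e9 := ev_rpow (10 * M) (a := -P.eδ + 1 - P.eK) (c := -(P.b * P.eδ)) (by unfold eK eδ b at *; nlinarith)
  have e10 := ev_rpow (40 * M) (a := -P.eδ + P.eK - P.b) (c := -(P.b * P.eδ)) (by unfold eK eδ b at *; nlinarith)
  have e11 := ev_rpow (10 * M) (a := -(P.eδ / 2) + P.eν - P.b) (c := -(P.b * P.eδ)) (by unfold eν eδ b at *; nlinarith)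
  have e12 := ev_rpow (10 * M * 4 ^ (P.n + 1)) (a := P.n * (P.eK - P.b) + 2 * P.b) (c := -(P.b * P.eδ)) (by
    have : P.n * (P.eK - P.b) ≤ -10 := by
      have : P.eK - P.b = -(P.s * (1 - P.β) / 2) := by unfold eK b; ring
      rw [this]
      nlinarith [mul_le_mul_of_nonneg_right h3 (by linarith : 0 ≤ 1 - P.β)]
    have h4 : P.b ≤ 2 := by unfold b; linarith
    have h5 : 0 ≤ P.b := by unfold b; linarith
    nlinarith)
  filter_upwards [e1, e2, e3, e4, e5, e6, e7, e8, e9, e10, e11, e12, Filter.eventually_ge_atTop 1] with x e1 e2 e3 e4 e5 e6 e7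
    e8 e9 e10 e11 e12 hx1 K Λ hK1 hK2 hΛ1 hΛ2
  clear h1 h2 h3
  have hx0 : 0 < x := by linarith
  have hΛ0 : (0:ℝ) < Λ := lt_of_lt_of_le (by positivity) hΛ1
  have hK0 : (0:ℝ) < K := lt_of_lt_of_le (by positivity) hK1
  have hsq : √(x ^ (-P.eδ)) = x ^ (-(P.eδ / 2)) := by
    rw [Real.sqrt_eq_rpow, ← Real.rpow_mul hx0.le]; congr 1; ring
  have two : ∀ a : ℝ, 0 ≤ a → a ≤ 1 → (1:ℝ) / 2 ≤ 2 ^ (-a) := fun a _ ha => by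
    calc (1:ℝ) / 2 = 2 ^ (-1:ℝ) := by rw [Real.rpow_neg_one]; norm_num
      _ ≤ _ := Real.rpow_le_rpow_of_exponent_le (by norm_num) (by linarith)
  have low : ∀ a : ℝ, 0 ≤ a → a ≤ 1 → 1 / 2 * x ^ (-(P.b * a)) ≤ (Λ:ℝ) ^ (-a) := fun a h0 h1 => by
    calc 1 / 2 * x ^ (-(P.b * a)) ≤ 2 ^ (-a) * x ^ (-(P.b * a)) := by gcongr; exact two a h0 h1
      _ = (2 * x ^ P.b) ^ (-a) := by
        rw [Real.mul_rpow (by norm_num) (by positivity), ← Real.rpow_mul hx0.le]; congr 2; ring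
      _ ≤ _ := Real.rpow_le_rpow_of_nonpos hΛ0 hΛ2 (by linarith)
  have hup : x ^ (P.b * (1 - P.β)) ≤ (Λ:ℝ) ^ (1 - P.β) := by
    rw [Real.rpow_mul hx0.le]
    exact Real.rpow_le_rpow (by positivity) hΛ1 (by linarith)
  have hM0 : 0 ≤ M := by linarith
  refine ⟨hx1, ?_, ?_, e2, ?_, ?_, ?_, ?_, ?_, e5.trans hup, e6.trans hup, ?_, ?_⟩
  · have : x ^ (1:ℝ) ≤ x ^ P.eK := Real.rpow_le_rpow_of_exponent_le hx1 (by unfold eK; nlinarith)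
    rw [Real.rpow_one] at this
    linarith
  · have : (K:ℝ) ≤ Λ := by linarith
    exact_mod_cast this
  · refine le_trans ?_ hΛ1
    exact Real.rpow_le_rpow_of_exponent_le hx1 (by unfold eν b; nlinarith)
  · calc (Λ:ℝ) * x ^ (1 - P.β) ≤ 2 * x ^ P.b * x ^ (1 - P.β) := by gcongr
      _ = 2 * (x ^ P.eK * x ^ P.eν) := by
        rw [mul_assoc, ← Real.rpow_add hx0, ← Real.rpow_add hx0]; congr 2; unfold b eK eν; ring
      _ = 2 * x ^ P.eK * x ^ P.eν := by ring
      _ ≤ _ := by gcongr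
  · exact Real.rpow_le_one_of_one_le_of_nonpos hx1 (by linarith)
  · rw [hsq]
    have := low P.β (by linarith) (by linarith)
    rw [mul_comm P.b] at this
    linarith
  · refine le_trans ?_ e4
    have : (Λ:ℝ) ^ (-P.β) ≤ (x ^ P.b) ^ (-P.β) := Real.rpow_le_rpow_of_nonpos (by positivity) hΛ1 (by linarith)
    rw [← Real.rpow_mul hx0.le, show P.b * -P.β = -(P.β * P.b) by ring] at this
    linarith
  · rw [div_eq_mul_inv, ← Real.rpow_neg hx0.le]
    exact e7
  · refine le_trans ?_ (low P.eδ (by linarith) (by linarith))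
    rw [hsq]
    set t := x ^ (-(P.b * P.eδ)) with ht
    have t1 : x ^ (-P.eδ) * (x ^ (1 - P.β) / x ^ P.eν) = x ^ (-P.eδ + (1 - P.β) - P.eν) := by
      rw [← Real.rpow_sub hx0, ← Real.rpow_add hx0]; congr 1; ring
    have t2 : x ^ (-P.eδ) * (x / K) ≤ x ^ (-P.eδ + 1 - P.eK) := by
      calc x ^ (-P.eδ) * (x / K) ≤ x ^ (-P.eδ) * (x / x ^ P.eK) := by
            gcongr
            have : 0 ≤ x ^ P.eK := by positivity
            linarith
        _ = _ := by
          nth_rewrite 2 [← Real.rpow_one x]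
          rw [← Real.rpow_sub hx0, ← Real.rpow_add hx0]; congr 1; ring
    have q : (K:ℝ) / Λ ≤ 4 * x ^ (P.eK - P.b) := by
      calc (K:ℝ) / Λ ≤ 4 * x ^ P.eK / x ^ P.b := by gcongr
        _ = _ := by rw [Real.rpow_sub hx0]; ring
    have t3 : x ^ (-P.eδ) * (K / Λ) ≤ 4 * x ^ (-P.eδ + P.eK - P.b) := by
      calc x ^ (-P.eδ) * (K / Λ) ≤ x ^ (-P.eδ) * (4 * x ^ (P.eK - P.b)) := by gcongr
        _ = 4 * (x ^ (-P.eδ) * x ^ (P.eK - P.b)) := by ring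
        _ = _ := by rw [← Real.rpow_add hx0]; congr 2; ring
    have t4 : x ^ (-(P.eδ / 2)) * x ^ P.eν / Λ ≤ x ^ (-(P.eδ / 2) + P.eν - P.b) := by
      calc x ^ (-(P.eδ / 2)) * x ^ P.eν / Λ ≤ x ^ (-(P.eδ / 2)) * x ^ P.eν / x ^ P.b := by gcongr
        _ = _ := by rw [← Real.rpow_add hx0, ← Real.rpow_sub hx0]
    have t5 : ((K:ℝ) / Λ) ^ P.n * Λ ^ 2 ≤ 4 ^ (P.n + 1) * x ^ (P.n * (P.eK - P.b) + 2 * P.b) := by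
      calc ((K:ℝ) / Λ) ^ P.n * Λ ^ 2 ≤ (4 * x ^ (P.eK - P.b)) ^ P.n * (2 * x ^ P.b) ^ 2 := by gcongr
        _ = 4 ^ (P.n + 1) * ((x ^ (P.eK - P.b)) ^ (P.n:ℝ) * (x ^ P.b) ^ (2:ℝ)) := by
          rw [Real.rpow_natCast, Real.rpow_two]; ring
        _ = _ := by
          rw [← Real.rpow_mul hx0.le, ← Real.rpow_mul hx0.le, ← Real.rpow_add hx0]; congr 2; ring
    have := mul_le_mul_of_nonneg_left t2 hM0
    have := mul_le_mul_of_nonneg_left t3 hM0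
    have := mul_le_mul_of_nonneg_left t4 hM0
    have := mul_le_mul_of_nonneg_left t5 hM0
    have ht0 : 0 < t := by positivity
    rw [mul_add (x ^ (-P.eδ)), t1]
    linarith
end Par

end

/-! ### Part 19 -/

section

namespace Sm

/-- A stage of the iteration at frequency `x`. -/
structure St (P : Par) (x : ℝ) where
  v : Fin 3 → Sm
  R : Fin 3 → Fin 3 → Sm
  p : Sm
  hvr : ∀ i, IsRe (v i)
  hRr : ∀ i j, IsRe (R i j)
  hpr : IsRe p
  hdiv : ∑ j, dx j (v j) = 0
  heq : ∀ l, DD v (v l) + dx l p = ∑ j, dx j (R j l)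
  hsym : ∀ i j, R i j = R j i
  hv1 : ∀ i q, ‖(v i).ap q‖ ≤ 1 - x ^ (-P.β)
  hdv : ∀ i j, Bd Set.univ (P.n + 2) (x ^ (1 - P.β)) x (dx j (v i))
  hdDv : ∀ i j, Bd Set.univ (P.n + 1) ((x ^ (1 - P.β)) ^ 2) x (dx j (DD v (v i)))
  hR : ∀ i j q, ‖(R i j).ap q‖ ≤ x ^ (-P.eδ)
  hdR : ∀ i j k q, ‖(dx k (R i j)).ap q‖ ≤ x ^ (-P.eδ) * x
  hDR : ∀ i j q, ‖(DD v (R i j)).ap q‖ ≤ x ^ (-P.eδ) * x ^ (1 - P.β)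
  vsupp : ∀ i q, 2 - x ^ (-P.β) < |q.1| → (v i).ap q = 0
  Rsupp : ∀ i j q, 2 - x ^ (-P.β) < |q.1| → (R i j).ap q = 0
  psupp : ∀ q, 2 - x ^ (-P.β) < |q.1| → p.ap q = 0

/-- Relation between successive stages. -/
structure Nx {P : Par} {x y : ℝ} (S : St P x) (S' : St P y) : Prop where
  xy : x ≤ y
  half : 2 * y ^ (-P.β) ≤ x ^ (-P.β)
  w0 : ∀ i q, ‖(S'.v i - S.v i).ap q‖ ≤ y ^ (-P.β)
  w1 : ∀ i j q, ‖(dx j (S'.v i - S.v i)).ap q‖ ≤ y ^ (1 - P.β)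
  wt : ∀ i q, ‖(dt (S'.v i - S.v i)).ap q‖ ≤ y ^ (1 - P.β)
  π0 : ∀ q, ‖(S'.p - S.p).ap q‖ ≤ y ^ (-(2 * P.β))
  π1 : ∀ j q, ‖(dx j (S'.p - S.p)).ap q‖ ≤ y ^ (1 - 2 * P.β)
  πt : ∀ q, ‖(dt (S'.p - S.p)).ap q‖ ≤ y ^ (1 - 2 * P.β)

/-- Data of a stage with parameters for the next step. -/
def St.toDat {P : Par} {x : ℝ} (S : St P x) {M : ℝ} {K Λ : ℕ} (h : P.Num M x K Λ) (h2 : 2 ≤ K) (he : Even K) :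
    Dat (P.n + 1) where
  v := S.v
  R := S.R
  p := S.p
  L := x ^ (1 - P.β)
  lam := x
  ν := x ^ P.eν
  δ := x ^ (-P.eδ)
  T := 2 - x ^ (-P.β)
  K := K
  Λ := Λ
  hvr := S.hvr
  hRr := S.hRr
  hpr := S.hpr
  hdiv := S.hdiv
  heq := S.heq
  hsym := S.hsym
  lam1 := h.x1
  L1 := Real.one_le_rpow h.x1 (by linarith [P.β1])
  lamK := h.xK
  K2 := h2
  Ke := he
  KΛ := h.KΛ
  Lν := h.Lν
  νΛ := h.νΛ
  ΛL := h.ΛL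
  δ0 := Real.rpow_pos_of_pos (by linarith [h.x1]) _
  δ1 := h.δ1
  T0 := by
    have := Real.rpow_le_one_of_one_le_of_nonpos (z := -P.β) h.x1 (by linarith [P.β0])
    linarith
  hv1 := fun i q => (S.hv1 i q).trans (by
    have : 0 ≤ x ^ (-P.β) := Real.rpow_nonneg (by linarith [h.x1]) _
    linarith)
  hdv := S.hdv
  hdDv := S.hdDv
  hR := S.hR
  hdR := S.hdR
  hDR := S.hDR
  hsupp := S.Rsupp

lemma St.next (P : Par) : ∃ X : ℝ, ∀ x ≥ X, ∀ S : St P x, ∃ (y : ℝ) (S' : St P y), Nx S S' := by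
  obtain ⟨M, hM, hs⟩ := Dat.step P.n
  obtain ⟨X, hX⟩ := Filter.eventually_atTop.1 (P.num hM)
  refine ⟨max X 1, fun x hx S => ?_⟩
  have hx1 : 1 ≤ x := (le_max_right _ _).trans hx
  have hx0 : 0 < x := by linarith
  have β0 := P.β0
  have β1 := P.β1
  have c1 : 1 ≤ x ^ P.eK := Real.one_le_rpow hx1 (by have := P.s0; unfold Par.eK; positivity)
  have c2 : 1 ≤ x ^ P.b := Real.one_le_rpow hx1 (by have := P.s0; unfold Par.b; positivity)
  have hk1 := Nat.le_ceil (x ^ P.eK)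
  have hk2 := Nat.ceil_lt_add_one (show 0 ≤ x ^ P.eK by linarith)
  have hl1 := Nat.le_ceil (x ^ P.b)
  have hl2 := Nat.ceil_lt_add_one (show 0 ≤ x ^ P.b by linarith)
  set k := ⌈x ^ P.eK⌉₊
  set Λ := ⌈x ^ P.b⌉₊
  have h := hX x ((le_max_left _ _).trans hx) (2 * k) Λ (by push_cast; linarith) (by push_cast; linarith) hl1 (by linarith)
  have k1 : 1 ≤ k := by
    have : (1:ℝ) ≤ k := c1.trans hk1
    exact_mod_cast this
  obtain ⟨o⟩ := hs (S.toDat h (by omega) (even_two_mul k))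
  have hxΛ : x ≤ Λ := h.xK.trans (by exact_mod_cast h.KΛ)
  have hΛ0 : (0:ℝ) < Λ := by linarith
  set δ := x ^ (-P.eδ) with hδ
  set ν := x ^ P.eν with hν
  set L := x ^ (1 - P.β) with hL
  set Y := (Λ:ℝ) ^ (1 - P.β) with hY
  have hδ0 : 0 ≤ δ := by positivity
  have hν0 : 0 < ν := by positivity
  have hL0 : 0 < L := by positivity
  have hY0 : 0 < Y := by positivity
  have Yβ : (Λ:ℝ) ^ (-P.β) * Λ = Y := by
    rw [hY, show 1 - P.β = -P.β + 1 by ring, Real.rpow_add hΛ0, Real.rpow_one]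
  have Yβ2 : (Λ:ℝ) ^ (-P.β) * (Λ:ℝ) ^ (-P.β) = (Λ:ℝ) ^ (-(2 * P.β)) := by
    rw [← Real.rpow_add hΛ0]; congr 1; ring
  have Yβ3 : (Λ:ℝ) ^ (-(2 * P.β)) * Λ = (Λ:ℝ) ^ (1 - 2 * P.β) := by
    rw [show 1 - 2 * P.β = -(2 * P.β) + 1 by ring, Real.rpow_add hΛ0, Real.rpow_one]
  have m1 := h.Mδ
  have m2 : M * (√δ * Λ) ≤ Y / 2 := by
    rw [← Yβ]; nlinarith
  have m0 : √δ * Λ ≤ M * (√δ * Λ) := le_mul_of_one_le_left (by positivity) hM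
  have m3 := h.νL
  have m4 := h.LL
  have m5 : L ^ 2 + M * (√δ * ν * Λ + δ * Λ ^ 2) ≤ Y ^ 2 := by
    have i1 : L ^ 2 ≤ (Y / 2) ^ 2 := by gcongr; linarith
    have i2 : M * (√δ * Λ) * ν ≤ Y / 2 * (Y / 2) := by gcongr; linarith
    have i3 : M * (√δ * Λ) * (√δ * Λ) ≤ Y / 2 * (Y / 2) := by gcongr; linarith
    have i4 : M * (√δ * Λ) * (√δ * Λ) = M * (δ * Λ ^ 2) := by
      calc _ = M * ((√δ * √δ) * Λ ^ 2) := by ring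
        _ = _ := by rw [Real.mul_self_sqrt hδ0]
    nlinarith
  have m6 : M * δ ≤ (Λ:ℝ) ^ (-(2 * P.β)) := by
    have i0 : √δ ≤ M * √δ := le_mul_of_one_le_left (by positivity) hM
    have i1 : 0 ≤ (Λ:ℝ) ^ (-P.β) := by positivity
    have i2 : M * √δ * √δ ≤ (Λ:ℝ) ^ (-P.β) * (Λ:ℝ) ^ (-P.β) := by gcongr <;> linarith
    rwa [mul_assoc, Real.mul_self_sqrt hδ0, Yβ2] at i2
  have m7 : M * (δ * Λ) ≤ (Λ:ℝ) ^ (1 - 2 * P.β) := by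
    rw [← Yβ3, ← mul_assoc]; gcongr
  have m8 := h.er
  have m9 := h.ΛΛ
  have hT : 2 - x ^ (-P.β) + 4 / ν ≤ 2 - (Λ:ℝ) ^ (-P.β) := by
    have := h.ν8
    have e : 8 / ν = 2 * (4 / ν) := by ring
    linarith
  have hν4 : 0 < 4 / ν := by positivity
  let S' : St P Λ :=
    { v := fun i => S.v i + o.w i
      R := o.R
      p := S.p + o.π
      hvr := fun i => (S.hvr i).add (o.hw i)
      hRr := o.hRr
      hpr := S.hpr.add o.hπ
      hdiv := by
        have e1 := S.hdiv
        have e2 := o.hdiv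
        simp only [map_add, Finset.sum_add_distrib]
        rw [e1, e2, add_zero]
      heq := o.heq
      hsym := o.hsym
      hv1 := fun i q => by
        have e1 := S.hv1 i q
        have e2 : ‖(o.w i).ap q‖ ≤ M * √δ := o.w0 i q
        rw [ap_add]
        refine (norm_add_le _ _).trans ?_
        have : 0 ≤ (Λ:ℝ) ^ (-P.β) := by positivity
        linarith
      hdv := fun i j => by
        rw [map_add]
        have e2 : Bd Set.univ (P.n + 2) (M * (√δ * Λ)) Λ (dx j (o.w i)) := o.w1 i j
        exact (((S.hdv i j).mono_μ hL0.le hx0.le hxΛ).add e2).mono (by linarith) hΛ0.le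
      hdDv := fun i j => by
        have e2 : Bd Set.univ (P.n + 1) (M * (√δ * ν * Λ + δ * Λ ^ 2)) Λ
          (dx j (DD (fun i => S.v i + o.w i) (S.v i + o.w i) - DD S.v (S.v i))) := o.Dw i j
        have e3 := (((S.hdDv i j).mono_μ (by positivity) hx0.le hxΛ).add e2).mono m5 hΛ0.le
        rw [← map_add, add_sub_cancel] at e3
        exact e3
      hR := fun i j q => (o.R0 i j q).trans m8
      hdR := fun i j k q => (o.R1 i j k q).trans (mul_le_mul_of_nonneg_right m8 hΛ0.le)
      hDR := fun i j q => (o.DR i j q).trans (by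
        refine mul_le_mul m8 ?_ ?_ (by positivity)
        · show ν + √δ * Λ ≤ Y
          linarith
        · show 0 ≤ ν + √δ * Λ
          positivity)
      vsupp := fun i q hq => by
        rw [ap_add, S.vsupp i q (by linarith), o.wsupp i q (lt_of_le_of_lt hT hq), add_zero]
      Rsupp := fun i j q hq => o.Rsupp i j q (lt_of_le_of_lt hT hq)
      psupp := fun q hq => by
        rw [ap_add, S.psupp q (by linarith), o.πsupp q (lt_of_le_of_lt hT hq), add_zero] }
  have hw : ∀ i, S'.v i - S.v i = o.w i := fun i => add_sub_cancel_left _ _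
  have hp : S'.p - S.p = o.π := add_sub_cancel_left _ _
  refine ⟨Λ, S', hxΛ, m9, fun i q => ?_, fun i j q => ?_, fun i q => ?_, fun q => ?_, fun j q => ?_, fun q => ?_⟩
  · rw [hw]
    have e : ‖(o.w i).ap q‖ ≤ M * √δ := o.w0 i q
    have : 0 ≤ (Λ:ℝ) ^ (-P.β) := by positivity
    linarith
  · rw [hw]
    have e : ‖(dx j (o.w i)).ap q‖ ≤ M * (√δ * Λ) := (o.w1 i j).le (Set.mem_univ q)
    linarith
  · rw [hw]
    have e : ‖(dt (o.w i)).ap q‖ ≤ M * (√δ * Λ) := o.wt i q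
    linarith
  · rw [hp]; exact (o.π0 q).trans m6
  · rw [hp]; exact (o.π1 j q).trans m7
  · rw [hp]; exact (o.πt q).trans m7

end Sm

end

/-! ### Part 20 -/

section

namespace Sm

/-- frequency vector of the initial shear flow -/
def k0 : Fin 3 → ℤ := Pi.single 1 1

/-- building block of the initial shear flow -/
def Sh (m : ℕ) (p : Prof) (c : ℂ) : Sm := rp (c • (tc p 1 0 * Ek m k0))

lemma Sh_re (m p c) : IsRe (Sh m p c) := rp_re _
lemma Sh_dx (m p c j) : dx j (Sh m p c) = Sh m p (c * (Complex.I * ((2 * Real.pi * m : ℝ) : ℂ) * (k0 j : ℂ))) := by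
  rw [Sh, ← rp_dx, (dx j).map_smul, leib, dx_tc, dx_Ek, zero_mul, zero_add, mul_smul_comm, smul_smul, Sh]
lemma Sh_dt_Ek (m : ℕ) : dt (Ek m k0) = 0 := by
  ext ⟨t, x⟩
  have h1 := hasDerivAt_time (Ek m k0) t x
  have h2 : HasDerivAt (fun s : ℝ => (Ek m k0).ap (s, x)) 0 t := by
    simp only [ap_Ek]
    exact hasDerivAt_const _ _
  exact h1.unique h2
lemma Sh_dt (m p c) : dt (Sh m p c) = Sh m p.der c := by
  rw [Sh, ← rp_dt, dt.map_smul, leib, dt_tc, Sh_dt_Ek, mul_zero, add_zero, Complex.ofReal_one, one_smul, Sh]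
lemma Sh_le {m : ℕ} {p : Prof} {C : ℝ} (hC : ∀ y, |p.h y| ≤ C) (c : ℂ) (q : Pt) : ‖(Sh m p c).ap q‖ ≤ C * ‖c‖ := by
  refine rp_le ?_
  rw [ap_smul, ap_mul, norm_mul, norm_mul, norm_Ek, ap_tc, Complex.norm_real, mul_one, mul_comm]
  exact mul_le_mul_of_nonneg_right (hC _) (norm_nonneg _)
lemma Sh_zero (m p) : Sh m p 0 = 0 := by
  rw [Sh, zero_smul]; ext; simp [rp]
lemma Sh_supp (m p c) {q : Pt} (hq : 1 ≤ |q.1|) : (Sh m p c).ap q = 0 := by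
  have : (tc p 1 0).ap q = 0 := by
    rw [ap_tc, p.z _ (by norm_num; linarith), Complex.ofReal_zero]
  rw [Sh, rp, ap_smul, ap_add, ap_cj, ap_smul, ap_mul, this]; simp
lemma Sh_Bd (m : ℕ) {p : Prof} {C : ℝ} (hC : ∀ y, |p.h y| ≤ C) (n : ℕ) : ∀ c : ℂ,
    Bd Set.univ n (C * ‖c‖) (2 * Real.pi * m) (Sh m p c) := by
  have hC0 : 0 ≤ C := (abs_nonneg _).trans (hC 0)
  have hm : 0 ≤ 2 * Real.pi * m := by positivity
  induction n with
  | zero => exact fun c q _ => Sh_le hC c q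
  | succ n ih =>
    refine fun c => ⟨fun q _ => Sh_le hC c q, fun j => ?_⟩
    rw [Sh_dx]
    refine (ih _).mono ?_ hm
    rw [norm_mul, norm_mul, norm_mul, Complex.norm_I, Complex.norm_real, one_mul, Real.norm_of_nonneg hm, mul_assoc C]
    refine mul_le_mul_of_nonneg_left ?_ hC0
    refine mul_le_mul_of_nonneg_left ?_ (norm_nonneg _)
    have : ‖((k0 j : ℤ) : ℂ)‖ ≤ 1 := by
      fin_cases j <;> simp [k0]
    nlinarith

lemma base_le (y : ℝ) : |Prof.base.h y| ≤ 1 := by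
  show |_ * _| ≤ _
  rw [abs_mul]
  exact mul_le_one₀ (Real.abs_sin_le_one _) (abs_nonneg _) (Real.abs_cos_le_one _)

lemma base_zero : Prof.base.h 0 = 1 := by
  show Real.sin (Real.pi / 2 * Real.smoothTransition (3 * 0 + 2)) *
    Real.cos (Real.pi / 2 * Real.smoothTransition (3 * 0 - 1)) = 1
  rw [Real.smoothTransition.one_of_one_le (by norm_num), Real.smoothTransition.zero_of_nonpos (by norm_num)]
  simp

lemma St.start (P : Par) (X : ℝ) : ∃ x ≥ X, 1 ≤ x ∧ ∃ S : St P x, ‖(S.v 0).ap 0‖ = 3 * x ^ (-P.β) ∧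
    S.p = 0 ∧ ∃ B, 0 ≤ B ∧ ∀ i q, ‖(dt (S.v i)).ap q‖ ≤ B := by
  have β0 := P.β0
  have β1 := P.β1
  have dlt := P.eδ_le
  have dpos := P.eδ_pos
  obtain ⟨C1, hC1, h1⟩ := Prof.base.der.bdd
  obtain ⟨C2, hC2, h2⟩ := Prof.base.der.der.bdd
  set C := max C1 C2
  have b1 : ∀ y, |Prof.base.der.h y| ≤ C := fun y => (h1 y).trans (le_max_left _ _)
  have b2 : ∀ y, |Prof.base.der.der.h y| ≤ C := fun y => (h2 y).trans (le_max_right _ _)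
  have hC : 0 ≤ C := hC1.trans (le_max_left _ _)
  have e1 := ev_rpow 4 (a := -P.β) (c := 0) (by linarith)
  have e2 := ev_rpow C (a := 0) (c := 1 - P.β) (by linarith)
  have e3 := ev_rpow (8 * C) (a := -1) (c := -P.eδ) (by linarith)
  obtain ⟨x, ⟨e1, e2, e3, hx⟩, hxX⟩ := ((e1.and (e2.and (e3.and (Filter.eventually_ge_atTop (40:ℝ))))).and
    (Filter.eventually_ge_atTop X)).exists
  refine ⟨x, hxX, by linarith, ?_⟩
  have hx0 : 0 < x := by linarith
  rw [Real.rpow_zero] at e1 e2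
  rw [mul_one] at e2
  rw [Real.rpow_neg_one] at e3
  set m := ⌊x / 20⌋₊
  have m1 : (m:ℝ) ≤ x / 20 := Nat.floor_le (by positivity)
  have m2 : x / 20 < m + 1 := Nat.lt_floor_add_one _
  have m3 : x / 40 ≤ m := by linarith
  set μ := 2 * Real.pi * m with hμ
  have hm0 : (0:ℝ) < m := by linarith
  have μ0 : 0 < μ := by positivity
  have μ1 : 3 * μ ≤ x := by
    have := Real.pi_lt_d2
    rw [hμ]; nlinarith
  have μ2 : x / 8 ≤ μ := by
    have := Real.pi_gt_three
    rw [hμ]; nlinarith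
  set z := x ^ (-P.β) with hz
  have z0 : 0 < z := by positivity
  have zx : z * x = x ^ (1 - P.β) := by
    rw [hz, show 1 - P.β = -P.β + 1 by ring, Real.rpow_add hx0, Real.rpow_one]
  set δ := x ^ (-P.eδ) with hδ
  have δ0 : 0 < δ := by positivity
  have aμ : 3 * z * μ ≤ x ^ (1 - P.β) := by rw [← zx]; nlinarith
  have Cμ : C * (3 * z / μ) ≤ δ := by
    refine le_trans ?_ e3
    have i1 : 3 * z / μ ≤ 1 / (x / 8) := by gcongr; linarith
    calc C * (3 * z / μ) ≤ C * (1 / (x / 8)) := by gcongr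
      _ = _ := by field_simp
  have L1 : 1 ≤ x ^ (1 - P.β) := Real.one_le_rpow (by linarith) (by linarith)
  have hs : 1 ≤ 2 - z := by linarith
  have na : ‖((3 * z : ℝ) : ℂ)‖ = 3 * z := by rw [Complex.norm_real, Real.norm_of_nonneg (by positivity)]
  have nb : ‖-Complex.I * ((3 * z / μ : ℝ) : ℂ)‖ = 3 * z / μ := by
    rw [norm_mul, norm_neg, Complex.norm_I, one_mul, Complex.norm_real, Real.norm_of_nonneg (by positivity)]
  set a : ℂ := ((3 * z : ℝ) : ℂ) with ha
  set c : ℂ := -Complex.I * ((3 * z / μ : ℝ) : ℂ) with hc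
  have hcμ : c * (Complex.I * ((2 * Real.pi * m : ℝ) : ℂ) * ((k0 1 : ℤ) : ℂ)) = a := by
    have : (μ:ℂ) ≠ 0 := by exact_mod_cast μ0.ne'
    rw [← hμ, hc, ha]
    simp only [k0, Pi.single_eq_same, Int.cast_one, mul_one]
    push_cast
    field_simp
    rw [Complex.I_sq]; ring
  have d0 : ∀ p c', dx 0 (Sh m p c') = 0 := fun p c' => by
    rw [Sh_dx]; simp [k0, Sh_zero]
  set V : Fin 3 → Sm := ![Sh m Prof.base a, 0, 0] with hV
  have hDD : ∀ p c', DD V (Sh m p c') = Sh m p.der c' := fun p c' => by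
    rw [DD_apply, Sh_dt, Fin.sum_univ_three, d0]; simp [hV]
  have hμ0 : (0:ℝ) ≤ 2 * Real.pi * m := μ0.le
  set F := Sh m Prof.base.der c with hF
  have hFx : ∀ k q, ‖(dx k F).ap q‖ ≤ δ * x := fun k q => by
    have i := ((Sh_Bd m b1 1 c).2 k)
    have i2 : ‖(dx k F).ap q‖ ≤ C * ‖c‖ * (2 * Real.pi * m) := i q (Set.mem_univ q)
    rw [nb] at i2
    refine i2.trans ?_
    rw [← hμ]
    gcongr
    linarith
  have hF0 : ∀ q, ‖F.ap q‖ ≤ δ := fun q => (Sh_le b1 c q).trans (by rwa [nb])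
  have hFD : ∀ q, ‖(DD V F).ap q‖ ≤ δ * x ^ (1 - P.β) := fun q => by
    rw [hF, hDD]
    refine (Sh_le b2 c q).trans ?_
    rw [nb]
    nlinarith
  refine ⟨⟨V, ![![0, F, 0], ![F, 0, 0], ![0, 0, 0]], 0, ?_, ?_, ?_, ?_, ?_, ?_, ?_, ?_, ?_, ?_, ?_, ?_, ?_, ?_, ?_⟩, ?_, rfl, C * ‖a‖, by positivity, ?_⟩
  · have : IsRe (0 : Sm) := by ext; simp
    intro i
    fin_cases i
    · exact Sh_re _ _ _
    · exact this
    · exact this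
  · have : IsRe (0 : Sm) := by ext; simp
    have hh : IsRe F := Sh_re _ _ _
    intro i j
    fin_cases i <;> fin_cases j <;> first | exact this | exact hh
  · ext; simp
  · rw [Fin.sum_univ_three]
    show dx 0 (Sh m Prof.base a) + dx 1 (0 : Sm) + dx 2 (0 : Sm) = 0
    rw [d0]; simp
  · intro l
    rw [Fin.sum_univ_three]
    fin_cases l
    · show DD V (Sh m Prof.base a) + dx 0 (0 : Sm) = dx 0 (0 : Sm) + dx 1 F + dx 2 (0 : Sm)
      rw [hDD, hF, Sh_dx, hcμ]; simp
    · show DD V (0 : Sm) + dx 1 (0 : Sm) = dx 0 F + dx 1 (0 : Sm) + dx 2 (0 : Sm)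
      rw [hF, d0]; simp
    · show DD V (0 : Sm) + dx 2 (0 : Sm) = dx 0 (0 : Sm) + dx 1 (0 : Sm) + dx 2 (0 : Sm)
      simp
  · intro i j
    fin_cases i <;> fin_cases j <;> rfl
  · intro i q
    have : (0:ℝ) ≤ 1 - z := by linarith
    fin_cases i
    · refine (Sh_le base_le a q).trans ?_
      rw [na]; linarith
    · simpa [hV] using this
    · simpa [hV] using this
  · intro i j
    have h0 : Bd Set.univ (P.n + 2) (x ^ (1 - P.β)) x (dx j (0 : Sm)) := by
      rw [map_zero]; exact Bd.zero (by positivity) hx0.le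
    fin_cases i
    · have i1 := (Sh_Bd m base_le (P.n + 3) a).2 j
      rw [na, one_mul, ← hμ] at i1
      exact (i1.mono aμ μ0.le).mono_μ (by positivity) μ0.le (by linarith)
    · exact h0
    · exact h0
  · intro i j
    have h0 : Bd Set.univ (P.n + 1) ((x ^ (1 - P.β)) ^ 2) x (dx j (DD V (0 : Sm))) := by
      rw [map_zero, map_zero]; exact Bd.zero (by positivity) hx0.le
    fin_cases i
    · have i1 := (Sh_Bd m b1 (P.n + 2) a).2 j
      rw [na, ← hμ, ← hDD] at i1
      refine (i1.mono ?_ μ0.le).mono_μ (by positivity) μ0.le (by linarith)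
      rw [sq, mul_assoc]
      gcongr
    · exact h0
    · exact h0
  · intro i j q
    fin_cases i <;> fin_cases j <;> first | exact hF0 q | simpa using δ0.le
  · intro i j k q
    have : 0 ≤ δ * x := by positivity
    fin_cases i <;> fin_cases j <;> first | exact hFx k q | simpa using this
  · intro i j q
    have : 0 ≤ δ * x ^ (1 - P.β) := by positivity
    fin_cases i <;> fin_cases j <;> first | exact hFD q | simpa using this
  · intro i q hq
    fin_cases i
    · exact Sh_supp _ _ _ (by linarith)
    · rfl
    · rfl
  · intro i j q hq
    have : F.ap q = 0 := Sh_supp _ _ _ (by linarith)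
    fin_cases i <;> fin_cases j <;> first | exact this | rfl
  · intro q _; rfl
  · show ‖(Sh m Prof.base a).ap 0‖ = 3 * z
    have h1 : (Sh m Prof.base a).ap 0 = a := by
      rw [Sh, rp, ap_smul, ap_add, ap_cj, ap_smul, ap_mul, ap_tc, ap_Ek]
      simp [base_zero, ha]
      rw [show (starRingEnd ℂ) 3 = 3 from Complex.conj_ofNat 3]
      ring
    rw [h1, na]
  · intro i q
    have : 0 ≤ C * ‖a‖ := by positivity
    fin_cases i
    · show ‖(dt (Sh m Prof.base a)).ap q‖ ≤ _
      rw [Sh_dt]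
      exact Sh_le b1 a q
    · simpa [hV] using this
    · simpa [hV] using this

end Sm

end

/-! ### Part 21 -/

section

namespace Sm

lemma St.seq (P : Par) : ∃ (l : ℕ → ℝ) (S : ∀ q, St P (l q)), (∀ q, Nx (S q) (S (q + 1))) ∧ 1 ≤ l 0 ∧
    ‖((S 0).v 0).ap 0‖ = 3 * (l 0) ^ (-P.β) ∧ (S 0).p = 0 ∧ ∃ B, 0 ≤ B ∧ ∀ i q, ‖(dt ((S 0).v i)).ap q‖ ≤ B := by
  obtain ⟨X, hX⟩ := St.next P
  obtain ⟨x, hx, hx1, S0, h0⟩ := St.start P X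
  let Q := Σ x : {x : ℝ // X ≤ x}, St P x.1
  have hn : ∀ s : Q, ∃ s' : Q, Nx s.2 s'.2 := fun ⟨⟨x, hx⟩, S⟩ => by
    obtain ⟨y, S', h⟩ := hX x hx S
    exact ⟨⟨⟨y, hx.trans h.xy⟩, S'⟩, h⟩
  choose nx hnx using hn
  let sq : ℕ → Q := fun n => Nat.rec ⟨⟨x, hx⟩, S0⟩ (fun _ s => nx s) n
  exact ⟨fun n => (sq n).1.1, fun n => (sq n).2, fun q => hnx (sq q), hx1, h0⟩

lemma lip (f : Sm) {B : ℝ} (ht : ∀ q, ‖(dt f).ap q‖ ≤ B) (hx : ∀ j q, ‖(dx j f).ap q‖ ≤ B) (a b : Pt) :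
    ‖f.ap a - f.ap b‖ ≤ 4 * B * dist a b := by
  obtain ⟨t, x⟩ := a
  obtain ⟨t', x'⟩ := b
  have hB : 0 ≤ B := (norm_nonneg _).trans (ht 0)
  have h1 : ‖f.ap (t, x) - f.ap (t', x)‖ ≤ B * ‖t - t'‖ :=
    Convex.norm_image_sub_le_of_norm_hasDerivWithin_le (f := fun s => f.ap (s, x)) (s := Set.univ)
      (fun s _ => (hasDerivAt_time f s x).hasDerivWithinAt) (fun s _ => ht _) convex_univ trivial trivial
  have h2 : ‖f.ap (t', x) - f.ap (t', x')‖ ≤ 3 * B * ‖x - x'‖ := by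
    have := Convex.norm_image_sub_le_of_norm_hasDerivWithin_le (f := fun s : ℝ => f.ap (t', x' + s • (x - x')))
      (s := Set.univ) (x := 0) (y := 1) (C := 3 * B * ‖x - x'‖)
      (fun s _ => (hasDerivAt_line f t' x' (x - x') s).hasDerivWithinAt) (fun s _ => by
        calc _ ≤ ∑ j : Fin 3, ‖x - x'‖ * B := by
              refine norm_sum_le_of_le _ fun j _ => ?_
              rw [norm_mul, Complex.norm_real]
              exact mul_le_mul (norm_le_pi_norm (x - x') j) (hx _ _) (norm_nonneg _) (norm_nonneg _)
          _ = _ := by simp; ring) convex_univ trivial trivial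
    simpa using this
  have d1 : ‖t - t'‖ ≤ dist ((t, x) : Pt) (t', x') := by
    rw [← dist_eq_norm]; exact le_max_left _ _
  have d2 : ‖x - x'‖ ≤ dist ((t, x) : Pt) (t', x') := by
    rw [← dist_eq_norm]; exact le_max_right _ _
  calc _ ≤ ‖f.ap (t, x) - f.ap (t', x)‖ + ‖f.ap (t', x) - f.ap (t', x')‖ := norm_sub_le_norm_sub_add_norm_sub _ _ _
    _ ≤ B * ‖t - t'‖ + 3 * B * ‖x - x'‖ := add_le_add h1 h2
    _ ≤ B * dist ((t, x) : Pt) (t', x') + 3 * B * dist ((t, x) : Pt) (t', x') := by gcongr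
    _ = _ := by ring

lemma interp {z α : ℝ} (hz : 0 ≤ z) (h0 : 0 < α) (h1 : α ≤ 1) : min 1 z ≤ z ^ α := by
  rcases le_total 1 z with h | h
  · exact (min_le_left _ _).trans (Real.one_le_rpow h h0.le)
  · refine (min_le_right _ _).trans ?_
    rcases hz.eq_or_lt with h' | h'
    · rw [← h', Real.zero_rpow h0.ne']
    · calc z = z ^ (1:ℝ) := (Real.rpow_one z).symm
        _ ≤ _ := Real.rpow_le_rpow_of_exponent_ge h' h h1

lemma hol_one (f : Sm) {y α γ : ℝ} (hy : 1 ≤ y) (h0 : 0 < α) (h1 : α ≤ 1)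
    (hf : ∀ q, ‖f.ap q‖ ≤ y ^ (-γ)) (hx : ∀ j q, ‖(dx j f).ap q‖ ≤ y ^ (1 - γ)) (ht : ∀ q, ‖(dt f).ap q‖ ≤ y ^ (1 - γ))
    (a b : Pt) : ‖f.ap a - f.ap b‖ ≤ 4 * y ^ (α - γ) * dist a b ^ α := by
  have hy0 : 0 < y := by linarith
  have l1 := lip f ht hx a b
  have l2 : ‖f.ap a - f.ap b‖ ≤ 2 * y ^ (-γ) := (norm_sub_le _ _).trans (by linarith [hf a, hf b])
  have yy : y ^ (1 - γ) = y ^ (-γ) * y := by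
    rw [show 1 - γ = -γ + 1 by ring, Real.rpow_add hy0, Real.rpow_one]
  have hyg : 0 < y ^ (-γ) := by positivity
  calc ‖f.ap a - f.ap b‖ ≤ 4 * y ^ (-γ) * min 1 (y * dist a b) := by
        rw [mul_min_of_nonneg _ _ (by positivity)]
        refine le_min (by linarith) ?_
        rw [yy] at l1
        linarith
    _ ≤ 4 * y ^ (-γ) * (y * dist a b) ^ α := by
        gcongr
        exact interp (by positivity) h0 h1
    _ = 4 * (y ^ (-γ) * y ^ α) * dist a b ^ α := by
        rw [Real.mul_rpow hy0.le dist_nonneg]; ring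
    _ = _ := by rw [← Real.rpow_add hy0]; congr 3; ring

lemma limit_lem (f : ℕ → Sm) (y : ℕ → ℝ) (hy : ∀ q, 1 ≤ y q) {α γ : ℝ} (h0 : 0 < α) (h1 : α ≤ 1) (hαγ : α ≤ γ)
    (hs : Summable fun q => y (q + 1) ^ (α - γ))
    (hf : ∀ n q, ‖(f (n + 1) - f n).ap q‖ ≤ y (n + 1) ^ (-γ))
    (hx : ∀ n j q, ‖(dx j (f (n + 1) - f n)).ap q‖ ≤ y (n + 1) ^ (1 - γ))
    (ht : ∀ n q, ‖(dt (f (n + 1) - f n)).ap q‖ ≤ y (n + 1) ^ (1 - γ))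
    {B : ℝ} (b0 : ∀ q, ‖(f 0).ap q‖ ≤ B) (bx : ∀ j q, ‖(dx j (f 0)).ap q‖ ≤ B) (bt : ∀ q, ‖(dt (f 0)).ap q‖ ≤ B) :
    ∃ F : Pt → ℂ, (∀ q, Filter.Tendsto (fun n => (f n).ap q) Filter.atTop (nhds (F q))) ∧
      (∃ C, ∀ n q, ‖(f n).ap q‖ ≤ C) ∧ ∃ C, ∀ a b, ‖F a - F b‖ ≤ C * dist a b ^ α := by
  have hB : 0 ≤ B := (norm_nonneg _).trans (b0 0)
  have hy0 : ∀ q, 0 < y q := fun q => by linarith [hy q]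
  have hs' : Summable fun q => y (q + 1) ^ (-γ) := by
    refine Summable.of_nonneg_of_le (fun q => (Real.rpow_pos_of_pos (hy0 _) _).le) (fun q => ?_) hs
    exact Real.rpow_le_rpow_of_exponent_le (hy _) (by linarith)
  have hc : ∀ q, ∃ F, Filter.Tendsto (fun n => (f n).ap q) Filter.atTop (nhds F) := fun q => by
    refine cauchySeq_tendsto_of_complete (cauchySeq_of_dist_le_of_summable _ (fun n => ?_) hs')
    rw [dist_comm, dist_eq_norm]
    exact hf n q
  choose F hF using hc
  refine ⟨F, hF, ⟨B + ∑' n, y (n + 1) ^ (-γ), fun n q => ?_⟩, B * 4 + ∑' n, 4 * y (n + 1) ^ (α - γ), fun a b => ?_⟩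
  · have : ‖(f n).ap q‖ ≤ B + ∑ k ∈ Finset.range n, y (k + 1) ^ (-γ) := by
      induction n with
      | zero => simpa using b0 q
      | succ n ih =>
        rw [Finset.sum_range_succ]
        have e : (f (n + 1)).ap q = (f n).ap q + (f (n + 1) - f n).ap q := by simp
        rw [e]
        have := norm_add_le ((f n).ap q) ((f (n + 1) - f n).ap q)
        linarith [hf n q]
    refine this.trans ?_
    have := hs'.sum_le_tsum (Finset.range n) (fun q _ => (Real.rpow_pos_of_pos (hy0 _) _).le)
    linarith
  · have hs4 : Summable fun n => 4 * y (n + 1) ^ (α - γ) := hs.mul_left 4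
    have hlim := ((hF a).sub (hF b)).norm
    refine le_of_tendsto' hlim fun n => ?_
    have hd : 0 ≤ dist a b ^ α := Real.rpow_nonneg dist_nonneg _
    have : ‖(f n).ap a - (f n).ap b‖ ≤ (B * 4 + ∑ k ∈ Finset.range n, 4 * y (k + 1) ^ (α - γ)) * dist a b ^ α := by
      induction n with
      | zero =>
        have l1 := lip (f 0) bt bx a b
        have l2 : ‖(f 0).ap a - (f 0).ap b‖ ≤ 2 * B := (norm_sub_le _ _).trans (by linarith [b0 a, b0 b])
        rw [Finset.sum_range_zero, add_zero]
        calc _ ≤ B * 4 * min 1 (dist a b) := by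
              rw [mul_min_of_nonneg _ _ (by positivity)]
              exact le_min (by linarith) (by linarith)
          _ ≤ _ := by
              gcongr
              exact interp dist_nonneg h0 h1
      | succ n ih =>
        rw [Finset.sum_range_succ]
        have e : (f (n + 1)).ap a - (f (n + 1)).ap b = ((f n).ap a - (f n).ap b) +
          ((f (n + 1) - f n).ap a - (f (n + 1) - f n).ap b) := by simp; ring
        rw [e]
        have := norm_add_le ((f n).ap a - (f n).ap b) ((f (n + 1) - f n).ap a - (f (n + 1) - f n).ap b)
        have h2 := hol_one (f (n + 1) - f n) (hy (n + 1)) h0 h1 (hf n) (hx n) (ht n) a b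
        linarith
    refine this.trans (mul_le_mul_of_nonneg_right ?_ hd)
    have := hs4.sum_le_tsum (Finset.range n) (fun q _ => by have := hy0 (q + 1); positivity)
    linarith

/-- geometric decay of negative powers along a sequence -/
lemma summ {y : ℕ → ℝ} {β c : ℝ} (hβ : 0 < β) (hc : 0 < c) (hy : ∀ q, 1 ≤ y q)
    (h : ∀ q, 2 * y (q + 1) ^ (-β) ≤ y q ^ (-β)) : Summable fun q => y (q + 1) ^ (-c) := by
  have hy0 : ∀ q, 0 < y q := fun q => by linarith [hy q]
  have h1 : ∀ q, y q ^ (-β) ≤ (1 / 2) ^ q := fun q => by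
    induction q with
    | zero => simpa using Real.rpow_le_one_of_one_le_of_nonpos (hy 0) (by linarith : -β ≤ 0)
    | succ q ih => rw [pow_succ]; linarith [h q]
  have h2 : ∀ q, y q ^ (-c) ≤ ((1 / 2 : ℝ) ^ (c / β)) ^ q := fun q => by
    calc y q ^ (-c) = (y q ^ (-β)) ^ (c / β) := by
          rw [← Real.rpow_mul (hy0 q).le]; congr 1; field_simp
      _ ≤ ((1 / 2) ^ q) ^ (c / β) := by
          have := hy0 q
          refine Real.rpow_le_rpow (by positivity) (h1 q) (by positivity)
      _ = _ := by
          rw [← Real.rpow_natCast, ← Real.rpow_natCast, ← Real.rpow_mul (by norm_num), ← Real.rpow_mul (by norm_num), mul_comm]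
  have hr : ((1 / 2 : ℝ) ^ (c / β)) < 1 := Real.rpow_lt_one (by norm_num) (by norm_num) (by positivity)
  have hg := summable_geometric_of_lt_one (by positivity : 0 ≤ ((1 / 2 : ℝ) ^ (c / β))) hr
  exact Summable.of_nonneg_of_le (fun q => (Real.rpow_pos_of_pos (hy0 _) _).le) (fun q => h2 (q + 1))
    ((summable_nat_add_iff 1).2 hg)

end Sm

end

/-! ### Part 22 -/

section

namespace Sm

/-- measure on the space-time slab -/
def mT (T : ℝ) : Measure Pt := (volume.restrict (Set.Icc (-T) T)).prod (volume.restrict Tdom)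

lemma Tdom_sub : Tdom ⊆ Set.Icc (0 : Spc) 1 := fun x hx =>
  ⟨fun i => (hx i trivial).1, fun i => (hx i trivial).2.le⟩

lemma Tdom_ae : Tdom =ᵐ[volume] Set.Icc (0 : Spc) 1 := by
  have := Measure.univ_pi_Ico_ae_eq_Icc (μ := fun _ : Fin 3 => (volume : Measure ℝ)) (f := (0 : Spc)) (g := 1)
  exact this

lemma mT_eq (T : ℝ) : mT T = volume.restrict (Set.Icc (-T) T ×ˢ Tdom) := by
  rw [mT, Measure.prod_restrict, Measure.volume_eq_prod]

lemma integ {E : Type} [NormedAddCommGroup E] {g : Pt → E} (hg : Continuous g) (T : ℝ) : Integrable g (mT T) := by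
  rw [mT_eq]
  have h : IntegrableOn g (Set.Icc (-T) T ×ˢ Set.Icc (0 : Spc) 1) :=
    hg.continuousOn.integrableOn_compact (isCompact_Icc.prod isCompact_Icc)
  exact h.mono_set (Set.prod_mono le_rfl Tdom_sub)

lemma to_mT {E : Type} [NormedAddCommGroup E] [NormedSpace ℝ E] {g : ℝ → Spc → E}
    (hg : Continuous fun q : Pt => g q.1 q.2) {T : ℝ} (h0 : ∀ t x, T < |t| → g t x = 0) :
    ∫ t, ∫ x in Tdom, g t x = ∫ q, g q.1 q.2 ∂(mT T) := by
  rw [mT, integral_prod _ (integ hg T)]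
  symm
  refine setIntegral_eq_integral_of_forall_compl_eq_zero fun t ht => ?_
  have : T < |t| := by
    by_contra hh
    exact ht (abs_le.1 (not_lt.1 hh))
  simp [h0 t _ this]

lemma int_div (B : Fin 3 → Sm) (t : ℝ) : ∫ x in Tdom, (∑ j, dx j (B j)).ap (t, x) = 0 := by
  rw [setIntegral_congr_set Tdom_ae]
  have hd : ∀ (i : Fin 3) (x : Spc), HasFDerivAt (fun x : Spc => (B i).ap (t, x))
      ((fderiv ℝ (B i).ap (t, x)).comp (ContinuousLinearMap.inr ℝ ℝ Spc)) x := fun i x => by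
    have h1 := ((B i).diff (t, x)).hasFDerivAt
    exact h1.comp x (hasFDerivAt_prodMk_right t x)
  have he : ∀ x : Spc, (∑ j, dx j (B j)).ap (t, x) = ∑ i, ((fderiv ℝ (B i).ap (t, x)).comp
      (ContinuousLinearMap.inr ℝ ℝ Spc)) (Pi.single i 1) := fun x => by
    rw [ap_sum]; rfl
  have hi : IntegrableOn (fun x : Spc => (∑ j, dx j (B j)).ap (t, x)) (Set.Icc 0 1) := by
    have : Continuous (fun x : Spc => (∑ j, dx j (B j)).ap (t, x)) :=
      (∑ j, dx j (B j)).cont.comp (by fun_prop)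
    exact this.continuousOn.integrableOn_compact isCompact_Icc
  simp only [he] at hi ⊢
  rw [integral_divergence_of_hasFDerivAt_off_countable' (0 : Spc) 1 (by intro i; simp) (fun i x => (B i).ap (t, x))
    (fun i x => (fderiv ℝ (B i).ap (t, x)).comp (ContinuousLinearMap.inr ℝ ℝ Spc)) ∅ Set.countable_empty
    (fun i => ((B i).cont.comp (by fun_prop)).continuousOn) (fun x _ i => hd i x) hi]
  refine Finset.sum_eq_zero fun i _ => ?_
  rw [sub_eq_zero]
  congr 1
  funext x
  have hp := (B i).per t (i.insertNth 0 x) (Pi.single i 1)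
  simp only [Pi.one_apply, Pi.zero_apply]
  rw [← hp]
  congr 2
  funext k
  rcases Fin.eq_self_or_eq_succAbove i k with h | ⟨m, h⟩
  · subst h; simp
  · subst h; simp

lemma int_dt (A : Sm) {T : ℝ} (hT : 0 ≤ T) (h : ∀ q : Pt, T ≤ |q.1| → A.ap q = 0) (x : Spc) :
    ∫ t in Set.Icc (-T) T, (dt A).ap (t, x) = 0 := by
  rw [integral_Icc_eq_integral_Ioc, ← intervalIntegral.integral_of_le (by linarith),
    intervalIntegral.integral_eq_sub_of_hasDerivAt (f := fun t => A.ap (t, x)) (fun t _ => hasDerivAt_time A t x)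
    (Continuous.intervalIntegrable ((dt A).cont.comp (by fun_prop)) _ _), h _ (le_abs_self _), h _ (by simpa using le_abs_self (T)), sub_zero]

lemma int_zero (A : Sm) (B : Fin 3 → Sm) {T : ℝ} (hT : 0 ≤ T) (h : ∀ q : Pt, T ≤ |q.1| → A.ap q = 0) :
    ∫ q, (dt A + ∑ j, dx j (B j)).ap q ∂(mT T) = 0 := by
  have i1 := integ (dt A).cont T
  have i2 := integ (∑ j, dx j (B j)).cont T
  simp only [ap_add]
  rw [integral_add i1 i2]
  have e2 : ∫ q, (∑ j, dx j (B j)).ap q ∂(mT T) = 0 := by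
    rw [mT, integral_prod _ i2]
    simp [int_div]
  have e1 : ∫ q, (dt A).ap q ∂(mT T) = 0 := by
    rw [mT, integral_prod_symm _ i1]
    simp [int_dt A hT h]
  rw [e1, e2, add_zero]

/-- weak form of the stage equation -/
lemma weak_id {v Φ : Fin 3 → Sm} {p : Sm} {R : Fin 3 → Fin 3 → Sm} (hdiv : ∑ j, dx j (v j) = 0)
    (heq : ∀ l, DD v (v l) + dx l p = ∑ j, dx j (R j l)) :
    (∑ l, v l * dt (Φ l)) + (∑ j, ∑ l, v j * v l * dx j (Φ l)) + p * ∑ j, dx j (Φ j) =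
    (dt (∑ l, v l * Φ l) + ∑ j, dx j ((∑ l, v j * v l * Φ l) + p * Φ j - ∑ l, R j l * Φ l)) +
      ∑ j, ∑ l, R j l * dx j (Φ l) := by
  have h0 := heq 0
  have h1 := heq 1
  have h2 := heq 2
  simp only [DD_apply, Fin.sum_univ_three] at h0 h1 h2 hdiv
  simp only [map_add, map_sub, leib, Fin.sum_univ_three]
  linear_combination (-Φ 0) * h0 + (-Φ 1) * h1 + (-Φ 2) * h2 -
    (v 0 * Φ 0 + v 1 * Φ 1 + v 2 * Φ 2) * hdiv

lemma div_id {v : Fin 3 → Sm} {Ψ : Sm} (hdiv : ∑ j, dx j (v j) = 0) :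
    ∑ j, v j * dx j Ψ = dt 0 + ∑ j, dx j (v j * Ψ) := by
  simp only [leib, Fin.sum_univ_three, map_zero] at hdiv ⊢
  linear_combination (-Ψ) * hdiv

end Sm

end

/-! ### Part 23 -/

section

namespace Sm

/-- real test function as an element of the algebra -/
def tst (ψ : ℝ → Spc → ℝ) (h : IsTest ψ) : Sm :=
  mk' (fun q => (ψ q.1 q.2 : ℂ)) (Complex.ofRealCLM.contDiff.comp h.1) (fun t x k => by
    have := h.2.1 t x k
    simp only [this])

lemma ap_tst (ψ h) (q : Pt) : (tst ψ h).ap q = (ψ q.1 q.2 : ℂ) := rfl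

lemma tst_fd (ψ : ℝ → Spc → ℝ) (h : IsTest ψ) (q e : Pt) :
    (pdir e (tst ψ h)).ap q = ((fderiv ℝ (fun q : Pt => ψ q.1 q.2) q e : ℝ) : ℂ) := by
  have hd : HasFDerivAt (fun q : Pt => ψ q.1 q.2) (fderiv ℝ (fun q : Pt => ψ q.1 q.2) q) q :=
    (h.1.differentiable (by simp) q).hasFDerivAt
  have h2 : HasFDerivAt (tst ψ h).ap (Complex.ofRealCLM.comp (fderiv ℝ (fun q : Pt => ψ q.1 q.2) q)) q :=
    Complex.ofRealCLM.hasFDerivAt.comp q hd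
  rw [ap_pdir, h2.fderiv]; rfl

lemma tst_dt (ψ h) (t : ℝ) (x : Spc) : (dt (tst ψ h)).ap (t, x) = ((pt ψ t x : ℝ) : ℂ) := by
  have hd : HasFDerivAt (fun q : Pt => ψ q.1 q.2) (fderiv ℝ (fun q : Pt => ψ q.1 q.2) (t, x)) (t, x) :=
    (h.1.differentiable (by simp) _).hasFDerivAt
  have h2 : HasDerivAt (fun s => ψ s x) (fderiv ℝ (fun q : Pt => ψ q.1 q.2) (t, x) (1, 0)) t :=
    HasFDerivAt.comp_hasDerivAt (f := fun s : ℝ => ((s, x) : Pt)) t hd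
      (by simpa using (hasDerivAt_id t).prodMk (hasDerivAt_const t x))
  rw [dt, tst_fd, pt, h2.deriv]

lemma tst_dx (ψ h) (j : Fin 3) (t : ℝ) (x : Spc) : (dx j (tst ψ h)).ap (t, x) = ((pd j (ψ t) x : ℝ) : ℂ) := by
  have hd : HasFDerivAt (fun q : Pt => ψ q.1 q.2) (fderiv ℝ (fun q : Pt => ψ q.1 q.2) (t, x)) (t, x) :=
    (h.1.differentiable (by simp) _).hasFDerivAt
  have h2 : HasFDerivAt (ψ t) ((fderiv ℝ (fun q : Pt => ψ q.1 q.2) (t, x)).comp (ContinuousLinearMap.inr ℝ ℝ Spc)) x :=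
    hd.comp x (hasFDerivAt_prodMk_right t x)
  rw [dx, tst_fd, pd, h2.fderiv]; rfl

lemma tst_supp {ψ : ℝ → Spc → ℝ} {T : ℝ} (hT : ∀ t : ℝ, T < |t| → ∀ x, ψ t x = 0) {t : ℝ} (ht : T < |t|) (x : Spc) :
    pt ψ t x = 0 ∧ ∀ j, pd j (ψ t) x = 0 := by
  constructor
  · have : (fun s => ψ s x) =ᶠ[nhds t] fun _ => 0 := by
      filter_upwards [(isOpen_lt continuous_const continuous_abs).mem_nhds ht] with s hs using hT s hs x
    rw [pt, this.deriv_eq]; simp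
  · intro j
    have : ψ t = fun _ => 0 := funext fun x => hT t ht x
    rw [pd, this]; simp

lemma test_comp {φ : ℝ → Spc → Spc} (h : IsTest φ) (l : Fin 3) : IsTest (fun t x => φ t x l) := by
  refine ⟨(contDiff_apply ℝ ℝ l).comp h.1, fun t x k => ?_, ?_⟩
  · have := h.2.1 t x k
    simp only [this]
  · obtain ⟨T, hT⟩ := h.2.2
    exact ⟨T, fun t ht x => by
      show φ t x l = 0
      rw [hT t ht x]; rfl⟩

lemma dct {T : ℝ} (h : ℕ → Sm) {g : Pt → ℂ} {b : Pt → ℝ} (hb : Continuous b) (hle : ∀ n q, ‖(h n).ap q‖ ≤ b q)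
    (hl : ∀ q, Filter.Tendsto (fun n => (h n).ap q) Filter.atTop (nhds (g q)))
    (h0 : ∀ n, ∫ q, (h n).ap q ∂(mT T) = 0) : ∫ q, g q ∂(mT T) = 0 := by
  have := tendsto_integral_of_dominated_convergence (μ := mT T) b (fun n => (h n).cont.aestronglyMeasurable) (integ hb T)
    (fun n => Filter.Eventually.of_forall (hle n)) (Filter.Eventually.of_forall hl)
  simp only [h0] at this
  exact tendsto_nhds_unique this tendsto_const_nhds

lemma cont_of_hol {F : Pt → ℂ} {C α : ℝ} (hα : 0 < α) (h : ∀ a b, ‖F a - F b‖ ≤ C * dist a b ^ α) : Continuous F := by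
  rw [continuous_iff_continuousAt]
  intro a
  rw [ContinuousAt, tendsto_iff_norm_sub_tendsto_zero]
  refine squeeze_zero (fun _ => norm_nonneg _) (fun b => h b a) ?_
  have h1 : Filter.Tendsto (fun b : Pt => dist b a) (nhds a) (nhds 0) := by
    have := (continuous_id.dist (continuous_const (y := a))).tendsto a
    simpa using this
  have h2 := (h1.rpow_const (Or.inr hα.le : (0:ℝ) ≠ 0 ∨ 0 ≤ α)).const_mul C
  rwa [Real.zero_rpow hα.ne', mul_zero] at h2

lemma weak_limit (v : ℕ → Fin 3 → Sm) (p : ℕ → Sm) (R : ℕ → Fin 3 → Fin 3 → Sm)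
    (hdiv : ∀ n, ∑ j, dx j (v n j) = 0)
    (heq : ∀ n l, DD (v n) (v n l) + dx l (p n) = ∑ j, dx j (R n j l))
    (F : Fin 3 → Pt → ℂ) (G : Pt → ℂ) (hF : ∀ i q, Filter.Tendsto (fun n => (v n i).ap q) Filter.atTop (nhds (F i q)))
    (hG : ∀ q, Filter.Tendsto (fun n => (p n).ap q) Filter.atTop (nhds (G q)))
    (hR : ∀ i j q, Filter.Tendsto (fun n => (R n i j).ap q) Filter.atTop (nhds 0))
    (hFc : ∀ i, Continuous (F i)) (hGc : Continuous G)
    (hFr : ∀ i q, ((F i q).re : ℂ) = F i q) (hGr : ∀ q, ((G q).re : ℂ) = G q)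
    {C : ℝ} (bv : ∀ n i q, ‖(v n i).ap q‖ ≤ C) (bp : ∀ n q, ‖(p n).ap q‖ ≤ C) (bR : ∀ n i j q, ‖(R n i j).ap q‖ ≤ C) :
    IsWeakEuler (fun t x i => (F i (t, x)).re) (fun t x => (G (t, x)).re) := by
  have hC : 0 ≤ C := (norm_nonneg _).trans (bp 0 0)
  constructor
  · intro φ hφ
    obtain ⟨T0, hT0⟩ := hφ.2.2
    set T := max T0 0 + 1 with hT
    have hT0T : T0 < T := by have := le_max_left T0 0; linarith
    have hTp : 0 ≤ T := by have := le_max_right T0 0; linarith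
    let Φ : Fin 3 → Sm := fun l => tst _ (test_comp hφ l)
    have hΦ0 : ∀ (l : Fin 3) (t : ℝ), T0 < |t| → ∀ x, φ t x l = 0 := fun l t ht x => by rw [hT0 t ht x]; rfl
    let gc : Pt → ℂ := fun q => (∑ l, F l q * (dt (Φ l)).ap q) + (∑ j, ∑ l, F j q * F l q * (dx j (Φ l)).ap q) +
      G q * ∑ j, (dx j (Φ j)).ap q
    let g : ℝ → Spc → ℝ := fun t x => ((∑ l, (F l (t, x)).re * pt (fun s y => φ s y l) t x) +
        (∑ j, ∑ l, (F j (t, x)).re * (F l (t, x)).re * pd j (fun y => φ t y l) x) +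
        (G (t, x)).re * ∑ j, pd j (fun y => φ t y j) x)
    have hgg : ∀ q : Pt, ((g q.1 q.2 : ℝ) : ℂ) = gc q := fun ⟨t, x⟩ => by
      simp only [g, gc, Φ, tst_dt, tst_dx]
      push_cast
      simp only [hFr, hGr]
    have hgcc : Continuous gc := by
      have a1 : ∀ l, Continuous (dt (Φ l)).ap := fun l => (dt (Φ l)).cont
      have a2 : ∀ j l, Continuous (dx j (Φ l)).ap := fun j l => (dx j (Φ l)).cont
      fun_prop
    have hgr : ∀ q : Pt, g q.1 q.2 = (gc q).re := fun q => by rw [← hgg, Complex.ofReal_re]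
    have hgc : Continuous fun q : Pt => g q.1 q.2 := by
      simp only [hgr]
      exact Complex.continuous_re.comp hgcc
    show ∫ t, ∫ x in Tdom, g t x = 0
    rw [to_mT (T := T) hgc (fun t x ht => by
      have ht' : T0 < |t| := by linarith
      have s1 : ∀ l, pt (fun s y => φ s y l) t x = 0 := fun l => (tst_supp (hΦ0 l) ht' x).1
      have s2 : ∀ j l, pd j (fun y => φ t y l) x = 0 := fun j l => (tst_supp (hΦ0 l) ht' x).2 j
      simp [g, s1, s2])]
    have key : ∫ q, gc q ∂(mT T) = 0 := by
      refine dct (fun n => dt (∑ l, v n l * Φ l) +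
        ∑ j, dx j ((∑ l, v n j * v n l * Φ l) + p n * Φ j - ∑ l, R n j l * Φ l))
        (b := fun q => (∑ l, C * ‖(dt (Φ l)).ap q‖) + (∑ j, ∑ l, C * C * ‖(dx j (Φ l)).ap q‖) +
          C * ‖∑ j, (dx j (Φ j)).ap q‖ + ∑ j, ∑ l, C * ‖(dx j (Φ l)).ap q‖) ?_ (fun n q => ?_) (fun q => ?_) (fun n => ?_)
      · have a1 : ∀ l, Continuous (dt (Φ l)).ap := fun l => (dt (Φ l)).cont
        have a2 : ∀ j l, Continuous (dx j (Φ l)).ap := fun j l => (dx j (Φ l)).cont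
        fun_prop
      · rw [← sub_eq_of_eq_add (weak_id (hdiv n) (heq n)), ap_sub, ap_add, ap_add, ap_mul]
        simp only [ap_sum]
        refine (norm_sub_le _ _).trans (add_le_add ((norm_add_le _ _).trans (add_le_add ((norm_add_le _ _).trans
          (add_le_add ?_ ?_)) ?_)) ?_)
        · refine norm_sum_le_of_le _ fun l _ => ?_
          rw [ap_mul, norm_mul]
          exact mul_le_mul_of_nonneg_right (bv n l q) (norm_nonneg _)
        · refine norm_sum_le_of_le _ fun j _ => norm_sum_le_of_le _ fun l _ => ?_
          rw [ap_mul, ap_mul, norm_mul, norm_mul]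
          exact mul_le_mul_of_nonneg_right (mul_le_mul (bv n j q) (bv n l q) (norm_nonneg _) hC) (norm_nonneg _)
        · rw [norm_mul]
          exact mul_le_mul_of_nonneg_right (bp n q) (norm_nonneg _)
        · refine norm_sum_le_of_le _ fun j _ => norm_sum_le_of_le _ fun l _ => ?_
          rw [ap_mul, norm_mul]
          exact mul_le_mul_of_nonneg_right (bR n j l q) (norm_nonneg _)
      · have e : ∀ n, (dt (∑ l, v n l * Φ l) +
          ∑ j, dx j ((∑ l, v n j * v n l * Φ l) + p n * Φ j - ∑ l, R n j l * Φ l)).ap q =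
            ((∑ l, (v n l).ap q * (dt (Φ l)).ap q) + (∑ j, ∑ l, (v n j).ap q * (v n l).ap q * (dx j (Φ l)).ap q) +
              (p n).ap q * ∑ j, (dx j (Φ j)).ap q) - ∑ j, ∑ l, (R n j l).ap q * (dx j (Φ l)).ap q := fun n => by
          rw [← sub_eq_of_eq_add (weak_id (hdiv n) (heq n)), ap_sub, ap_add, ap_add, ap_mul]
          simp only [ap_sum, ap_mul]
        simp only [e]
        have hz : gc q = gc q - ∑ j : Fin 3, ∑ l : Fin 3, 0 * (dx j (Φ l)).ap q := by simp
        rw [hz]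
        refine Filter.Tendsto.sub (Filter.Tendsto.add (Filter.Tendsto.add ?_ ?_) ?_) ?_
        · exact tendsto_finsetSum _ fun l _ => (hF l q).mul_const _
        · exact tendsto_finsetSum _ fun j _ => tendsto_finsetSum _ fun l _ => ((hF j q).mul (hF l q)).mul_const _
        · exact (hG q).mul_const _
        · exact tendsto_finsetSum _ fun j _ => tendsto_finsetSum _ fun l _ => (hR j l q).mul_const _
      · refine int_zero _ _ hTp fun q hq => ?_
        rw [ap_sum]
        refine Finset.sum_eq_zero fun l _ => ?_
        rw [ap_mul, ap_tst, hΦ0 l q.1 (by linarith), Complex.ofReal_zero, mul_zero]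
    have k2 : ((∫ q : Pt, g q.1 q.2 ∂(mT T) : ℝ) : ℂ) = 0 := by
      rw [← integral_complex_ofReal]
      simp only [hgg]
      exact key
    exact_mod_cast k2
  · intro ψ hψ
    obtain ⟨T0, hT0⟩ := hψ.2.2
    set T := max T0 0 + 1 with hT
    have hT0T : T0 < T := by have := le_max_left T0 0; linarith
    have hTp : 0 ≤ T := by have := le_max_right T0 0; linarith
    let gc : Pt → ℂ := fun q => ∑ j, F j q * (dx j (tst ψ hψ)).ap q
    let g : ℝ → Spc → ℝ := fun t x => ∑ j, (F j (t, x)).re * pd j (ψ t) x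
    have hgg : ∀ q : Pt, ((g q.1 q.2 : ℝ) : ℂ) = gc q := fun ⟨t, x⟩ => by
      simp only [g, gc, tst_dx]
      push_cast
      simp only [hFr]
    have hgcc : Continuous gc := by
      have a2 : ∀ j, Continuous (dx j (tst ψ hψ)).ap := fun j => (dx j (tst ψ hψ)).cont
      fun_prop
    have hgr : ∀ q : Pt, g q.1 q.2 = (gc q).re := fun q => by rw [← hgg, Complex.ofReal_re]
    have hgc : Continuous fun q : Pt => g q.1 q.2 := by
      simp only [hgr]
      exact Complex.continuous_re.comp hgcc
    show ∫ t, ∫ x in Tdom, g t x = 0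
    rw [to_mT (T := T) hgc (fun t x ht => by
      have ht' : T0 < |t| := by linarith
      have s2 : ∀ j, pd j (ψ t) x = 0 := (tst_supp hT0 ht' x).2
      simp [g, s2])]
    have key : ∫ q, gc q ∂(mT T) = 0 := by
      refine dct (fun n => dt 0 + ∑ j, dx j (v n j * tst ψ hψ))
        (b := fun q => ∑ j, C * ‖(dx j (tst ψ hψ)).ap q‖) ?_ (fun n q => ?_) (fun q => ?_) (fun n => ?_)
      · have a2 : ∀ j, Continuous (dx j (tst ψ hψ)).ap := fun j => (dx j (tst ψ hψ)).cont
        fun_prop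
      · rw [← div_id (hdiv n), ap_sum]
        refine norm_sum_le_of_le _ fun l _ => ?_
        rw [ap_mul, norm_mul]
        exact mul_le_mul_of_nonneg_right (bv n l q) (norm_nonneg _)
      · simp only [← div_id (hdiv _), ap_sum, ap_mul]
        exact tendsto_finsetSum _ fun l _ => (hF l q).mul_const _
      · exact int_zero _ _ hTp fun q hq => rfl
    have k2 : ((∫ q : Pt, g q.1 q.2 ∂(mT T) : ℝ) : ℂ) = 0 := by
      rw [← integral_complex_ofReal]
      simp only [hgg]
      exact key
    exact_mod_cast k2

end Sm

end

/-! ### Part 24 -/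

section

namespace Sm

theorem final (δ : ℝ) (hδ0 : 0 < δ) (hδ1 : δ < 1/5) :
    ∃ (v : ℝ → Spc → Spc) (p : ℝ → Spc → ℝ),
      (∀ t, Per (v t)) ∧ (∀ t, Per (p t)) ∧
      IsWeakEuler v p ∧
      HolderTS (1/5 - δ) v ∧
      HolderTS (2 * (1/5 - δ)) p ∧
      (∃ t x, v t x ≠ 0) ∧
      (∃ a b : ℝ, a ≤ b ∧ ∀ t, t ∉ Set.Icc a b → ∀ x, v t x = 0 ∧ p t x = 0) := by
  obtain ⟨P, hP⟩ := exists_par (β := 1/5 - δ/2) (by linarith) (by linarith)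
  have hβ : 0 < P.β := by rw [hP]; linarith
  obtain ⟨l, S, hN, hl0, hz, hp0, B, hB, hBt⟩ := St.seq P
  have hl : ∀ q, 1 ≤ l q := fun q => by
    induction q with
    | zero => exact hl0
    | succ q ih => exact ih.trans (hN q).xy
  have hlp : ∀ q c, 0 < l q ^ (c : ℝ) := fun q c => Real.rpow_pos_of_pos (by linarith [hl q]) _
  have hv1 : ∀ n i q, ‖((S n).v i).ap q‖ ≤ 1 := fun n i q => by
    have := (S n).hv1 i q
    have := hlp n (-P.β)
    linarith
  have hs : ∀ c : ℝ, 0 < c → Summable fun q => l (q + 1) ^ (-c) := fun c hc =>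
    summ hβ hc hl (fun q => (hN q).half)
  have hV : ∀ i, _ := fun i => limit_lem (fun n => (S n).v i) l hl (α := 1/5 - δ) (γ := P.β) (by linarith) (by linarith)
    (by rw [hP]; linarith) (by
      have := hs (P.β - (1/5 - δ)) (by rw [hP]; linarith)
      rwa [neg_sub] at this) (fun n q => (hN n).w0 i q) (fun n j q => (hN n).w1 i j q) (fun n q => (hN n).wt i q)
    (B := max 1 (max B (l 0 ^ (1 - P.β)))) (fun q => (hv1 0 i q).trans (le_max_left _ _))
    (fun j q => (((S 0).hdv i j).le (Set.mem_univ q)).trans ((le_max_right _ _).trans (le_max_right _ _)))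
    (fun q => (hBt i q).trans ((le_max_left _ _).trans (le_max_right _ _)))
  choose F hF hFb HF hFh using hV
  obtain ⟨G, hG, ⟨CG, hGb⟩, HG, hGh⟩ := limit_lem (fun n => (S n).p) l hl (α := 2 * (1/5 - δ)) (γ := 2 * P.β) (by linarith)
    (by linarith) (by rw [hP]; linarith) (by
      have := hs (2 * P.β - 2 * (1/5 - δ)) (by rw [hP]; linarith)
      rwa [neg_sub] at this) (fun n q => (hN n).π0 q) (fun n j q => (hN n).π1 j q) (fun n q => (hN n).πt q)
    (B := 0) (fun q => by simp [hp0]) (fun j q => by simp [hp0]) (fun q => by simp [hp0])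
  have hR1 : ∀ n i j q, ‖((S n).R i j).ap q‖ ≤ 1 := fun n i j q =>
    ((S n).hR i j q).trans (Real.rpow_le_one_of_one_le_of_nonpos (hl n) (by linarith [P.eδ_pos]))
  have hR0 : ∀ i j q, Filter.Tendsto (fun n => ((S n).R i j).ap q) Filter.atTop (nhds 0) := fun i j q => by
    have h1 := (hs P.eδ P.eδ_pos).tendsto_atTop_zero
    rw [← Filter.tendsto_add_atTop_iff_nat 1]
    exact squeeze_zero_norm (fun n => (S (n + 1)).hR i j q) h1
  have hre : ∀ (f : ℕ → Sm) (H : Pt → ℂ), (∀ n, IsRe (f n)) →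
      (∀ q, Filter.Tendsto (fun n => (f n).ap q) Filter.atTop (nhds (H q))) → ∀ q, ((H q).re : ℂ) = H q :=
    fun f H hr h q => by
      have h2 : Filter.Tendsto (fun n => (((f n).ap q).re : ℂ)) Filter.atTop (nhds ((H q).re : ℂ)) :=
        ((Complex.continuous_ofReal.comp Complex.continuous_re).tendsto (H q)).comp (h q)
      simp only [(hr _).ofReal] at h2
      exact tendsto_nhds_unique h2 (h q)
  have hper : ∀ (f : ℕ → Sm) (H : Pt → ℂ),
      (∀ q, Filter.Tendsto (fun n => (f n).ap q) Filter.atTop (nhds (H q))) →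
      ∀ (t : ℝ) (x : Spc) (k : Fin 3 → ℤ), H (t, fun i => x i + (k i : ℝ)) = H (t, x) := fun f H h t x k => by
    have h2 := h (t, fun i => x i + (k i : ℝ))
    simp only [Sm.per] at h2
    exact tendsto_nhds_unique h2 (h (t, x))
  have hsup : ∀ (f : ℕ → Sm) (H : Pt → ℂ) (q : Pt), (∀ n, (f n).ap q = 0) →
      (∀ q, Filter.Tendsto (fun n => (f n).ap q) Filter.atTop (nhds (H q))) → H q = 0 := fun f H q h0 h => by
    have h2 := h q
    simp only [h0] at h2
    exact tendsto_nhds_unique h2 tendsto_const_nhds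
  refine ⟨fun t x i => (F i (t, x)).re, fun t x => (G (t, x)).re, ?_, ?_, ?_, ?_, ?_, ?_, ?_⟩
  · intro t x k
    funext i
    show (F i (t, fun i => x i + (k i : ℝ))).re = (F i (t, x)).re
    rw [hper _ _ (hF i)]
  · intro t x k
    show (G (t, fun i => x i + (k i : ℝ))).re = (G (t, x)).re
    rw [hper _ _ hG]
  · exact weak_limit (fun n => (S n).v) (fun n => (S n).p) (fun n => (S n).R) (fun n => (S n).hdiv) (fun n => (S n).heq)
      F G hF hG hR0 (fun i => cont_of_hol (by linarith) (hFh i)) (cont_of_hol (by linarith) hGh)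
      (fun i => hre _ _ (fun n => (S n).hvr i) (hF i)) (hre _ _ (fun n => (S n).hpr) hG) (C := max 1 CG)
      (fun n i q => (hv1 n i q).trans (le_max_left _ _)) (fun n q => (hGb n q).trans (le_max_right _ _))
      (fun n i j q => (hR1 n i j q).trans (le_max_left _ _))
  · refine ⟨∑ i, |HF i|, fun t t' x x' => ?_⟩
    have hd : 0 ≤ dist ((t, x) : ℝ × Spc) ((t', x') : ℝ × Spc) ^ (1/5 - δ) := Real.rpow_nonneg dist_nonneg _
    rw [pi_norm_le_iff_of_nonneg (mul_nonneg (Finset.sum_nonneg fun i _ => abs_nonneg _) hd)]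
    intro i
    show ‖(F i (t, x)).re - (F i (t', x')).re‖ ≤ _
    rw [← Complex.sub_re, Real.norm_eq_abs]
    refine (Complex.abs_re_le_norm _).trans ((hFh i _ _).trans ?_)
    refine mul_le_mul_of_nonneg_right ?_ hd
    exact (le_abs_self _).trans (Finset.single_le_sum (f := fun i => |HF i|) (fun i _ => abs_nonneg _) (Finset.mem_univ i))
  · refine ⟨HG, fun t t' x x' => ?_⟩
    rw [← Complex.sub_re, Real.norm_eq_abs]
    exact (Complex.abs_re_le_norm _).trans (hGh _ _)
  · refine ⟨0, 0, fun h => ?_⟩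
    have h1 : (F 0 0).re = 0 := congrFun h 0
    have h2 : F 0 0 = 0 := by
      rw [← hre _ _ (fun n => (S n).hvr 0) (hF 0) 0, h1]; simp
    have h3 : ∀ n, 2 * l 0 ^ (-P.β) + l n ^ (-P.β) ≤ ‖((S n).v 0).ap 0‖ := fun n => by
      induction n with
      | zero => rw [hz]; linarith
      | succ n ih =>
        have a := (hN n).w0 0 0
        have b := (hN n).half
        rw [ap_sub, norm_sub_rev] at a
        have c := norm_sub_norm_le (((S n).v 0).ap 0) (((S (n + 1)).v 0).ap 0)
        linarith
    have h4 := (hF 0 0).norm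
    rw [h2, norm_zero] at h4
    have h5 := ge_of_tendsto' h4 (b := 2 * l 0 ^ (-P.β)) (fun n => by linarith [h3 n, hlp n (-P.β)])
    linarith [hlp 0 (-P.β)]
  · refine ⟨-2, 2, by norm_num, fun t ht x => ?_⟩
    have ht2 : 2 < |t| := by
      by_contra hc
      exact ht (abs_le.1 (not_lt.1 hc))
    have hq : ∀ n, 2 - l n ^ (-P.β) < |((t, x) : Pt).1| := fun n => by
      have := hlp n (-P.β)
      show _ < |t|
      linarith
    constructor
    · funext i
      show (F i (t, x)).re = 0
      rw [hsup _ _ (t, x) (fun n => (S n).vsupp i _ (hq n)) (hF i)]; rfl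
    · show (G (t, x)).re = 0
      rw [hsup _ _ (t, x) (fun n => (S n).psupp _ (hq n)) hG]; rfl

end Sm

end

end

/-- For every `0 < δ < 1/5` there is a nontrivial weak solution of incompressible
Euler on ℝ×𝕋³, of Hölder class `C^{1/5-δ}` in time and space (with pressure of
class `C^{2(1/5-δ)}`), supported in a compact time interval. -/
theorem euler_onsager_one_fifth (δ : ℝ) (hδ0 : 0 < δ) (hδ1 : δ < 1/5) :
    ∃ (v : ℝ → Spc → Spc) (p : ℝ → Spc → ℝ),
      (∀ t, Per (v t)) ∧ (∀ t, Per (p t)) ∧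
      IsWeakEuler v p ∧
      HolderTS (1/5 - δ) v ∧
      HolderTS (2 * (1/5 - δ)) p ∧
      (∃ t x, v t x ≠ 0) ∧
      (∃ a b : ℝ, a ≤ b ∧ ∀ t, t ∉ Set.Icc a b → ∀ x, v t x = 0 ∧ p t x = 0) := by
  exact Sm.final δ hδ0 hδ1
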